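/- (sl(3) q-Selberg identity with general exponent, as a sum over pairs of partitions.) Let 0 < q < 1, let k1, k2 ≥ 0 be integers, and let γ, α1, α2, β1 be real numbers with γ > 0, α1 > 0, α2 > k1·γ, and β1 + mγ ∉ ℤ for every integer m. Set β2 := γ + 1 − β1. For partitions η = (η_1 ≥ … ≥ η_{k1} ≥ 0) and ν = (ν_1 ≥ … ≥ ν_{k2} ≥ 0) of nonnegative integers, define T(η,ν) := ∏_{i=1}^{k1} q^{η_i α1} (q^{1+(k1−i)γ+η_i}; q)_{β1−1} · ∏_{1≤i<j≤k1} q^{2γ η_j} (1 − q^{(j−i)γ+η_i−η_j}) (q^{1+(j−i−1)γ+η_i−η_j}; q)_{2γ−1} · ∏_{i=1}^{k2} q^{ν_i α2} (q^{1+(k2−i)γ+ν_i}; q)_{β2−1} · ∏_{1≤i<j≤k2} q^{2γ ν_j} (1 − q^{(j−i)γ+ν_i−ν_j}) (q^{1+(j−i−1)γ+ν_i−ν_j}; q)_{2γ−1} · ∏_{i=1}^{k1} ∏_{j=1}^{k2} q^{−γ ν_j} (q^{β1+(k1−k2+j−i)γ+η_i−ν_j}; q)_{−γ}. Then the sum of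 T(η,ν) over all such pairs of partitions (η, ν) converges absolutely and (1−q)^{k1+k2} Σ_{η,ν} T(η,ν) = ∏_{i=1}^{k1} [Γ_q(α1+(k1−i)γ) Γ_q(β1+(i−k2−1)γ) Γ_q(iγ)] / [Γ_q(α1+β1+(2k1−k2−i−1)γ) Γ_q(γ)] · ∏_{i=1}^{k2} [Γ_q(α2+(k2−i)γ) Γ_q(β2+(i−1)γ) Γ_q(iγ)] / [Γ_q(α2+β2+(2k2−k1−i−1)γ) Γ_q(γ)] · ∏_{i=1}^{k1} ∏_{j=1}^{k2} Γ_q(α1+α2+(k1+k2−i−j−1)γ) / Γ_q(α1+α2+(k1+k2−i−j)γ). -/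

import Mathlib

/-- Infinite q-Pochhammer symbol `(a; q)_∞ = ∏_{i≥0} (1 − a q^i)`. -/
noncomputable def qPochInf (a q : ℂ) : ℂ := ∏' i : ℕ, (1 - a * q ^ i)

/-- General q-Pochhammer symbol `(a; q)_z = (a; q)_∞ / (a q^z; q)_∞`, `q^z = exp(z log q)`. -/
noncomputable def qPoch (a q z : ℂ) : ℂ := qPochInf a q / qPochInf (a * q ^ z) q

/-- The q-Gamma function `Γ_q(x) = (q; q)_{x−1} / (1−q)^{x−1}`. -/
noncomputable def qGamma (q x : ℂ) : ℂ := qPoch q q (x - 1) / (1 - q) ^ (x - 1)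

/-- The summand `T(η, ν)` of the sl(3) q-Selberg identity with general exponent `γ`:
`∏_{i=1}^{k1} q^{η_i α1} (q^{1+(k1−i)γ+η_i};q)_{β1−1}
 · ∏_{1≤i<j≤k1} q^{2γη_j} (1−q^{(j−i)γ+η_i−η_j}) (q^{1+(j−i−1)γ+η_i−η_j};q)_{2γ−1}
 · ∏_{i=1}^{k2} q^{ν_i α2} (q^{1+(k2−i)γ+ν_i};q)_{β2−1}
 · ∏_{1≤i<j≤k2} q^{2γν_j} (1−q^{(j−i)γ+ν_i−ν_j}) (q^{1+(j−i−1)γ+ν_i−ν_j};q)_{2γ−1}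
 · ∏_{i=1}^{k1} ∏_{j=1}^{k2} q^{−γν_j} (q^{β1+(k1−k2+j−i)γ+η_i−ν_j};q)_{−γ}`. -/
noncomputable def sl3qSummand (q γ α1 α2 β1 β2 : ℝ) (k1 k2 : ℕ)
    (η : Fin k1 → ℕ) (ν : Fin k2 → ℕ) : ℂ :=
  (∏ i : Fin k1,
      ((q : ℂ) ^ ((((η i : ℝ) * α1 : ℝ)) : ℂ) *
        qPoch ((q : ℂ) ^ (((1 + ((k1 : ℝ) - (((i : ℕ) : ℝ) + 1)) * γ + (η i : ℝ) : ℝ)) : ℂ))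
          q (((β1 - 1 : ℝ)) : ℂ))) *
  (∏ p ∈ Finset.univ.filter (fun p : Fin k1 × Fin k1 => p.1 < p.2),
      ((q : ℂ) ^ (((2 * γ * (η p.2 : ℝ) : ℝ)) : ℂ) *
        (1 - (q : ℂ) ^
          ((((((p.2 : ℕ) : ℝ) - ((p.1 : ℕ) : ℝ)) * γ + (η p.1 : ℝ) - (η p.2 : ℝ) : ℝ)) : ℂ)) *
        qPoch ((q : ℂ) ^
            (((1 + ((((p.2 : ℕ) : ℝ) - ((p.1 : ℕ) : ℝ) - 1)) * γ +
                (η p.1 : ℝ) - (η p.2 : ℝ) : ℝ)) : ℂ))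
          q (((2 * γ - 1 : ℝ)) : ℂ))) *
  (∏ i : Fin k2,
      ((q : ℂ) ^ ((((ν i : ℝ) * α2 : ℝ)) : ℂ) *
        qPoch ((q : ℂ) ^ (((1 + ((k2 : ℝ) - (((i : ℕ) : ℝ) + 1)) * γ + (ν i : ℝ) : ℝ)) : ℂ))
          q (((β2 - 1 : ℝ)) : ℂ))) *
  (∏ p ∈ Finset.univ.filter (fun p : Fin k2 × Fin k2 => p.1 < p.2),
      ((q : ℂ) ^ (((2 * γ * (ν p.2 : ℝ) : ℝ)) : ℂ) *
        (1 - (q : ℂ) ^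
          ((((((p.2 : ℕ) : ℝ) - ((p.1 : ℕ) : ℝ)) * γ + (ν p.1 : ℝ) - (ν p.2 : ℝ) : ℝ)) : ℂ)) *
        qPoch ((q : ℂ) ^
            (((1 + ((((p.2 : ℕ) : ℝ) - ((p.1 : ℕ) : ℝ) - 1)) * γ +
                (ν p.1 : ℝ) - (ν p.2 : ℝ) : ℝ)) : ℂ))
          q (((2 * γ - 1 : ℝ)) : ℂ))) *
  ∏ i : Fin k1, ∏ j : Fin k2,
      ((q : ℂ) ^ (((-γ * (ν j : ℝ) : ℝ)) : ℂ) *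
        qPoch ((q : ℂ) ^
            (((β1 + ((k1 : ℝ) - (k2 : ℝ) + ((j : ℕ) : ℝ) - ((i : ℕ) : ℝ)) * γ +
                (η i : ℝ) - (ν j : ℝ) : ℝ)) : ℂ))
          q (((-γ : ℝ)) : ℂ))

open Polynomial

/-- The interaction of a variable `a` in the first block with a variable `b` in the second. -/
noncomputable def pairFactor (q t a b : ℝ) : ℝ :=
  (b - t * a) * (q * a - t * b) / (t * (b - a) * (q * a - b))

/-- The sum over all ways to split `S` into two blocks, with affine one-body weights. -/
noncomputable def bipartSum {ι : Type*} [DecidableEq ι] (q t : ℝ) (φ ψ : ℝ[X]) (y : ι → ℝ)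
    (S : Finset ι) : ℝ :=
  ∑ P ∈ S.powerset, (∏ i ∈ P, ∏ j ∈ S \ P, pairFactor q t (y i) (y j)) *
    ((∏ i ∈ P, φ.eval (y i)) * ∏ j ∈ S \ P, ψ.eval (y j))

theorem bipartSum_insert {ι : Type*} [DecidableEq ι] (q t : ℝ) (φ ψ : ℝ[X]) (y : ι → ℝ)
    (S : Finset ι) (m : ι) (hm : m ∉ S) :
    bipartSum q t φ ψ y (insert m S) =
    ∑ P ∈ S.powerset, ((∏ i ∈ P, ∏ j ∈ S \ P, pairFactor q t (y i) (y j)) *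
      ((∏ i ∈ P, φ.eval (y i)) * ∏ j ∈ S \ P, ψ.eval (y j))) *
      (φ.eval (y m) * (∏ j ∈ S \ P, pairFactor q t (y m) (y j)) +
       ψ.eval (y m) * ∏ i ∈ P, pairFactor q t (y i) (y m)) := by
  unfold bipartSum
  rw [Finset.sum_powerset_insert hm, ← Finset.sum_add_distrib]
  refine Finset.sum_congr rfl fun P hP => ?_
  have hmP : m ∉ P := fun h => hm (Finset.mem_powerset.1 hP h)
  have e1 : insert m S \ P = insert m (S \ P) := Finset.insert_sdiff_of_notMem _ hmP
  have e2 : insert m S \ insert m P = S \ P := by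
    rw [Finset.insert_sdiff_insert, Finset.sdiff_insert, Finset.erase_eq_of_notMem]
    simp [hm]
  have hm' : m ∉ S \ P := by simp [hm]
  rw [e1, e2]
  simp only [Finset.prod_insert hmP, Finset.prod_insert hm', Finset.prod_mul_distrib]
  ring

/-- Common denominator of the interactions with a fixed variable. -/
noncomputable def pairDen (q y : ℝ) : ℝ[X] := (X - C y) * (X - C (q * y)) * (C q * X - C y)

/-- Numerator of `pairFactor q t z y` over `pairDen`. -/
noncomputable def pairNumLeft (q t y : ℝ) : ℝ[X] :=
  C (-t⁻¹) * (C y - C t * X) * (C q * X - C (t * y)) * (X - C (q * y))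

/-- Numerator of `pairFactor q t y z` over `pairDen`. -/
noncomputable def pairNumRight (q t y : ℝ) : ℝ[X] :=
  C (-t⁻¹) * (X - C (t * y)) * (C (q * y) - C t * X) * (C q * X - C y)

theorem pairNumLeft_eval {q t y z : ℝ} (ht : t ≠ 0) (h1 : z ≠ y) (h3 : q * z ≠ y) :
    (pairNumLeft q t y).eval z = (pairDen q y).eval z * pairFactor q t z y := by
  have h1 : z - y ≠ 0 := sub_ne_zero.2 h1
  have h1' : y - z ≠ 0 := by intro h; apply h1; linarith
  simp only [pairNumLeft, pairDen, pairFactor, eval_mul, eval_sub, eval_C, eval_X]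
  rw [← mul_div_assoc, eq_div_iff (mul_ne_zero (mul_ne_zero ht h1') (sub_ne_zero.2 h3))]
  field_simp
  ring

theorem pairNumRight_eval {q t y z : ℝ} (ht : t ≠ 0) (h1 : z ≠ y) (h3 : z ≠ q * y) :
    (pairNumRight q t y).eval z = (pairDen q y).eval z * pairFactor q t y z := by
  have h1 : z - y ≠ 0 := sub_ne_zero.2 h1
  have h3' : q * y - z ≠ 0 := by intro h; apply h3; linarith
  simp only [pairNumRight, pairDen, pairFactor, eval_mul, eval_sub, eval_C, eval_X]
  rw [← mul_div_assoc, eq_div_iff (mul_ne_zero (mul_ne_zero ht h1) h3')]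
  field_simp
  ring

theorem pairDen_natDegree (q y : ℝ) : (pairDen q y).natDegree ≤ 3 := by
  unfold pairDen; compute_degree

theorem pairNumLeft_natDegree (q t y : ℝ) : (pairNumLeft q t y).natDegree ≤ 3 := by
  unfold pairNumLeft; compute_degree

theorem pairNumRight_natDegree (q t y : ℝ) : (pairNumRight q t y).natDegree ≤ 3 := by
  unfold pairNumRight; compute_degree

theorem pairDen_coeff (q y : ℝ) : (pairDen q y).coeff 3 = q := by
  unfold pairDen; compute_degree!

theorem pairNumLeft_coeff {q t : ℝ} (ht : t ≠ 0) (y : ℝ) : (pairNumLeft q t y).coeff 3 = q := by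
  unfold pairNumLeft; compute_degree!; field_simp

theorem pairNumRight_coeff {q t : ℝ} (ht : t ≠ 0) (y : ℝ) : (pairNumRight q t y).coeff 3 = q := by
  unfold pairNumRight; compute_degree!; field_simp

/-- `bipartSum` over `insert m S`, cleared of denominators, as a polynomial in `y m`. -/
noncomputable def bipartPoly {ι : Type*} [DecidableEq ι] (q t : ℝ) (φ ψ : ℝ[X]) (y : ι → ℝ)
    (S : Finset ι) : ℝ[X] :=
  ∑ P ∈ S.powerset, C ((∏ i ∈ P, ∏ j ∈ S \ P, pairFactor q t (y i) (y j)) *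
      ((∏ i ∈ P, φ.eval (y i)) * ∏ j ∈ S \ P, ψ.eval (y j))) *
      (φ * ((∏ i ∈ P, pairDen q (y i)) * ∏ j ∈ S \ P, pairNumLeft q t (y j)) +
       ψ * ((∏ i ∈ P, pairNumRight q t (y i)) * ∏ j ∈ S \ P, pairDen q (y j)))

section
variable {ι : Type*} [DecidableEq ι] {q t : ℝ}

theorem prod_pair_natDegree {f g : ι → ℝ[X]} (hf : ∀ i, (f i).natDegree ≤ 3)
    (hg : ∀ i, (g i).natDegree ≤ 3) {P S : Finset ι} (hP : P ⊆ S) :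
    ((∏ i ∈ P, f i) * ∏ j ∈ S \ P, g j).natDegree ≤ 3 * S.card := by
  refine natDegree_mul_le.trans ?_
  have h1 := (natDegree_prod_le P f).trans (Finset.sum_le_card_nsmul P _ 3 fun i _ => hf i)
  have h2 := (natDegree_prod_le (S \ P) g).trans
    (Finset.sum_le_card_nsmul (S \ P) _ 3 fun i _ => hg i)
  have h3 := Finset.card_sdiff_add_card_eq_card hP
  simp only [smul_eq_mul] at h1 h2
  omega

theorem prod_pair_coeff {f g : ι → ℝ[X]} (hf : ∀ i, (f i).natDegree ≤ 3)
    (hg : ∀ i, (g i).natDegree ≤ 3) (hf' : ∀ i, (f i).coeff 3 = q)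
    (hg' : ∀ i, (g i).coeff 3 = q) {P S : Finset ι} (hP : P ⊆ S) :
    ((∏ i ∈ P, f i) * ∏ j ∈ S \ P, g j).coeff (3 * S.card) = q ^ S.card := by
  have h3 := Finset.card_sdiff_add_card_eq_card hP
  have e : 3 * S.card = P.card * 3 + (S \ P).card * 3 := by omega
  have d (T : Finset ι) (k : ι → ℝ[X]) (hk : ∀ i, (k i).natDegree ≤ 3) :
      (∏ i ∈ T, k i).natDegree ≤ T.card * 3 :=
    (natDegree_prod_le T k).trans (Finset.sum_le_card_nsmul T _ 3 fun i _ => hk i)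
  rw [e, coeff_mul_add_eq_of_natDegree_le (d P f hf) (d _ g hg),
    coeff_prod_of_natDegree_le _ _ _ fun i _ => hf i,
    coeff_prod_of_natDegree_le _ _ _ fun i _ => hg i]
  simp only [hf', hg', Finset.prod_const, ← pow_add]
  congr 1; omega

theorem bipartPoly_natDegree {φ ψ : ℝ[X]} (hφ : φ.natDegree ≤ 1) (hψ : ψ.natDegree ≤ 1)
    (y : ι → ℝ) (S : Finset ι) : (bipartPoly q t φ ψ y S).natDegree ≤ 1 + 3 * S.card := by
  refine natDegree_sum_le_of_forall_le _ _ fun P hP => ?_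
  have hP := Finset.mem_powerset.1 hP
  refine (natDegree_C_mul_le _ _).trans (natDegree_add_le_of_degree_le ?_ ?_)
  · exact natDegree_mul_le_of_le hφ (prod_pair_natDegree (fun i => pairDen_natDegree q (y i))
      (fun i => pairNumLeft_natDegree q t (y i)) hP)
  · exact natDegree_mul_le_of_le hψ (prod_pair_natDegree
      (fun i => pairNumRight_natDegree q t (y i)) (fun i => pairDen_natDegree q (y i)) hP)

theorem bipartPoly_coeff (ht : t ≠ 0) {φ ψ : ℝ[X]} (hφ : φ.natDegree ≤ 1) (hψ : ψ.natDegree ≤ 1)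
    (y : ι → ℝ) (S : Finset ι) : (bipartPoly q t φ ψ y S).coeff (1 + 3 * S.card) =
      bipartSum q t φ ψ y S * ((φ + ψ).coeff 1 * q ^ S.card) := by
  rw [bipartPoly, bipartSum, finsetSum_coeff, Finset.sum_mul]
  refine Finset.sum_congr rfl fun P hP => ?_
  have hP := Finset.mem_powerset.1 hP
  rw [coeff_C_mul, coeff_add,
    coeff_mul_add_eq_of_natDegree_le hφ (prod_pair_natDegree (fun i => pairDen_natDegree q (y i))
      (fun i => pairNumLeft_natDegree q t (y i)) hP),
    coeff_mul_add_eq_of_natDegree_le hψ (prod_pair_natDegree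
      (fun i => pairNumRight_natDegree q t (y i)) (fun i => pairDen_natDegree q (y i)) hP),
    prod_pair_coeff (fun i => pairDen_natDegree q (y i))
      (fun i => pairNumLeft_natDegree q t (y i)) (fun i => pairDen_coeff q (y i))
      (fun i => pairNumLeft_coeff ht (y i)) hP,
    prod_pair_coeff (fun i => pairNumRight_natDegree q t (y i))
      (fun i => pairDen_natDegree q (y i)) (fun i => pairNumRight_coeff ht (y i))
      (fun i => pairDen_coeff q (y i)) hP, coeff_add]
  ring

theorem bipartPoly_eval_zero (ht : t ≠ 0) (φ ψ : ℝ[X]) (y : ι → ℝ) (S : Finset ι) :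
    (bipartPoly q t φ ψ y S).eval 0 =
      bipartSum q t φ ψ y S * ((φ + ψ).eval 0 * ∏ j ∈ S, (-q * y j ^ 3)) := by
  rw [bipartPoly, bipartSum, eval_finsetSum, Finset.sum_mul]
  refine Finset.sum_congr rfl fun P hP => ?_
  have hP := Finset.mem_powerset.1 hP
  have hD (a : ℝ) : (pairDen q a).eval 0 = -q * a ^ 3 := by simp [pairDen]; ring
  have hL (a : ℝ) : (pairNumLeft q t a).eval 0 = -q * a ^ 3 := by
    simp [pairNumLeft]; field_simp
  have hR (a : ℝ) : (pairNumRight q t a).eval 0 = -q * a ^ 3 := by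
    simp [pairNumRight]; field_simp
  simp only [eval_mul, eval_C, eval_add, eval_prod, hD, hL, hR]
  rw [← Finset.prod_sdiff hP]
  ring

theorem bipartPoly_eval (ht : t ≠ 0) (φ ψ : ℝ[X]) (y : ι → ℝ) (S : Finset ι) (m : ι) (hm : m ∉ S)
    (h1 : ∀ j ∈ S, y m ≠ y j) (h2 : ∀ j ∈ S, y m ≠ q * y j) (h3 : ∀ j ∈ S, q * y m ≠ y j) :
    (bipartPoly q t φ ψ y S).eval (y m) =
      (∏ j ∈ S, (pairDen q (y j)).eval (y m)) * bipartSum q t φ ψ y (insert m S) := by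
  rw [bipartPoly, bipartSum_insert q t φ ψ y S m hm, eval_finsetSum, Finset.mul_sum]
  refine Finset.sum_congr rfl fun P hP => ?_
  have hP := Finset.mem_powerset.1 hP
  simp only [eval_mul, eval_C, eval_add, eval_prod]
  rw [Finset.prod_congr rfl fun j hj => pairNumLeft_eval ht (h1 j (Finset.sdiff_subset hj))
      (h3 j (Finset.sdiff_subset hj)),
    Finset.prod_congr rfl fun j hj => pairNumRight_eval ht (h1 j (hP hj)) (h2 j (hP hj))]
  rw [← Finset.prod_sdiff hP]
  simp only [Finset.prod_mul_distrib]
  ring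

theorem bipartPoly_insert (φ ψ : ℝ[X]) (y : ι → ℝ) (S : Finset ι) (l : ι) (hl : l ∉ S) :
    bipartPoly q t φ ψ y (insert l S) =
    ∑ P ∈ S.powerset, C ((∏ i ∈ P, ∏ j ∈ S \ P, pairFactor q t (y i) (y j)) *
      ((∏ i ∈ P, φ.eval (y i)) * ∏ j ∈ S \ P, ψ.eval (y j))) *
      (C (ψ.eval (y l) * ∏ i ∈ P, pairFactor q t (y i) (y l)) *
        (φ * (pairNumLeft q t (y l) *
            ((∏ i ∈ P, pairDen q (y i)) * ∏ j ∈ S \ P, pairNumLeft q t (y j))) +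
         ψ * (pairDen q (y l) *
            ((∏ i ∈ P, pairNumRight q t (y i)) * ∏ j ∈ S \ P, pairDen q (y j)))) +
       C (φ.eval (y l) * ∏ j ∈ S \ P, pairFactor q t (y l) (y j)) *
        (φ * (pairDen q (y l) *
            ((∏ i ∈ P, pairDen q (y i)) * ∏ j ∈ S \ P, pairNumLeft q t (y j))) +
         ψ * (pairNumRight q t (y l) *
            ((∏ i ∈ P, pairNumRight q t (y i)) * ∏ j ∈ S \ P, pairDen q (y j))))) := by
  unfold bipartPoly
  rw [Finset.sum_powerset_insert hl, ← Finset.sum_add_distrib]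
  refine Finset.sum_congr rfl fun P hP => ?_
  have hlP : l ∉ P := fun h => hl (Finset.mem_powerset.1 hP h)
  have e1 : insert l S \ P = insert l (S \ P) := Finset.insert_sdiff_of_notMem _ hlP
  have e2 : insert l S \ insert l P = S \ P := by
    rw [Finset.insert_sdiff_insert, Finset.sdiff_insert, Finset.erase_eq_of_notMem]
    simp [hl]
  have hl' : l ∉ S \ P := by simp [hl]
  rw [e1, e2]
  simp only [Finset.prod_insert hlP, Finset.prod_insert hl', Finset.prod_mul_distrib, C_mul]
  ring

theorem pairFactor_mul_right (hq : q ≠ 0) (a b : ℝ) :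
    pairFactor q t a (q * b) = pairFactor q t b a := by
  have e1 : (q * b - t * a) * (q * a - t * (q * b)) = q * ((a - t * b) * (q * b - t * a)) := by
    ring
  have e2 : t * (q * b - a) * (q * a - q * b) = q * (t * (a - b) * (q * b - a)) := by ring
  rw [pairFactor, pairFactor, e1, e2, mul_div_mul_left _ _ hq]

theorem bipartPoly_eval_self (ht : t ≠ 0) (φ ψ : ℝ[X]) (y : ι → ℝ) (S : Finset ι) (l : ι)
    (hl : l ∉ S) (h1 : ∀ j ∈ S, y l ≠ y j) (h2 : ∀ j ∈ S, y l ≠ q * y j)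
    (h3 : ∀ j ∈ S, q * y l ≠ y j) :
    (bipartPoly q t φ ψ y (insert l S)).eval (y l) = 0 := by
  rw [bipartPoly_insert φ ψ y S l hl, eval_finsetSum]
  refine Finset.sum_eq_zero fun P hP => ?_
  have hP := Finset.mem_powerset.1 hP
  have hD : (pairDen q (y l)).eval (y l) = 0 := by simp [pairDen]
  have hLR : (pairNumLeft q t (y l)).eval (y l) = - (pairNumRight q t (y l)).eval (y l) := by
    simp [pairNumLeft, pairNumRight]; ring
  simp only [eval_mul, eval_C, eval_add, eval_prod, hD, hLR]
  rw [Finset.prod_congr rfl fun j hj => pairNumLeft_eval ht (h1 j (Finset.sdiff_subset hj))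
      (h3 j (Finset.sdiff_subset hj)),
    Finset.prod_congr rfl fun j hj => pairNumRight_eval ht (h1 j (hP hj)) (h2 j (hP hj))]
  simp only [Finset.prod_mul_distrib]
  ring

theorem bipartPoly_eval_mul (ht : t ≠ 0) (hq : q ≠ 0) (φ ψ : ℝ[X]) (y : ι → ℝ) (S : Finset ι)
    (l : ι) (hl : l ∉ S) (h1 : ∀ j ∈ S, q * y l ≠ y j) (h2 : ∀ j ∈ S, y l ≠ y j) :
    (bipartPoly q t φ ψ y (insert l S)).eval (q * y l) =
      (φ.eval (y l) * ψ.eval (q * y l)) * ((pairNumRight q t (y l)).eval (q * y l) *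
        ∏ j ∈ S, ((pairDen q (y j)).eval (q * y l) * pairFactor q t (y l) (y j))) *
        bipartSum q t φ ψ y S := by
  rw [bipartPoly_insert φ ψ y S l hl, eval_finsetSum, bipartSum, Finset.mul_sum]
  refine Finset.sum_congr rfl fun P hP => ?_
  have hP := Finset.mem_powerset.1 hP
  have hD : (pairDen q (y l)).eval (q * y l) = 0 := by simp [pairDen]
  have hL : (pairNumLeft q t (y l)).eval (q * y l) = 0 := by simp [pairNumLeft]
  simp only [eval_mul (R := ℝ), eval_C, eval_add, eval_prod, hD, hL]
  rw [Finset.prod_congr rfl fun j hj => pairNumRight_eval (q := q) ht (h1 j (hP hj))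
    fun h => h2 j (hP hj) (mul_left_cancel₀ hq h)]
  simp only [pairFactor_mul_right hq]
  rw [← Finset.prod_sdiff hP]
  simp only [Finset.prod_mul_distrib]
  ring

theorem bipartPoly_eval_div (ht : t ≠ 0) (hq : q ≠ 0) (φ ψ : ℝ[X]) (y : ι → ℝ) (S : Finset ι)
    (l : ι) (hl : l ∉ S) (z : ℝ) (hz : q * z = y l) (h1 : ∀ j ∈ S, y l ≠ q * y j)
    (h2 : ∀ j ∈ S, y l ≠ y j) :
    (bipartPoly q t φ ψ y (insert l S)).eval z =
      (φ.eval z * ψ.eval (q * z)) * ((pairNumLeft q t (y l)).eval z *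
        ∏ j ∈ S, ((pairDen q (y j)).eval z * pairFactor q t (y j) (y l))) *
        bipartSum q t φ ψ y S := by
  rw [bipartPoly_insert φ ψ y S l hl, eval_finsetSum, bipartSum, Finset.mul_sum]
  refine Finset.sum_congr rfl fun P hP => ?_
  have hP := Finset.mem_powerset.1 hP
  have hD : (pairDen q (y l)).eval z = 0 := by simp [pairDen, hz]
  have hR : (pairNumRight q t (y l)).eval z = 0 := by simp [pairNumRight, hz]
  simp only [eval_mul, eval_C, eval_add, eval_prod, hD, hR]
  rw [Finset.prod_congr rfl fun j hj => pairNumLeft_eval ht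
    (fun h => h1 j (Finset.sdiff_subset hj) (by rw [← h, hz]))
    (fun h => h2 j (Finset.sdiff_subset hj) (by rw [← h, hz]))]
  rw [← Finset.prod_sdiff hP, ← hz]
  simp only [pairFactor_mul_right hq, Finset.prod_mul_distrib]
  ring

/-- `bipartSum` depends on the affine weights only through `φ + ψ` and `φ(y) ψ(qy)`. -/
theorem bipartSum_congr (ht : t ≠ 0) (hq0 : 0 < q) (hq1 : q < 1) {φ ψ φ' ψ' : ℝ[X]}
    (hφ : φ.natDegree ≤ 1) (hψ : ψ.natDegree ≤ 1) (hφ' : φ'.natDegree ≤ 1)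
    (hψ' : ψ'.natDegree ≤ 1) (hadd : φ + ψ = φ' + ψ')
    (hmul : ∀ a, φ.eval a * ψ.eval (q * a) = φ'.eval a * ψ'.eval (q * a))
    (y : ι → ℝ) (S : Finset ι) (h0 : ∀ i ∈ S, y i ≠ 0)
    (hy1 : ∀ i ∈ S, ∀ j ∈ S, i ≠ j → y i ≠ y j) (hy2 : ∀ i ∈ S, ∀ j ∈ S, i ≠ j → y i ≠ q * y j)
    (hy3 : ∀ i ∈ S, ∀ j ∈ S, i ≠ j → y i ≠ q * (q * y j)) :
    bipartSum q t φ ψ y S = bipartSum q t φ' ψ' y S := by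
  have hq := hq0.ne'
  induction hN : S.card using Nat.strong_induction_on generalizing S with
  | _ N IH =>
  subst hN
  rcases S.eq_empty_or_nonempty with rfl | ⟨m, hmS⟩
  · simp [bipartSum]
  obtain ⟨T, hmT, rfl⟩ : ∃ T, m ∉ T ∧ insert m T = S :=
    ⟨S.erase m, Finset.notMem_erase m S, Finset.insert_erase hmS⟩
  have sub {A : Finset ι} (hA : A ⊆ T) : bipartSum q t φ ψ y A = bipartSum q t φ' ψ' y A := by
    have hA' : A ⊆ insert m T := hA.trans (Finset.subset_insert _ _)
    refine IH A.card ?_ A (fun i hi => h0 i (hA' hi))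
      (fun i hi j hj => hy1 i (hA' hi) j (hA' hj)) (fun i hi j hj => hy2 i (hA' hi) j (hA' hj))
      (fun i hi j hj => hy3 i (hA' hi) j (hA' hj)) rfl
    rw [Finset.card_insert_of_notMem hmT]
    exact Nat.lt_succ_of_le (Finset.card_le_card hA)
  have key : bipartPoly q t φ ψ y T = bipartPoly q t φ' ψ' y T := by
    have hTm {i} (hi : i ∈ T) : i ∈ insert m T := Finset.mem_insert_of_mem hi
    set zs : Finset ℝ := insert 0 (T.image y ∪ (T.image (fun i => q * y i) ∪
      T.image (fun i => q⁻¹ * y i))) with hzs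
    have hqq {i} (hi : i ∈ T) : y i ≠ q * y i := fun h => by
      have : (1 - q) * y i = 0 := by linarith
      rcases mul_eq_zero.1 this with h | h
      · linarith
      · exact h0 i (hTm hi) h
    have hqq2 {i} (hi : i ∈ T) : y i ≠ q * (q * y i) := fun h => by
      have : (1 - q) * (1 + q) * y i = 0 := by linarith
      rcases mul_eq_zero.1 this with h | h
      · rcases mul_eq_zero.1 h with h | h <;> linarith
      · exact h0 i (hTm hi) h
    have g1 {i j} (hi : i ∈ T) (hj : j ∈ T) (h : i ≠ j) := hy1 i (hTm hi) j (hTm hj) h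
    have g2 {i j} (hi : i ∈ T) (hj : j ∈ T) : y i ≠ q * y j := by
      by_cases h : i = j
      · subst h; exact hqq hi
      · exact hy2 i (hTm hi) j (hTm hj) h
    have g3 {i j} (hi : i ∈ T) (hj : j ∈ T) : y i ≠ q * (q * y j) := by
      by_cases h : i = j
      · subst h; exact hqq2 hi
      · exact hy3 i (hTm hi) j (hTm hj) h
    have card : zs.card = 1 + 3 * T.card := by
      have inj : Set.InjOn y T := fun i hi j hj h => by
        by_contra hne; exact g1 hi hj hne h
      rw [hzs, Finset.card_insert_of_notMem, Finset.card_union_of_disjoint,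
        Finset.card_union_of_disjoint, Finset.card_image_of_injOn inj,
        Finset.card_image_of_injOn, Finset.card_image_of_injOn]
      · ring
      · exact fun i hi j hj h => inj hi hj (mul_left_cancel₀ (inv_ne_zero hq) h)
      · exact fun i hi j hj h => inj hi hj (mul_left_cancel₀ hq h)
      · rw [Finset.disjoint_left]
        intro z hz hz'
        obtain ⟨i, hi, rfl⟩ := Finset.mem_image.1 hz
        obtain ⟨j, hj, h⟩ := Finset.mem_image.1 hz'
        refine g3 hj hi ?_
        rw [← h]; field_simp
      · rw [Finset.disjoint_left]
        intro z hz hz'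
        obtain ⟨i, hi, rfl⟩ := Finset.mem_image.1 hz
        rcases Finset.mem_union.1 hz' with hz' | hz' <;>
          obtain ⟨j, hj, h⟩ := Finset.mem_image.1 hz'
        · exact g2 hi hj h.symm
        · refine g2 hj hi ?_
          rw [← h]; field_simp
      · simp only [Finset.mem_union, Finset.mem_image, not_or, not_exists, not_and]
        refine ⟨fun i hi => h0 i (hTm hi), fun i hi h => ?_, fun i hi h => ?_⟩ <;>
          rcases mul_eq_zero.1 h with h | h
        · exact hq h
        · exact h0 i (hTm hi) h
        · exact inv_ne_zero hq h
        · exact h0 i (hTm hi) h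
    refine Polynomial.eq_of_degree_sub_lt_of_eval_finset_eq zs ?_ ?_
    · rw [card]
      have hd := natDegree_sub_le_of_le (bipartPoly_natDegree (q := q) (t := t) hφ hψ y T)
        (bipartPoly_natDegree (q := q) (t := t) hφ' hψ' y T)
      rw [max_self] at hd
      refine (degree_lt_iff_coeff_zero _ _).2 fun k hk => ?_
      rcases hk.eq_or_lt with rfl | hk
      · rw [coeff_sub, bipartPoly_coeff ht hφ hψ, bipartPoly_coeff ht hφ' hψ', hadd,
          sub subset_rfl, sub_self]
      · exact coeff_eq_zero_of_natDegree_lt (hd.trans_lt hk)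
    · intro z hz
      rcases Finset.mem_insert.1 hz with rfl | hz
      · rw [bipartPoly_eval_zero ht, bipartPoly_eval_zero ht, hadd, sub subset_rfl]
      have split {l} (hl : l ∈ T) : ∃ A, l ∉ A ∧ insert l A = T :=
        ⟨T.erase l, Finset.notMem_erase l T, Finset.insert_erase hl⟩
      rcases Finset.mem_union.1 hz with hz | hz
      · obtain ⟨l, hl, rfl⟩ := Finset.mem_image.1 hz
        obtain ⟨A, hlA, hA⟩ := split hl
        have mA {j} (hj : j ∈ A) : j ∈ T := hA ▸ Finset.mem_insert_of_mem hj
        have ne {j} (hj : j ∈ A) : l ≠ j := fun h => hlA (h ▸ hj)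
        rw [← hA]
        rw [bipartPoly_eval_self ht φ ψ y A l hlA (fun j hj => g1 hl (mA hj) (ne hj))
            (fun j hj => g2 hl (mA hj)) (fun j hj => (g2 (mA hj) hl).symm),
          bipartPoly_eval_self ht φ' ψ' y A l hlA (fun j hj => g1 hl (mA hj) (ne hj))
            (fun j hj => g2 hl (mA hj)) (fun j hj => (g2 (mA hj) hl).symm)]
      rcases Finset.mem_union.1 hz with hz | hz <;>
      · obtain ⟨l, hl, rfl⟩ := Finset.mem_image.1 hz
        obtain ⟨A, hlA, hA⟩ := split hl
        have mA {j} (hj : j ∈ A) : j ∈ T := hA ▸ Finset.mem_insert_of_mem hj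
        have ne {j} (hj : j ∈ A) : l ≠ j := fun h => hlA (h ▸ hj)
        have sA := sub (A := A) fun j hj => mA hj
        rw [← hA]
        first
        | rw [bipartPoly_eval_mul ht hq φ ψ y A l hlA (fun j hj => (g2 (mA hj) hl).symm)
              (fun j hj => g1 hl (mA hj) (ne hj)),
            bipartPoly_eval_mul ht hq φ' ψ' y A l hlA (fun j hj => (g2 (mA hj) hl).symm)
              (fun j hj => g1 hl (mA hj) (ne hj)), hmul, sA]
        | rw [bipartPoly_eval_div ht hq φ ψ y A l hlA _ (mul_inv_cancel_left₀ hq _)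
              (fun j hj => g2 hl (mA hj)) (fun j hj => g1 hl (mA hj) (ne hj)),
            bipartPoly_eval_div ht hq φ' ψ' y A l hlA _ (mul_inv_cancel_left₀ hq _)
              (fun j hj => g2 hl (mA hj)) (fun j hj => g1 hl (mA hj) (ne hj)), hmul, sA]
  have hm {j} (hj : j ∈ T) : m ≠ j := fun h => hmT (h ▸ hj)
  have im := Finset.mem_insert_self m T
  have ij {j} (hj : j ∈ T) : j ∈ insert m T := Finset.mem_insert_of_mem hj
  have k1 := fun j (hj : j ∈ T) => hy1 m im j (ij hj) (hm hj)
  have k2 := fun j (hj : j ∈ T) => hy2 m im j (ij hj) (hm hj)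
  have k3 := fun j (hj : j ∈ T) => (hy2 j (ij hj) m im (hm hj).symm).symm
  have e := congrArg (eval (y m)) key
  rw [bipartPoly_eval ht φ ψ y T m hmT k1 k2 k3,
    bipartPoly_eval ht φ' ψ' y T m hmT k1 k2 k3] at e
  refine mul_left_cancel₀ (Finset.prod_ne_zero_iff.2 fun j hj => ?_) e
  simp only [pairDen, eval_mul, eval_sub, eval_C, eval_X]
  exact mul_ne_zero (mul_ne_zero (sub_ne_zero.2 (k1 j hj)) (sub_ne_zero.2 (k2 j hj)))
    (sub_ne_zero.2 (k3 j hj))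
end

/-- Ordered pairs `i < j` in `Fin n`. -/
def ltPairs (n : ℕ) : Finset (Fin n × Fin n) :=
  Finset.univ.filter fun p : Fin n × Fin n => p.1 < p.2

/-- Multiply the coordinates in `J` by `c`. -/
noncomputable def scaleOn {n : ℕ} (c : ℝ) (J : Finset (Fin n)) (y : Fin n → ℝ) : Fin n → ℝ :=
  fun i => if i ∈ J then c * y i else y i

/-- The ratio of Vandermonde products of `scaleOn t J y` and `y`. -/
noncomputable def vdmRatio {n : ℕ} (t : ℝ) (y : Fin n → ℝ) (J : Finset (Fin n)) : ℝ :=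
  ∏ p ∈ ltPairs n, (scaleOn t J y p.2 - scaleOn t J y p.1) / (y p.2 - y p.1)

theorem prod_ltPairs_symm {n : ℕ} (e : Fin n → Fin n → ℝ) (he : ∀ i, e i i = 1) :
    ∏ p ∈ ltPairs n, e p.1 p.2 * e p.2 p.1 = ∏ i, ∏ j, e i j := by
  rw [Finset.prod_mul_distrib]
  have h1 : ∏ i, ∏ j, e i j = ∏ p : Fin n × Fin n, e p.1 p.2 := by
    rw [← Finset.univ_product_univ, Finset.prod_product]
  have h2 : ∏ p ∈ ltPairs n, e p.2 p.1 =
      ∏ p ∈ Finset.univ.filter (fun p : Fin n × Fin n => p.2 < p.1), e p.1 p.2 := by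
    refine Finset.prod_nbij' Prod.swap Prod.swap ?_ ?_ ?_ ?_ ?_ <;> simp [ltPairs]
  have h3 : ∏ p ∈ Finset.univ.filter (fun p : Fin n × Fin n => p.2 < p.1), e p.1 p.2 =
      ∏ p ∈ Finset.univ.filter (fun p : Fin n × Fin n => ¬ p.1 < p.2), e p.1 p.2 := by
    refine Finset.prod_subset (fun p hp => ?_) fun p hp hp' => ?_
    · simp only [Finset.mem_filter, Finset.mem_univ, true_and] at hp ⊢
      exact hp.le.not_gt
    · simp only [Finset.mem_filter, Finset.mem_univ, true_and, not_lt] at hp hp'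
      rw [le_antisymm hp hp', he]
  rw [h1, h2, h3, ltPairs, Finset.prod_filter_mul_prod_filter_not]

/-- The contribution of a pair to the product of two successive `vdmRatio`s. -/
theorem pair_scale_identity {q t a b : ℝ} (ht : t ≠ 0) (hq : q ≠ 0) (h1 : b - a ≠ 0)
    (h2 : q * b - a ≠ 0) (h3 : b - q * a ≠ 0)
    (iD iS iP jD jS jP : Prop) [Decidable iD] [Decidable iS] [Decidable iP]
    [Decidable jD] [Decidable jS] [Decidable jP] (hi : iP → iS) (hj : jP → jS)
    (hi' : iS → ¬ iD) (hj' : jS → ¬ jD) :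
    let f : Prop → Prop → Prop → Prop → ℝ := fun iJ iK jJ jK => by
      classical exact
      ((if jJ then t * b else b) - (if iJ then t * a else a)) / (b - a) *
      (((if jK then t * (if jJ then q * b else b) else (if jJ then q * b else b)) -
        (if iK then t * (if iJ then q * a else a) else (if iJ then q * a else a))) /
        ((if jJ then q * b else b) - (if iJ then q * a else a)))
    f (iD ∨ iP) (iD ∨ (iS ∧ ¬ iP)) (jD ∨ jP) (jD ∨ (jS ∧ ¬ jP)) =
      f iD (iD ∨ iS) jD (jD ∨ jS) *
      ((if iP ∧ (jS ∧ ¬ jP) then pairFactor q t a b else 1) *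
        (if jP ∧ (iS ∧ ¬ iP) then pairFactor q t b a else 1)) := by
  have h4 : a - b ≠ 0 := fun h => h1 (by linarith)
  have h5 : q * a - b ≠ 0 := fun h => h3 (by linarith)
  have h6 : a - q * b ≠ 0 := fun h => h2 (by linarith)
  have h7 : q * b - q * a ≠ 0 := by rw [← mul_sub]; exact mul_ne_zero hq h1
  have h8 : a * q - b ≠ 0 := by rwa [mul_comm]
  have h9 : a - b * q ≠ 0 := by rwa [mul_comm b]
  have h10 : b * q - a ≠ 0 := by rwa [mul_comm]
  have h11 : b - a * q ≠ 0 := by rwa [mul_comm a]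
  have h12 : a * q - b * q ≠ 0 := by rw [← sub_mul]; exact mul_ne_zero h4 hq
  have h13 : b * q - a * q ≠ 0 := by rw [← sub_mul]; exact mul_ne_zero h1 hq
  have h14 : q * a - q * b ≠ 0 := by rw [← mul_sub]; exact mul_ne_zero hq h4
  intro f
  by_cases xiD : iD <;> by_cases xiS : iS <;> by_cases xiP : iP <;>
    by_cases xjD : jD <;> by_cases xjS : jS <;> by_cases xjP : jP <;>
    simp only [xiD, xiS, xiP, xjD, xjS, xjP, not_true, not_false_eq_true, imp_false, true_imp_iff,
      false_imp_iff] at hi hj hi' hj' <;>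
    simp only [f, xiD, xiS, xiP, xjD, xjS, xjP, pairFactor, or_true, or_false, and_true,
      and_false, if_true, if_false, not_true, not_false_eq_true,
      mul_one, one_mul] <;>
    first | rfl | (field_simp; ring) | field_simp

/-- Two successive `vdmRatio`s, with the coordinates in `J` multiplied by `q` in between. -/
theorem vdmRatio_mul_vdmRatio {n : ℕ} {q t : ℝ} (ht : t ≠ 0) (hq : q ≠ 0) {y : Fin n → ℝ}
    (h1 : ∀ i j, i ≠ j → y i ≠ y j) (h2 : ∀ i j, i ≠ j → y i ≠ q * y j)
    {D S P : Finset (Fin n)} (hDS : Disjoint D S) (hP : P ⊆ S) :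
    vdmRatio t y (D ∪ P) * vdmRatio t (scaleOn q (D ∪ P) y) (D ∪ (S \ P)) =
      (vdmRatio t y D * vdmRatio t (scaleOn q D y) (D ∪ S)) *
        ∏ i ∈ P, ∏ j ∈ S \ P, pairFactor q t (y i) (y j) := by
  have e := prod_ltPairs_symm
    (fun i j => if i ∈ P ∧ (j ∈ S ∧ j ∉ P) then pairFactor q t (y i) (y j) else 1)
    (fun i => if_neg fun h => h.2.2 h.1)
  have e' : ∏ i, ∏ j, (if i ∈ P ∧ (j ∈ S ∧ j ∉ P) then pairFactor q t (y i) (y j) else 1) =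
      ∏ i ∈ P, ∏ j ∈ S \ P, pairFactor q t (y i) (y j) := by
    rw [← Finset.prod_subset (Finset.subset_univ P)]
    · refine Finset.prod_congr rfl fun i hi => ?_
      rw [← Finset.prod_subset (Finset.subset_univ (S \ P))]
      · refine Finset.prod_congr rfl fun j hj => ?_
        rw [if_pos ⟨hi, Finset.mem_sdiff.1 hj⟩]
      · intro j _ hj
        rw [if_neg fun h => hj (Finset.mem_sdiff.2 h.2)]
    · intro i _ hi
      exact Finset.prod_eq_one fun j _ => if_neg fun h => hi h.1
  rw [← e', ← e]
  simp only [vdmRatio, ← Finset.prod_mul_distrib]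
  refine Finset.prod_congr rfl fun p hp => ?_
  have hlt : p.1 ≠ p.2 := by
    have := (Finset.mem_filter.1 hp).2
    exact this.ne
  have := pair_scale_identity (a := y p.1) (b := y p.2) ht hq (sub_ne_zero.2 (h1 _ _ hlt.symm))
    (sub_ne_zero.2 (h2 _ _ hlt).symm) (sub_ne_zero.2 (h2 _ _ hlt.symm))
    (p.1 ∈ D) (p.1 ∈ S) (p.1 ∈ P) (p.2 ∈ D) (p.2 ∈ S) (p.2 ∈ P) (fun h => hP h) (fun h => hP h)
    (fun h h' => Finset.disjoint_left.1 hDS h' h) (fun h h' => Finset.disjoint_left.1 hDS h' h)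
  simp only [] at this
  simp only [scaleOn, Finset.mem_union, Finset.mem_sdiff]
  convert this using 3 <;> congr!

/-- The weight of the step `J` of the `q`-shift operator with parameters `s, u, v`. -/
noncomputable def stepWeight {n : ℕ} {R : Type*} [CommRing R] [Algebra ℝ R] (t : ℝ) (s u v : R)
    (y : Fin n → ℝ) (J : Finset (Fin n)) : R :=
  algebraMap ℝ R (vdmRatio t y J) * ((∏ i ∈ J, -s * (1 - v * algebraMap ℝ R (y i))) *
    ∏ i ∈ Jᶜ, (1 - u * algebraMap ℝ R (y i)))

/-- The indicator of `J` as an increment. -/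
def inc {n : ℕ} (J : Finset (Fin n)) : Fin n → ℕ := fun i => if i ∈ J then 1 else 0

theorem sum_filter_inc {n : ℕ} {M : Type*} [AddCommMonoid M] (d : Fin n → ℕ) (hd : ∀ i, d i ≤ 2)
    (f : Finset (Fin n) × Finset (Fin n) → M) :
    ∑ p ∈ Finset.univ.filter (fun p : Finset (Fin n) × Finset (Fin n) => inc p.1 + inc p.2 = d),
      f p = ∑ P ∈ (Finset.univ.filter fun i => d i = 1).powerset,
        f (Finset.univ.filter (fun i => d i = 2) ∪ P,
          Finset.univ.filter (fun i => d i = 2) ∪ (Finset.univ.filter (fun i => d i = 1) \ P)) := by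
  have key {J K : Finset (Fin n)} (h : inc J + inc K = d) (i : Fin n) :
      d i = (if i ∈ J then 1 else 0) + (if i ∈ K then 1 else 0) := by rw [← h]; rfl
  refine Finset.sum_nbij' (fun p => p.1 \ p.2) (fun P => (Finset.univ.filter (fun i => d i = 2) ∪ P,
      Finset.univ.filter (fun i => d i = 2) ∪ (Finset.univ.filter (fun i => d i = 1) \ P)))
      ?_ ?_ ?_ ?_ ?_
  · rintro ⟨J, K⟩ h
    have h := key (Finset.mem_filter.1 h).2
    rw [Finset.mem_powerset]
    intro i hi
    rw [Finset.mem_sdiff] at hi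
    simp [h i, hi.1, hi.2]
  · intro P hP
    rw [Finset.mem_powerset] at hP
    simp only [Finset.mem_filter, Finset.mem_univ, true_and]
    funext i
    simp only [inc, Pi.add_apply, Finset.mem_union, Finset.mem_filter, Finset.mem_univ, true_and,
      Finset.mem_sdiff]
    have := hd i
    by_cases hiP : i ∈ P
    · have := (Finset.mem_filter.1 (hP hiP)).2
      simp [hiP, this]
    · interval_cases hh : d i <;> simp [hiP]
  · rintro ⟨J, K⟩ h
    have h := key (Finset.mem_filter.1 h).2
    simp only [Prod.mk.injEq]
    constructor <;> ext i <;> have := h i <;>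
      simp only [Finset.mem_union, Finset.mem_filter, Finset.mem_univ, true_and,
        Finset.mem_sdiff] <;>
      by_cases h1 : i ∈ J <;> by_cases h2 : i ∈ K <;> simp [h1, h2] at this ⊢ <;> omega
  · intro P hP
    rw [Finset.mem_powerset] at hP
    ext i
    simp only [Finset.mem_union, Finset.mem_filter, Finset.mem_univ, true_and, Finset.mem_sdiff]
    by_cases hiP : i ∈ P
    · have := (Finset.mem_filter.1 (hP hiP)).2
      simp [hiP, this]
    · simp only [hiP]
      grind
  · rintro ⟨J, K⟩ h
    have h := key (Finset.mem_filter.1 h).2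
    congr 1
    simp only [Prod.mk.injEq]
    constructor <;> ext i <;> have := h i <;>
      simp only [Finset.mem_union, Finset.mem_filter, Finset.mem_univ, true_and,
        Finset.mem_sdiff] <;>
      by_cases h1 : i ∈ J <;> by_cases h2 : i ∈ K <;> simp [h1, h2] at this ⊢ <;> omega

theorem stepWeight_eq {n : ℕ} {R : Type*} [CommRing R] [Algebra ℝ R] (t : ℝ) (s u v : R)
    (y : Fin n → ℝ) (J : Finset (Fin n)) :
    stepWeight t s u v y J = algebraMap ℝ R (vdmRatio t y J) *
      ∏ i, if i ∈ J then -s * (1 - v * algebraMap ℝ R (y i)) else 1 - u * algebraMap ℝ R (y i) := by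
  rw [stepWeight, Finset.prod_ite]
  congr 3 <;> ext <;> simp

theorem sum_step_step_generic {n : ℕ} {q t : ℝ} (ht : t ≠ 0) (hq0 : 0 < q) (hq1 : q < 1)
    {s s' s₃ s₄ u v v' : ℝ} (hv : v = q * v') (hs : s + s' = s₃ + s₄) (hss : s * s' = s₃ * s₄)
    (hsv : s * v + s' * u = s₃ * (u * q) + s₄ * v') (y : Fin n → ℝ) (h0 : ∀ i, y i ≠ 0)
    (h1 : ∀ i j, i ≠ j → y i ≠ y j) (h2 : ∀ i j, i ≠ j → y i ≠ q * y j)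
    (h3 : ∀ i j, i ≠ j → y i ≠ q * (q * y j)) (d : Fin n → ℕ) (hd : ∀ i, d i ≤ 2) :
    ∑ p ∈ Finset.univ.filter (fun p : Finset (Fin n) × Finset (Fin n) => inc p.1 + inc p.2 = d),
      stepWeight t s u v y p.1 * stepWeight t s' 0 0 (scaleOn q p.1 y) p.2 =
    ∑ p ∈ Finset.univ.filter (fun p : Finset (Fin n) × Finset (Fin n) => inc p.1 + inc p.2 = d),
      stepWeight t s₃ 0 0 y p.1 * stepWeight t s₄ u v' (scaleOn q p.1 y) p.2 := by
  rw [sum_filter_inc d hd, sum_filter_inc d hd]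
  set D := Finset.univ.filter fun i => d i = 2 with hD
  set S := Finset.univ.filter fun i => d i = 1 with hS
  have hDS : Disjoint D S := by
    rw [Finset.disjoint_left]; intro i h h'
    simp only [hD, hS, Finset.mem_filter] at h h'
    omega
  have hDS' (i) (h : i ∈ S) : i ∉ D := fun h' => Finset.disjoint_left.1 hDS h' h
  have split (φ ψ : ℝ[X]) (P : Finset (Fin n)) (hP : P ⊆ S) :
      (∏ i ∈ P, φ.eval (y i)) * ∏ j ∈ S \ P, ψ.eval (y j) =
        ∏ i, if i ∈ P then φ.eval (y i) else if i ∈ S then ψ.eval (y i) else 1 := by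
    rw [Finset.prod_ite, Finset.prod_ite, Finset.filter_filter]
    simp only [Finset.prod_const_one, mul_one]
    congr 2 <;> ext i <;> simp [and_comm]
  set com : ℝ := ∏ i, if i ∈ D then s * s' * (1 - v * y i) else if i ∈ S then 1 else 1 - u * y i
    with hcom
  set U : ℝ := vdmRatio t y D * vdmRatio t (scaleOn q D y) (D ∪ S) with hU
  have e1 : ∑ P ∈ S.powerset, stepWeight t s u v y (D ∪ P) *
      stepWeight t s' 0 0 (scaleOn q (D ∪ P) y) (D ∪ (S \ P)) =
      U * com * bipartSum q t (C (-s) * (1 - C v * X)) (C (-s') * (1 - C u * X)) y S := by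
    rw [bipartSum, Finset.mul_sum]
    refine Finset.sum_congr rfl fun P hP => ?_
    have hP := Finset.mem_powerset.1 hP
    have e := vdmRatio_mul_vdmRatio (q := q) ht hq0.ne' h1 h2 hDS hP
    rw [stepWeight_eq, stepWeight_eq, split _ _ P hP]
    simp only [Algebra.algebraMap_self, RingHom.id_apply]
    rw [mul_mul_mul_comm, e, ← Finset.prod_mul_distrib, mul_mul_mul_comm, hcom,
      ← Finset.prod_mul_distrib]
    congr 1
    refine Finset.prod_congr rfl fun i _ => ?_
    by_cases hiP : i ∈ P
    · simp [hiP, hP hiP, hDS' i (hP hiP)]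
    · by_cases hiS : i ∈ S
      · simp [hiP, hiS, hDS' i hiS]; ring
      · by_cases hiD : i ∈ D
        · simp [hiP, hiS, hiD]; ring
        · simp [hiP, hiS, hiD]
  have e2 : ∑ P ∈ S.powerset, stepWeight t s₃ 0 0 y (D ∪ P) *
      stepWeight t s₄ u v' (scaleOn q (D ∪ P) y) (D ∪ (S \ P)) =
      U * com * bipartSum q t (C (-s₃) * (1 - C (u * q) * X)) (C (-s₄) * (1 - C v' * X)) y S := by
    rw [bipartSum, Finset.mul_sum]
    refine Finset.sum_congr rfl fun P hP => ?_
    have hP := Finset.mem_powerset.1 hP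
    have e := vdmRatio_mul_vdmRatio (q := q) ht hq0.ne' h1 h2 hDS hP
    rw [stepWeight_eq, stepWeight_eq, split _ _ P hP]
    simp only [Algebra.algebraMap_self, RingHom.id_apply]
    rw [mul_mul_mul_comm, e, ← Finset.prod_mul_distrib, mul_mul_mul_comm, hcom,
      ← Finset.prod_mul_distrib]
    congr 1
    refine Finset.prod_congr rfl fun i _ => ?_
    by_cases hiP : i ∈ P
    · simp [hiP, hP hiP, hDS' i (hP hiP), scaleOn]; left; ring
    · by_cases hiS : i ∈ S
      · simp [hiP, hiS, hDS' i hiS, scaleOn]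
      · by_cases hiD : i ∈ D
        · simp [hiP, hiS, hiD, scaleOn, hv, hss]; ring
        · simp [hiP, hiS, hiD, scaleOn]
  rw [e1, e2]
  congr 1
  refine bipartSum_congr ht hq0 hq1 (by compute_degree) (by compute_degree) (by compute_degree)
    (by compute_degree) ?_ (fun a => ?_) y S (fun i _ => h0 i) (fun i _ j _ => h1 i j)
    (fun i _ j _ => h2 i j) (fun i _ j _ => h3 i j)
  · have e3 : C s + C s' = C s₃ + C s₄ := by rw [← C_add, ← C_add, hs]
    have e4 : C s * C v + C s' * C u = C s₃ * (C u * C q) + C s₄ * C v' := by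
      simp only [← C_add, ← C_mul, hsv]
    simp only [C_neg, C_mul]
    linear_combination -e3 + X * e4
  · simp only [eval_mul, eval_C, eval_sub, eval_one, eval_X, hv]
    linear_combination (1 - q * v' * a) * (1 - u * (q * a)) * hss

/-- The lattice point `q ^ ν i * t ^ (n - 1 - i)`. -/
noncomputable def lat {n : ℕ} (q t : ℝ) (ν : Fin n → ℕ) : Fin n → ℝ :=
  fun i => q ^ ν i * t ^ (i.rev : ℕ)

theorem scaleOn_lat {n : ℕ} (q t : ℝ) (ν : Fin n → ℕ) (J : Finset (Fin n)) :
    scaleOn q J (lat q t ν) = lat q t (ν + inc J) := by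
  funext i
  by_cases h : i ∈ J <;> simp [scaleOn, lat, inc, h, pow_succ]
  ring

theorem lat_pos {n : ℕ} {q t : ℝ} (hq : 0 < q) (ht : 0 < t) (ν : Fin n → ℕ) (i : Fin n) :
    0 < lat q t ν i := mul_pos (pow_pos hq _) (pow_pos ht _)

theorem lat_le_of_lt {n : ℕ} {q t : ℝ} (hq : 0 < q) (hq1 : q < 1) (ht : 0 < t) (ht1 : t < 1)
    {ν : Fin n → ℕ} (hν : Antitone ν) {i j : Fin n} (hij : i < j) :
    lat q t ν i ≤ t * lat q t ν j := by
  have h1 : q ^ ν i ≤ q ^ ν j := pow_le_pow_of_le_one hq.le hq1.le (hν hij.le)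
  have h2 : t ^ (i.rev : ℕ) ≤ t ^ ((j.rev : ℕ) + 1) := by
    refine pow_le_pow_of_le_one ht.le ht1.le ?_
    have : j.rev < i.rev := Fin.rev_lt_rev.2 hij
    exact this
  calc lat q t ν i ≤ q ^ ν j * t ^ ((j.rev : ℕ) + 1) := by
        unfold lat; gcongr
    _ = _ := by unfold lat; ring

theorem lat_sub_pos {n : ℕ} {q t : ℝ} (hq : 0 < q) (hq1 : q < 1) (ht : 0 < t) (ht1 : t < 1)
    {ν : Fin n → ℕ} (hν : Antitone ν) {i j : Fin n} (hij : i < j) :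
    0 < lat q t ν j - lat q t ν i := by
  have := lat_le_of_lt hq hq1 ht ht1 hν hij
  nlinarith [lat_pos hq ht ν j]

/-- A non-antitone step from an antitone point has an equal pair that gets separated. -/
theorem exists_of_not_antitone {n : ℕ} {ν : Fin n → ℕ} (hν : Antitone ν) {J : Finset (Fin n)}
    (h : ¬ Antitone (ν + inc J)) :
    ∃ i j : Fin n, (j : ℕ) = i + 1 ∧ ν i = ν j ∧ i ∉ J ∧ j ∈ J := by
  obtain _ | n := n
  · exact absurd (fun i => i.elim0) h
  by_contra hc
  refine h (Fin.antitone_iff_succ_le.2 fun i => ?_)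
  have h1 := hν (Fin.castSucc_le_succ i)
  push Not at hc
  have h2 := hc i.castSucc i.succ (by simp)
  simp only [Pi.add_apply, inc]
  by_cases h3 : i.castSucc ∈ J <;> by_cases h4 : i.succ ∈ J <;> simp only [h3, h4, if_true,
    if_false] <;> grind

theorem vdmRatio_lat_eq_zero {n : ℕ} (q t : ℝ) {ν : Fin n → ℕ} (hν : Antitone ν)
    {J : Finset (Fin n)} (h : ¬ Antitone (ν + inc J)) : vdmRatio t (lat q t ν) J = 0 := by
  obtain ⟨i, j, hj, hij, hi, hj'⟩ := exists_of_not_antitone hν h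
  refine Finset.prod_eq_zero (i := (i, j)) ?_ ?_
  · simp only [ltPairs, Finset.mem_filter, Finset.mem_univ, true_and]
    exact Fin.lt_def.2 (by omega)
  · have : (i.rev : ℕ) = j.rev + 1 := by
      rw [Fin.val_rev, Fin.val_rev]; omega
    simp only [scaleOn, hi, hj', if_true, if_false, lat, hij, this]
    ring

theorem stepWeight_lat_eq_zero {n : ℕ} {R : Type*} [CommRing R] [Algebra ℝ R] (q t : ℝ)
    (s u v : R) {ν : Fin n → ℕ} (hν : Antitone ν)
    {J : Finset (Fin n)} (h : ¬ Antitone (ν + inc J)) : stepWeight t s u v (lat q t ν) J = 0 := by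
  rw [stepWeight, vdmRatio_lat_eq_zero q t hν h, map_zero, zero_mul]

theorem continuousAt_stepWeight_lat {n : ℕ} {q t : ℝ} (hq : 0 < q) (hq1 : q < 1) (ht : 0 < t)
    (ht1 : t < 1) (s u v : ℝ) {ν : Fin n → ℕ} (hν : Antitone ν) (J : Finset (Fin n)) :
    ContinuousAt (fun t => stepWeight t s u v (lat q t ν) J) t := by
  have hl (i : Fin n) : ContinuousAt (fun t => lat q t ν i) t := by
    unfold lat; fun_prop
  simp only [stepWeight, Algebra.algebraMap_self, RingHom.id_apply]
  refine ContinuousAt.mul ?_ (by fun_prop)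
  unfold vdmRatio
  refine tendsto_finsetProd _ fun p hp => ?_
  have hlt := (Finset.mem_filter.1 hp).2
  refine ContinuousAt.div ?_ (by fun_prop) (lat_sub_pos hq hq1 ht ht1 hν hlt).ne'
  unfold scaleOn
  refine ContinuousAt.sub ?_ ?_ <;> split_ifs <;> fun_prop

theorem eventually_lat_ne {n : ℕ} {q : ℝ} (hq : q ≠ 0) (t : ℝ) (ν : Fin n → ℕ) (a : ℕ)
    {i j : Fin n} (hij : i ≠ j) :
    ∀ᶠ t' in nhdsWithin t {t}ᶜ, lat q t' ν i ≠ q ^ a * lat q t' ν j := by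
  set p : ℝ[X] := C (q ^ ν i) * X ^ (i.rev : ℕ) - C (q ^ a * q ^ ν j) * X ^ (j.rev : ℕ) with hp
  have hne : (i.rev : ℕ) ≠ j.rev := fun h => hij (Fin.rev_injective (Fin.ext h))
  have hp0 : p ≠ 0 := by
    intro h
    have := congrArg (fun p => p.coeff (i.rev : ℕ)) h
    simp only [hp, coeff_sub, coeff_C_mul, coeff_X_pow, hne, if_true, if_false, coeff_zero] at this
    simp [hq] at this
  have hfin : ({x | p.IsRoot x} \ {t}).Finite := (finite_setOfPred_isRoot hp0).subset Set.sdiff_subset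
  have h1 : ∀ᶠ t' in nhdsWithin t {t}ᶜ, t' ∈ ({x | p.IsRoot x} \ {t})ᶜ :=
    nhdsWithin_le_nhds (hfin.isClosed.isOpen_compl.mem_nhds (by simp))
  filter_upwards [h1, self_mem_nhdsWithin] with t' h h' heq
  refine h ⟨?_, h'⟩
  simp only [Set.mem_ofPred_eq, IsRoot.def, hp, eval_sub, eval_mul, eval_C, eval_pow, eval_X]
  simp only [lat] at heq
  linear_combination heq

/-- The exchange relation for the steps of two `q`-shift operators, over `ℝ`. -/
theorem sum_step_step_real {n : ℕ} {q t : ℝ} (hq0 : 0 < q) (hq1 : q < 1) (ht : 0 < t) (ht1 : t < 1)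
    {s s' s₃ s₄ u v v' : ℝ} (hv : v = q * v') (hs : s + s' = s₃ + s₄) (hss : s * s' = s₃ * s₄)
    (hsv : s * v + s' * u = s₃ * (u * q) + s₄ * v') {ν : Fin n → ℕ} (hν : Antitone ν)
    (d : Fin n → ℕ) (hd : ∀ i, d i ≤ 2) :
    ∑ p ∈ Finset.univ.filter (fun p : Finset (Fin n) × Finset (Fin n) => inc p.1 + inc p.2 = d),
      stepWeight t s u v (lat q t ν) p.1 * stepWeight t s' 0 0 (lat q t (ν + inc p.1)) p.2 =
    ∑ p ∈ Finset.univ.filter (fun p : Finset (Fin n) × Finset (Fin n) => inc p.1 + inc p.2 = d),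
      stepWeight t s₃ 0 0 (lat q t ν) p.1 * stepWeight t s₄ u v' (lat q t (ν + inc p.1)) p.2 := by
  have hcont (s u v s' u' v' : ℝ) : ContinuousAt (fun t => ∑ p ∈ Finset.univ.filter
      (fun p : Finset (Fin n) × Finset (Fin n) => inc p.1 + inc p.2 = d),
      stepWeight t s u v (lat q t ν) p.1 *
        stepWeight t s' u' v' (lat q t (ν + inc p.1)) p.2) t := by
    refine tendsto_finsetSum _ fun p _ => ?_
    by_cases hp : Antitone (ν + inc p.1)
    · exact (continuousAt_stepWeight_lat hq0 hq1 ht ht1 _ _ _ hν _).mul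
        (continuousAt_stepWeight_lat hq0 hq1 ht ht1 _ _ _ hp _)
    · simp only [stepWeight_lat_eq_zero q _ _ _ _ hν hp, zero_mul]
      exact tendsto_const_nhds
  refine tendsto_nhds_unique (f := fun t => ∑ p ∈ Finset.univ.filter
      (fun p : Finset (Fin n) × Finset (Fin n) => inc p.1 + inc p.2 = d),
      stepWeight t s u v (lat q t ν) p.1 *
        stepWeight t s' 0 0 (lat q t (ν + inc p.1)) p.2) (l := nhdsWithin t {t}ᶜ)
    ((hcont s u v s' 0 0).mono_left nhdsWithin_le_nhds) ?_
  refine Filter.Tendsto.congr' ?_ ((hcont s₃ 0 0 s₄ u v').mono_left nhdsWithin_le_nhds)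
  have hgen (a : ℕ) : ∀ᶠ t' in nhdsWithin t {t}ᶜ, ∀ i j : Fin n, i ≠ j →
      lat q t' ν i ≠ q ^ a * lat q t' ν j := by
    simp only [Filter.eventually_all]
    exact fun i j hij => eventually_lat_ne hq0.ne' t ν a hij
  filter_upwards [hgen 0, hgen 1, hgen 2, nhdsWithin_le_nhds (lt_mem_nhds ht)] with t' h1 h2 h3 ht'
  have := sum_step_step_generic (t := t') ht'.ne' hq0 hq1 hv hs hss hsv (lat q t' ν)
    (fun i => (lat_pos hq0 ht' ν i).ne') (by simpa using h1) (by simpa using h2)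
    (by simpa [pow_two, mul_assoc] using h3) d hd
  simp only [scaleOn_lat] at this
  exact this.symm

theorem map_stepWeight {n : ℕ} {R S : Type*} [CommRing R] [Algebra ℝ R] [CommRing S] [Algebra ℝ S]
    (f : R →ₐ[ℝ] S) (t : ℝ) (s u v : R) (y : Fin n → ℝ) (J : Finset (Fin n)) :
    f (stepWeight t s u v y J) = stepWeight t (f s) (f u) (f v) y J := by
  simp [stepWeight, map_prod]

theorem coe_stepWeight {n : ℕ} (t : ℝ) (s u v : ℝ[X]) (y : Fin n → ℝ) (J : Finset (Fin n)) :
    ((stepWeight t s u v y J : ℝ[X]) : PowerSeries ℝ) =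
      stepWeight t (s : PowerSeries ℝ) u v y J := by
  simpa using map_stepWeight (Polynomial.coeToPowerSeries.algHom (R := ℝ) ℝ) t s u v y J

/-- The exchange relation for the steps of two `q`-shift operators, with polynomial parameters. -/
theorem sum_step_step {n : ℕ} {q t : ℝ} (hq0 : 0 < q) (hq1 : q < 1) (ht : 0 < t) (ht1 : t < 1)
    {s s' s₃ s₄ u v v' : ℝ[X]} (hv : v = C q * v') (hs : s + s' = s₃ + s₄)
    (hss : s * s' = s₃ * s₄) (hsv : s * v + s' * u = s₃ * (u * C q) + s₄ * v') {ν : Fin n → ℕ}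
    (hν : Antitone ν) (d : Fin n → ℕ) (hd : ∀ i, d i ≤ 2) :
    ∑ p ∈ Finset.univ.filter (fun p : Finset (Fin n) × Finset (Fin n) => inc p.1 + inc p.2 = d),
      stepWeight t (s : PowerSeries ℝ) u v (lat q t ν) p.1 *
        stepWeight t (s' : PowerSeries ℝ) 0 0 (lat q t (ν + inc p.1)) p.2 =
    ∑ p ∈ Finset.univ.filter (fun p : Finset (Fin n) × Finset (Fin n) => inc p.1 + inc p.2 = d),
      stepWeight t (s₃ : PowerSeries ℝ) 0 0 (lat q t ν) p.1 *
        stepWeight t (s₄ : PowerSeries ℝ) u v' (lat q t (ν + inc p.1)) p.2 := by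
  have key : ∑ p ∈ Finset.univ.filter
        (fun p : Finset (Fin n) × Finset (Fin n) => inc p.1 + inc p.2 = d),
      stepWeight t s u v (lat q t ν) p.1 * stepWeight t s' 0 0 (lat q t (ν + inc p.1)) p.2 =
      ∑ p ∈ Finset.univ.filter
        (fun p : Finset (Fin n) × Finset (Fin n) => inc p.1 + inc p.2 = d),
      stepWeight t s₃ 0 0 (lat q t ν) p.1 * stepWeight t s₄ u v' (lat q t (ν + inc p.1)) p.2 := by
    refine Polynomial.funext fun a => ?_
    have e := sum_step_step_real hq0 hq1 ht ht1 (s := s.eval a) (s' := s'.eval a)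
      (s₃ := s₃.eval a) (s₄ := s₄.eval a) (u := u.eval a) (v := v.eval a) (v' := v'.eval a)
      (by rw [hv]; simp) (by rw [← eval_add, hs, eval_add])
      (by rw [← eval_mul, hss, eval_mul])
      (by simpa using congrArg (eval a) hsv) hν d hd
    rw [← coe_aeval_eq_eval]
    simp only [map_sum, map_mul, map_stepWeight, map_zero]
    simpa only [coe_aeval_eq_eval] using e
  have := congrArg (Polynomial.coeToPowerSeries.ringHom (R := ℝ)) key
  simpa only [map_sum, map_mul, coeToPowerSeries.ringHom_apply, coe_stepWeight, coe_zero] using this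

/-- `L` vanishes outside the weakly decreasing tuples. -/
def AntitoneSupported {n : ℕ} {R : Type*} [Zero R] (L : (Fin n → ℕ) → R) : Prop :=
  ∀ ν, ¬ Antitone ν → L ν = 0

open Classical in

/-- The action of the `q`-shift operator with parameters `s, u, v` on row vectors. -/
noncomputable def stepAct {n : ℕ} (q t : ℝ) (s u v : PowerSeries ℝ)
    (L : (Fin n → ℕ) → PowerSeries ℝ) (ν : Fin n → ℕ) : PowerSeries ℝ :=
  ∑ J : Finset (Fin n), if inc J ≤ ν then
    stepWeight t s u v (lat q t (ν - inc J)) J * L (ν - inc J) else 0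

theorem stepAct_supported {n : ℕ} (q t : ℝ) (s u v : PowerSeries ℝ)
    {L : (Fin n → ℕ) → PowerSeries ℝ} (hL : AntitoneSupported L) :
    AntitoneSupported (stepAct q t s u v L) := by
  intro ν hν
  refine Finset.sum_eq_zero fun J _ => ?_
  split_ifs with h
  · by_cases h' : Antitone (ν - inc J)
    · rw [stepWeight_lat_eq_zero q t s u v h' (by rwa [tsub_add_cancel_of_le h]), zero_mul]
    · rw [hL _ h', mul_zero]
  · rfl

theorem inc_le_one {n : ℕ} (J : Finset (Fin n)) (i : Fin n) : inc J i ≤ 1 := by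
  unfold inc; split_ifs <;> simp

open Classical in

theorem stepAct_stepAct {n : ℕ} (q t : ℝ) (s u v s' u' v' : PowerSeries ℝ)
    (L : (Fin n → ℕ) → PowerSeries ℝ) (ν : Fin n → ℕ) :
    stepAct q t s' u' v' (stepAct q t s u v L) ν =
      ∑ d ∈ Fintype.piFinset fun _ : Fin n => Finset.range 3, if d ≤ ν then
        (∑ p ∈ Finset.univ.filter
            (fun p : Finset (Fin n) × Finset (Fin n) => inc p.1 + inc p.2 = d),
          stepWeight t s u v (lat q t (ν - d)) p.1 *
            stepWeight t s' u' v' (lat q t (ν - d + inc p.1)) p.2) * L (ν - d) else 0 := by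
  have h1 : stepAct q t s' u' v' (stepAct q t s u v L) ν =
      ∑ p : Finset (Fin n) × Finset (Fin n), if inc p.1 + inc p.2 ≤ ν then
        stepWeight t s u v (lat q t (ν - (inc p.1 + inc p.2))) p.1 *
          stepWeight t s' u' v' (lat q t (ν - (inc p.1 + inc p.2) + inc p.1)) p.2 *
            L (ν - (inc p.1 + inc p.2)) else 0 := by
    rw [← Finset.univ_product_univ, Finset.sum_product_right]
    refine Finset.sum_congr rfl fun K _ => ?_
    split_ifs with hK
    · rw [stepAct, Finset.mul_sum]
      refine Finset.sum_congr rfl fun J _ => ?_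
      have e : inc J ≤ ν - inc K ↔ inc J + inc K ≤ ν := le_tsub_iff_right hK
      simp only [e]
      split_ifs with hJK
      · have e1 : ν - inc K - inc J = ν - (inc J + inc K) := by
          rw [tsub_tsub, add_comm]
        have e2 : ν - (inc J + inc K) + inc J = ν - inc K := by
          rw [← e1, tsub_add_cancel_of_le (e.2 hJK)]
        simp only [e1, e2]
        ring
      · rw [mul_zero]
    · refine (Finset.sum_eq_zero fun J _ => if_neg fun h => hK ?_).symm
      exact le_trans (self_le_add_left _ _) h
  rw [h1, ← Finset.sum_fiberwise_of_maps_to (s := Finset.univ)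
    (t := Fintype.piFinset fun _ : Fin n => Finset.range 3) (g := fun p => inc p.1 + inc p.2)]
  · refine Finset.sum_congr rfl fun d _ => ?_
    split_ifs with hd
    · rw [Finset.sum_mul]
      refine Finset.sum_congr rfl fun p hp => ?_
      rw [(Finset.mem_filter.1 hp).2, if_pos hd]
    · refine Finset.sum_eq_zero fun p hp => ?_
      rw [(Finset.mem_filter.1 hp).2, if_neg hd]
  · intro p _
    rw [Fintype.mem_piFinset]
    intro i
    have := inc_le_one p.1 i
    have := inc_le_one p.2 i
    rw [Finset.mem_range, Pi.add_apply]
    omega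

/-- The exchange relation for two `q`-shift operators. -/
theorem stepAct_exchange {n : ℕ} {q t : ℝ} (hq0 : 0 < q) (hq1 : q < 1) (ht : 0 < t) (ht1 : t < 1)
    {s s' s₃ s₄ u v v' : ℝ[X]} (hv : v = C q * v') (hs : s + s' = s₃ + s₄)
    (hss : s * s' = s₃ * s₄) (hsv : s * v + s' * u = s₃ * (u * C q) + s₄ * v')
    {L : (Fin n → ℕ) → PowerSeries ℝ} (hL : AntitoneSupported L) :
    stepAct q t (s' : PowerSeries ℝ) 0 0 (stepAct q t (s : PowerSeries ℝ) u v L) =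
      stepAct q t (s₄ : PowerSeries ℝ) u v' (stepAct q t (s₃ : PowerSeries ℝ) 0 0 L) := by
  funext ν
  rw [stepAct_stepAct, stepAct_stepAct]
  refine Finset.sum_congr rfl fun d hd => ?_
  split_ifs with h
  · by_cases h' : Antitone (ν - d)
    · rw [sum_step_step hq0 hq1 ht ht1 hv hs hss hsv h' d fun i => ?_]
      have := Fintype.mem_piFinset.1 hd i
      rw [Finset.mem_range] at this
      omega
    · rw [hL _ h', mul_zero, mul_zero]
  · rfl

theorem rescale_stepWeight {n : ℕ} (a t : ℝ) (s u v : PowerSeries ℝ) (y : Fin n → ℝ)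
    (J : Finset (Fin n)) :
    PowerSeries.rescale a (stepWeight t s u v y J) = stepWeight t (PowerSeries.rescale a s)
      (PowerSeries.rescale a u) (PowerSeries.rescale a v) y J := by
  have h (x : PowerSeries ℝ) : PowerSeries.rescaleAlgHom a x = PowerSeries.rescale a x := by
    rw [← PowerSeries.coe_rescaleAlgHom]; rfl
  simpa only [h] using map_stepWeight (PowerSeries.rescaleAlgHom a) t s u v y J

theorem rescale_stepAct {n : ℕ} (a q t : ℝ) (s u v : PowerSeries ℝ)
    (L : (Fin n → ℕ) → PowerSeries ℝ) (ν : Fin n → ℕ) :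
    PowerSeries.rescale a (stepAct q t s u v L ν) = stepAct q t (PowerSeries.rescale a s)
      (PowerSeries.rescale a u) (PowerSeries.rescale a v) (fun ν => PowerSeries.rescale a (L ν)) ν := by
  rw [stepAct, map_sum]
  refine Finset.sum_congr rfl fun J _ => ?_
  split_ifs
  · rw [map_mul, rescale_stepWeight]
  · rw [map_zero]

theorem stepAct_sub {n : ℕ} (q t : ℝ) (s u v : PowerSeries ℝ)
    (L L' : (Fin n → ℕ) → PowerSeries ℝ) (ν : Fin n → ℕ) :
    stepAct q t s u v (fun ν => L ν - L' ν) ν = stepAct q t s u v L ν - stepAct q t s u v L' ν := by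
  rw [stepAct, stepAct, stepAct, ← Finset.sum_sub_distrib]
  refine Finset.sum_congr rfl fun J _ => ?_
  split_ifs <;> ring

theorem stepAct_mul {n : ℕ} (q t : ℝ) (s u v g : PowerSeries ℝ)
    (L : (Fin n → ℕ) → PowerSeries ℝ) (ν : Fin n → ℕ) :
    stepAct q t s u v (fun ν => g * L ν) ν = g * stepAct q t s u v L ν := by
  rw [stepAct, stepAct, Finset.mul_sum]
  refine Finset.sum_congr rfl fun J _ => ?_
  split_ifs <;> ring

theorem vdmRatio_lat_empty {n : ℕ} {q t : ℝ} (hq0 : 0 < q) (hq1 : q < 1) (ht : 0 < t) (ht1 : t < 1)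
    {ν : Fin n → ℕ} (hν : Antitone ν) : vdmRatio t (lat q t ν) ∅ = 1 := by
  refine Finset.prod_eq_one fun p hp => ?_
  simp only [scaleOn, Finset.notMem_empty, if_false]
  exact div_self (lat_sub_pos hq0 hq1 ht ht1 hν (Finset.mem_filter.1 hp).2).ne'

theorem constantCoeff_stepWeight {n : ℕ} {q t : ℝ} (hq0 : 0 < q) (hq1 : q < 1) (ht : 0 < t)
    (ht1 : t < 1) {s u : PowerSeries ℝ} (v : PowerSeries ℝ) (hs : PowerSeries.constantCoeff s = 0)
    (hu : PowerSeries.constantCoeff u = 0) {ν : Fin n → ℕ} (hν : Antitone ν)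
    (J : Finset (Fin n)) :
    PowerSeries.constantCoeff (stepWeight t s u v (lat q t ν) J) = if J = ∅ then 1 else 0 := by
  have h1 (r : ℝ) : PowerSeries.constantCoeff (algebraMap ℝ (PowerSeries ℝ) r) = r := by
    simp
  simp only [stepWeight, map_mul, map_prod, map_neg, map_sub, map_one, hs, hu, h1, zero_mul,
    neg_zero, sub_zero, Finset.prod_const_one, mul_one, Finset.prod_const]
  split_ifs with h
  · rw [h, vdmRatio_lat_empty hq0 hq1 ht ht1 hν]; simp
  · rw [zero_pow (by simpa using h), mul_zero]

theorem inc_empty {n : ℕ} : inc (∅ : Finset (Fin n)) = 0 := by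
  funext i; simp [inc]

open Classical in

/-- The part of the `m`-th coefficient of `stepAct` that involves lower coefficients only. -/
noncomputable def lowerAct {n : ℕ} (q t : ℝ) (s u v : PowerSeries ℝ)
    (ℓ : ℕ → (Fin n → ℕ) → ℝ) (m : ℕ) (ν : Fin n → ℕ) : ℝ :=
  ∑ J : Finset (Fin n), if inc J ≤ ν then ∑ i ∈ Finset.range m,
    ℓ i (ν - inc J) * PowerSeries.coeff (m - i) (stepWeight t s u v (lat q t (ν - inc J)) J) else 0

theorem coeff_stepAct {n : ℕ} {q t : ℝ} (hq0 : 0 < q) (hq1 : q < 1) (ht : 0 < t)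
    (ht1 : t < 1) {s u : PowerSeries ℝ} (v : PowerSeries ℝ) (hs : PowerSeries.constantCoeff s = 0)
    (hu : PowerSeries.constantCoeff u = 0) {L : (Fin n → ℕ) → PowerSeries ℝ}
    (hL : AntitoneSupported L) (m : ℕ) (ν : Fin n → ℕ) :
    PowerSeries.coeff m (stepAct q t s u v L ν) = PowerSeries.coeff m (L ν) +
      lowerAct q t s u v (fun m ν => PowerSeries.coeff m (L ν)) m ν := by
  classical
  have h1 (J : Finset (Fin n)) : PowerSeries.coeff m (if inc J ≤ ν then
      stepWeight t s u v (lat q t (ν - inc J)) J * L (ν - inc J) else 0) =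
      (if J = ∅ then PowerSeries.coeff m (L ν) else 0) + if inc J ≤ ν then ∑ i ∈ Finset.range m,
        PowerSeries.coeff i (L (ν - inc J)) *
          PowerSeries.coeff (m - i) (stepWeight t s u v (lat q t (ν - inc J)) J) else 0 := by
    by_cases h : inc J ≤ ν
    · rw [if_pos h, if_pos h, mul_comm, PowerSeries.coeff_mul,
        Finset.Nat.sum_antidiagonal_eq_sum_range_succ_mk, Finset.sum_range_succ, add_comm]
      congr 1
      simp only [tsub_self, PowerSeries.coeff_zero_eq_constantCoeff]
      by_cases h' : Antitone (ν - inc J)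
      · rw [constantCoeff_stepWeight hq0 hq1 ht ht1 v hs hu h']
        split_ifs with hJ
        · rw [hJ, inc_empty, tsub_zero, mul_one]
        · rw [mul_zero]
      · rw [hL _ h', map_zero, zero_mul]
        split_ifs with hJ
        · rw [hJ, inc_empty, tsub_zero] at h'
          rw [hL _ h', map_zero]
        · rfl
    · rw [if_neg h, if_neg h, if_neg fun hJ => h ?_, map_zero, add_zero]
      rw [hJ, inc_empty]; exact zero_le
  rw [stepAct, map_sum, lowerAct]
  simp only [h1, Finset.sum_add_distrib, Finset.sum_ite_eq', Finset.mem_univ, if_true]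

/-- The substitution `X ↦ q X` acts on `L` as the `q`-shift operator with parameters `s, u, v`. -/
def IsTwisted {n : ℕ} (q t : ℝ) (s u v : PowerSeries ℝ) (L : (Fin n → ℕ) → PowerSeries ℝ) : Prop :=
  ∀ ν, PowerSeries.rescale q (L ν) = stepAct q t s u v L ν

theorem isTwisted_iff {n : ℕ} {q t : ℝ} (hq0 : 0 < q) (hq1 : q < 1) (ht : 0 < t)
    (ht1 : t < 1) {s u : PowerSeries ℝ} (v : PowerSeries ℝ) (hs : PowerSeries.constantCoeff s = 0)
    (hu : PowerSeries.constantCoeff u = 0) {L : (Fin n → ℕ) → PowerSeries ℝ}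
    (hL : AntitoneSupported L) : IsTwisted q t s u v L ↔ ∀ m ν,
      (q ^ m - 1) * PowerSeries.coeff m (L ν) =
        lowerAct q t s u v (fun m ν => PowerSeries.coeff m (L ν)) m ν := by
  simp only [IsTwisted, PowerSeries.ext_iff, coeff_stepAct hq0 hq1 ht ht1 v hs hu hL,
    PowerSeries.coeff_rescale, sub_mul, one_mul, sub_eq_iff_eq_add']
  exact forall_comm

theorem pow_sub_one_ne_zero {q : ℝ} (hq0 : 0 < q) (hq1 : q < 1) {m : ℕ} (hm : m ≠ 0) :
    q ^ m - 1 ≠ 0 := (sub_neg.2 (pow_lt_one₀ hq0.le hq1 hm)).ne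

theorem IsTwisted.eq_zero {n : ℕ} {q t : ℝ} (hq0 : 0 < q) (hq1 : q < 1) (ht : 0 < t)
    (ht1 : t < 1) {s u v : PowerSeries ℝ} (hs : PowerSeries.constantCoeff s = 0)
    (hu : PowerSeries.constantCoeff u = 0) {L : (Fin n → ℕ) → PowerSeries ℝ}
    (hL : AntitoneSupported L) (h : IsTwisted q t s u v L)
    (h0 : ∀ ν, PowerSeries.constantCoeff (L ν) = 0) (ν : Fin n → ℕ) : L ν = 0 := by
  rw [isTwisted_iff hq0 hq1 ht ht1 v hs hu hL] at h
  ext m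
  rw [map_zero]
  induction m using Nat.strong_induction_on generalizing ν with
  | _ m ih =>
    rcases eq_or_ne m 0 with rfl | hm
    · simpa using h0 ν
    · have e := h m ν
      rw [lowerAct, Finset.sum_eq_zero, mul_eq_zero] at e
      · exact e.resolve_left (pow_sub_one_ne_zero hq0 hq1 hm)
      · intro J _
        split_ifs
        · exact Finset.sum_eq_zero fun i hi => by rw [ih i (Finset.mem_range.1 hi), zero_mul]
        · rfl

theorem IsTwisted.ext {n : ℕ} {q t : ℝ} (hq0 : 0 < q) (hq1 : q < 1) (ht : 0 < t)
    (ht1 : t < 1) {s u v : PowerSeries ℝ} (hs : PowerSeries.constantCoeff s = 0)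
    (hu : PowerSeries.constantCoeff u = 0) {L L' : (Fin n → ℕ) → PowerSeries ℝ}
    (hL : AntitoneSupported L) (hL' : AntitoneSupported L') (h : IsTwisted q t s u v L)
    (h' : IsTwisted q t s u v L')
    (h0 : ∀ ν, PowerSeries.constantCoeff (L ν) = PowerSeries.constantCoeff (L' ν)) : L = L' := by
  funext ν
  refine sub_eq_zero.1 (IsTwisted.eq_zero hq0 hq1 ht ht1 (v := v) hs hu
    (L := fun ν => L ν - L' ν) ?_ ?_ ?_ ν)
  · intro ν hν
    simp only [hL ν hν, hL' ν hν, sub_zero]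
  · intro ν
    rw [map_sub, stepAct_sub, h ν, h' ν]
  · intro ν
    rw [map_sub, h0, sub_self]

open Classical in

/-- The coefficients of the solution of a twisted equation. -/
noncomputable def solveCoeff {n : ℕ} (q t : ℝ) (s u v : PowerSeries ℝ)
    (L₀ : (Fin n → ℕ) → ℝ) (m : ℕ) (ν : Fin n → ℕ) : ℝ :=
  if m = 0 then L₀ ν else (q ^ m - 1)⁻¹ *
    ∑ J : Finset (Fin n), if inc J ≤ ν then ∑ i : Fin m, solveCoeff q t s u v L₀ i (ν - inc J) *
      PowerSeries.coeff (m - i) (stepWeight t s u v (lat q t (ν - inc J)) J) else 0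
termination_by m
decreasing_by exact i.2

theorem exists_isTwisted {n : ℕ} {q t : ℝ} (hq0 : 0 < q) (hq1 : q < 1) (ht : 0 < t)
    (ht1 : t < 1) {s u : PowerSeries ℝ} (v : PowerSeries ℝ) (hs : PowerSeries.constantCoeff s = 0)
    (hu : PowerSeries.constantCoeff u = 0) {L₀ : (Fin n → ℕ) → ℝ} (hL₀ : AntitoneSupported L₀) :
    ∃ L : (Fin n → ℕ) → PowerSeries ℝ, AntitoneSupported L ∧ IsTwisted q t s u v L ∧
      ∀ ν, PowerSeries.constantCoeff (L ν) = L₀ ν := by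
  have hsupp : AntitoneSupported fun ν => PowerSeries.mk fun m => solveCoeff q t s u v L₀ m ν := by
    intro ν hν
    ext m
    rw [PowerSeries.coeff_mk, map_zero]
    induction m using Nat.strong_induction_on generalizing ν with
    | _ m ih =>
      rw [solveCoeff]
      split_ifs with hm
      · exact hL₀ ν hν
      · rw [Finset.sum_eq_zero, mul_zero]
        intro J _
        split_ifs with hJ
        · refine Finset.sum_eq_zero fun i _ => ?_
          by_cases h' : Antitone (ν - inc J)
          · rw [stepWeight_lat_eq_zero q t s u v h' (by rwa [tsub_add_cancel_of_le hJ]), map_zero,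
              mul_zero]
          · rw [ih i i.2 _ h', zero_mul]
        · rfl
  refine ⟨_, hsupp, ?_, fun ν => ?_⟩
  · rw [isTwisted_iff hq0 hq1 ht ht1 v hs hu hsupp]
    intro m ν
    simp only [PowerSeries.coeff_mk]
    rcases eq_or_ne m 0 with rfl | hm
    · simp [lowerAct]
    · rw [solveCoeff, if_neg hm, mul_inv_cancel_left₀ (pow_sub_one_ne_zero hq0 hq1 hm), lowerAct]
      refine Finset.sum_congr rfl fun J _ => ?_
      rw [Finset.sum_range fun i => solveCoeff q t s u v L₀ i (ν - inc J) *
        PowerSeries.coeff (m - i) (stepWeight t s u v (lat q t (ν - inc J)) J)]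
  · rw [← PowerSeries.coeff_zero_eq_constantCoeff_apply, PowerSeries.coeff_mk, solveCoeff,
      if_pos rfl]

theorem abs_vdmRatio_lat_le {n : ℕ} {q t : ℝ} (hq0 : 0 < q) (hq1 : q < 1) (ht : 0 < t) (ht1 : t < 1)
    {ν : Fin n → ℕ} (hν : Antitone ν) (J : Finset (Fin n)) :
    |vdmRatio t (lat q t ν) J| ≤ ∏ _p ∈ ltPairs n, (1 - t)⁻¹ := by
  rw [vdmRatio, Finset.abs_prod]
  refine Finset.prod_le_prod (fun _ _ => abs_nonneg _) fun p hp => ?_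
  have hlt := (Finset.mem_filter.1 hp).2
  have h1 := lat_sub_pos hq0 hq1 ht ht1 hν hlt
  have h2 := lat_le_of_lt hq0 hq1 ht ht1 hν hlt
  have h3 := lat_pos hq0 ht ν p.1
  have h4 := lat_pos hq0 ht ν p.2
  rw [abs_div, abs_of_pos h1, div_le_iff₀ h1, inv_mul_eq_div, le_div_iff₀ (by linarith)]
  set a := lat q t ν p.1
  set b := lat q t ν p.2
  have hs (i : Fin n) : scaleOn t J (lat q t ν) i ≤ lat q t ν i ∧
      0 ≤ scaleOn t J (lat q t ν) i := by
    have := lat_pos hq0 ht ν i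
    unfold scaleOn; split_ifs
    · exact ⟨by nlinarith, by positivity⟩
    · exact ⟨le_rfl, this.le⟩
  have h5 := hs p.1
  have h6 := hs p.2
  have h7 : |scaleOn t J (lat q t ν) p.2 - scaleOn t J (lat q t ν) p.1| ≤ b := by
    rw [abs_le]; constructor <;> linarith
  nlinarith

theorem lat_le_one {n : ℕ} {q t : ℝ} (hq0 : 0 < q) (hq1 : q < 1) (ht : 0 < t) (ht1 : t < 1)
    (ν : Fin n → ℕ) (i : Fin n) : lat q t ν i ≤ 1 :=
  mul_le_one₀ (pow_le_one₀ hq0.le hq1.le) (by positivity) (pow_le_one₀ ht.le ht1.le)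

open scoped PowerSeries.WithPiTopology in

theorem exists_coeff_stepWeight_le {n : ℕ} {q t : ℝ} (hq0 : 0 < q) (hq1 : q < 1) (ht : 0 < t)
    (ht1 : t < 1) (s u v : PowerSeries ℝ) (m : ℕ) :
    ∃ M, 0 ≤ M ∧ ∀ k ≤ m, ∀ J : Finset (Fin n), ∀ ν : Fin n → ℕ, Antitone ν →
      |PowerSeries.coeff k (stepWeight t s u v (lat q t ν) J)| ≤ M := by
  have key (k : ℕ) (J : Finset (Fin n)) : ∃ M, 0 ≤ M ∧ ∀ ν : Fin n → ℕ, Antitone ν →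
      |PowerSeries.coeff k (stepWeight t s u v (lat q t ν) J)| ≤ M := by
    have hc : Continuous fun y : Fin n → ℝ => PowerSeries.coeff k
        ((∏ i ∈ J, -s * (1 - v * algebraMap ℝ (PowerSeries ℝ) (y i))) *
          ∏ i ∈ Jᶜ, (1 - u * algebraMap ℝ (PowerSeries ℝ) (y i))) := by
      have hC : Continuous (algebraMap ℝ (PowerSeries ℝ)) := PowerSeries.WithPiTopology.continuous_C
      refine (PowerSeries.WithPiTopology.continuous_coeff ℝ k).comp ?_
      fun_prop
    obtain ⟨M, hM⟩ := (isCompact_univ_pi fun _ : Fin n =>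
      isCompact_Icc (a := (0 : ℝ)) (b := 1)).exists_bound_of_continuousOn hc.continuousOn
    refine ⟨(∏ _p ∈ ltPairs n, (1 - t)⁻¹) * |M|, ?_, fun ν hν => ?_⟩
    · have : 0 ≤ (1 - t)⁻¹ := by rw [inv_nonneg]; linarith
      positivity
    · rw [stepWeight, PowerSeries.algebraMap_apply, Algebra.algebraMap_self, RingHom.id_apply,
        PowerSeries.coeff_C_mul, abs_mul]
      refine mul_le_mul (abs_vdmRatio_lat_le hq0 hq1 ht ht1 hν J) ?_ (abs_nonneg _) ?_
      · refine (hM (lat q t ν) ?_).trans (le_abs_self M)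
        exact fun i _ => ⟨(lat_pos hq0 ht ν i).le, lat_le_one hq0 hq1 ht ht1 ν i⟩
      · have : 0 ≤ (1 - t)⁻¹ := by rw [inv_nonneg]; linarith
        positivity
  choose M hM0 hM using key
  refine ⟨∑ k ∈ Finset.range (m + 1), ∑ J, M k J, Finset.sum_nonneg fun k _ =>
    Finset.sum_nonneg fun J _ => hM0 k J, fun k hk J ν hν => (hM k J ν hν).trans ?_⟩
  refine (Finset.single_le_sum (fun J _ => hM0 k J) (Finset.mem_univ J)).trans ?_
  exact Finset.single_le_sum (f := fun k => ∑ J, M k J)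
    (fun k _ => Finset.sum_nonneg fun J _ => hM0 k J) (Finset.mem_range.2 (by omega))

theorem stepWeight_mul_left {n : ℕ} {R : Type*} [CommRing R] [Algebra ℝ R] (t : ℝ) (c s u v : R)
    (y : Fin n → ℝ) (J : Finset (Fin n)) :
    stepWeight t (c * s) u v y J = c ^ J.card * stepWeight t s u v y J := by
  have : ∏ i ∈ J, -(c * s) * (1 - v * algebraMap ℝ R (y i)) =
      c ^ J.card * ∏ i ∈ J, -s * (1 - v * algebraMap ℝ R (y i)) := by
    rw [← Finset.prod_const, ← Finset.prod_mul_distrib]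
    exact Finset.prod_congr rfl fun i _ => by ring
  rw [stepWeight, stepWeight, this]
  ring

/-- The coefficients of the family `L` are bounded by multiples of `B ^ ∑ j, ν j`. -/
def GeomBdd {ι : Type*} {n : ℕ} (B : ℝ) (L : ι → (Fin n → ℕ) → PowerSeries ℝ) : Prop :=
  ∀ m, ∃ C, ∀ i ν, |PowerSeries.coeff m (L i ν)| ≤ C * B ^ ∑ j, ν j

theorem sum_le_sum_sub_inc {n : ℕ} (ν : Fin n → ℕ) (J : Finset (Fin n)) :
    ∑ j, ν j ≤ ∑ j, (ν - inc J) j + n := by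
  have : ∑ j, ν j ≤ ∑ j, ((ν - inc J) j + 1) := by
    refine Finset.sum_le_sum fun j _ => ?_
    have := inc_le_one J j
    rw [Pi.sub_apply]; omega
  simpa [Finset.sum_add_distrib] using this

theorem pow_sum_sub_inc_le {n : ℕ} {B : ℝ} (hB : 0 < B) (hB1 : B < 1) (ν : Fin n → ℕ)
    (J : Finset (Fin n)) : B ^ ∑ j, (ν - inc J) j ≤ (B ^ n)⁻¹ * B ^ ∑ j, ν j := by
  rw [inv_mul_eq_div, le_div_iff₀ (by positivity), ← pow_add]
  exact pow_le_pow_of_le_one hB.le hB1.le (sum_le_sum_sub_inc ν J)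

theorem geomBdd_of_isTwisted {ι : Type*} {n : ℕ} {q t B S : ℝ} (hq0 : 0 < q) (hq1 : q < 1)
    (ht : 0 < t) (ht1 : t < 1) (hB : 0 < B) (hB1 : B < 1) {σ : ι → ℝ} (hσ : ∀ i, |σ i| ≤ S)
    (u v : ℝ) {L : ι → (Fin n → ℕ) → PowerSeries ℝ} (hL : ∀ i, AntitoneSupported (L i))
    (hT : ∀ i, IsTwisted q t (PowerSeries.C (σ i) * PowerSeries.X)
      (PowerSeries.C u * PowerSeries.X) (PowerSeries.C v) (L i))
    (h0 : ∃ C, ∀ i ν, |PowerSeries.constantCoeff (L i ν)| ≤ C * B ^ ∑ j, ν j) : GeomBdd B L := by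
  have key (m : ℕ) : ∃ C, 0 ≤ C ∧ ∀ k < m, ∀ i ν,
      |PowerSeries.coeff k (L i ν)| ≤ C * B ^ ∑ j, ν j := by
    induction m with
    | zero => exact ⟨0, le_rfl, by simp⟩
    | succ m ih =>
      obtain ⟨C, hC, hCm⟩ := ih
      suffices h : ∃ C', ∀ i ν, |PowerSeries.coeff m (L i ν)| ≤ C' * B ^ ∑ j, ν j by
        obtain ⟨C', hC'⟩ := h
        refine ⟨max C C', le_max_of_le_left hC, fun k hk i ν => ?_⟩
        rcases Nat.lt_succ_iff_lt_or_eq.1 hk with hk | rfl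
        · exact (hCm k hk i ν).trans (mul_le_mul_of_nonneg_right (le_max_left _ _) (by positivity))
        · exact (hC' i ν).trans (mul_le_mul_of_nonneg_right (le_max_right _ _) (by positivity))
      rcases eq_or_ne m 0 with rfl | hm
      · obtain ⟨C', hC'⟩ := h0
        exact ⟨C', by simpa using hC'⟩
      obtain ⟨M, hM0, hM⟩ := exists_coeff_stepWeight_le (n := n) hq0 hq1 ht ht1 PowerSeries.X
        (PowerSeries.C u * PowerSeries.X) (PowerSeries.C v) m
      have hm' := pow_sub_one_ne_zero hq0 hq1 hm
      refine ⟨|q ^ m - 1|⁻¹ * ∑ _J : Finset (Fin n), ∑ _k ∈ Finset.range m,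
        C * (B ^ n)⁻¹ * (max 1 S ^ n * M), fun i ν => ?_⟩
      have e := (isTwisted_iff hq0 hq1 ht ht1 _ (by simp) (by simp) (hL i)).1 (hT i) m ν
      have e' : |PowerSeries.coeff m (L i ν)| = |q ^ m - 1|⁻¹ * |lowerAct q t
          (PowerSeries.C (σ i) * PowerSeries.X) (PowerSeries.C u * PowerSeries.X) (PowerSeries.C v)
          (fun m ν => PowerSeries.coeff m (L i ν)) m ν| := by
        rw [← e, abs_mul, inv_mul_cancel_left₀ (abs_ne_zero.2 hm')]
      rw [e', mul_assoc, Finset.sum_mul]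
      refine mul_le_mul_of_nonneg_left ?_ (by positivity)
      refine (Finset.abs_sum_le_sum_abs _ _).trans (Finset.sum_le_sum fun J _ => ?_)
      rw [Finset.sum_mul]
      split_ifs with hJ
      · refine (Finset.abs_sum_le_sum_abs _ _).trans (Finset.sum_le_sum fun k hk => ?_)
        rw [Finset.mem_range] at hk
        by_cases hν : Antitone (ν - inc J)
        · rw [stepWeight_mul_left, ← map_pow, PowerSeries.coeff_C_mul, abs_mul, abs_mul]
          have h1 := (hCm k hk i (ν - inc J)).trans
            (mul_le_mul_of_nonneg_left (pow_sum_sub_inc_le hB hB1 ν J) hC)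
          have h2 := hM (m - k) (Nat.sub_le _ _) J _ hν
          have h3 : |σ i ^ J.card| ≤ max 1 S ^ n := by
            rw [abs_pow]
            calc |σ i| ^ J.card ≤ max 1 S ^ J.card :=
                  pow_le_pow_left₀ (abs_nonneg _) ((hσ i).trans (le_max_right _ _)) _
              _ ≤ _ := pow_le_pow_right₀ (le_max_left _ _) (by simpa using J.card_le_univ)
          calc _ ≤ (C * ((B ^ n)⁻¹ * B ^ ∑ j, ν j)) * (max 1 S ^ n * M) := by gcongr
            _ = _ := by ring
        · simp only [hL i _ hν, map_zero, zero_mul, abs_zero]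
          positivity
      · rw [abs_zero]
        exact Finset.sum_nonneg fun k _ => by positivity
  intro m
  obtain ⟨C, -, hC⟩ := key (m + 1)
  exact ⟨C, fun i ν => hC m (Nat.lt_succ_self m) i ν⟩

open Filter Topology in

theorem tendsto_coeff_of_isTwisted {n : ℕ} {q t : ℝ} (hq0 : 0 < q) (hq1 : q < 1)
    (ht : 0 < t) (ht1 : t < 1) {σ : ℕ → ℝ} {σ' : ℝ} (hσ : Tendsto σ atTop (𝓝 σ'))
    (u v : ℝ) {L : ℕ → (Fin n → ℕ) → PowerSeries ℝ} {L' : (Fin n → ℕ) → PowerSeries ℝ}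
    (hL : ∀ i, AntitoneSupported (L i)) (hL' : AntitoneSupported L')
    (hT : ∀ i, IsTwisted q t (PowerSeries.C (σ i) * PowerSeries.X)
      (PowerSeries.C u * PowerSeries.X) (PowerSeries.C v) (L i))
    (hT' : IsTwisted q t (PowerSeries.C σ' * PowerSeries.X)
      (PowerSeries.C u * PowerSeries.X) (PowerSeries.C v) L')
    (h0 : ∀ ν, Tendsto (fun i => PowerSeries.constantCoeff (L i ν)) atTop
      (𝓝 (PowerSeries.constantCoeff (L' ν)))) (m : ℕ) (ν : Fin n → ℕ) :
    Tendsto (fun i => PowerSeries.coeff m (L i ν)) atTop (𝓝 (PowerSeries.coeff m (L' ν))) := by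
  induction m using Nat.strong_induction_on generalizing ν with
  | _ m ih =>
    rcases eq_or_ne m 0 with rfl | hm
    · simpa using h0 ν
    · have hm' := pow_sub_one_ne_zero hq0 hq1 hm
      have e (i) := (isTwisted_iff hq0 hq1 ht ht1 _ (by simp) (by simp) (hL i)).1 (hT i) m ν
      have e' := (isTwisted_iff hq0 hq1 ht ht1 _ (by simp) (by simp) hL').1 hT' m ν
      suffices h : Tendsto (fun i => (q ^ m - 1) * PowerSeries.coeff m (L i ν)) atTop
          (𝓝 ((q ^ m - 1) * PowerSeries.coeff m (L' ν))) by
        simpa [inv_mul_cancel_left₀ hm'] using h.const_mul (q ^ m - 1)⁻¹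
      simp only [e, e']
      refine tendsto_finsetSum _ fun J _ => ?_
      split_ifs
      · refine tendsto_finsetSum _ fun k hk => ?_
        simp only [stepWeight_mul_left, ← map_pow, PowerSeries.coeff_C_mul]
        exact (ih k (Finset.mem_range.1 hk) _).mul ((hσ.pow _).mul_const _)
      · exact tendsto_const_nhds

theorem det_add_rows {n : ℕ} {R : Type*} [CommRing R] [Algebra ℝ R] (a b : Fin n → R)
    (f : ℝ → Fin n → ℝ) (z w : Fin n → ℝ) :
    (Matrix.of fun i j => a i * algebraMap ℝ R (f (z i) j) +
      b i * algebraMap ℝ R (f (w i) j)).det =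
    ∑ I : Finset (Fin n), algebraMap ℝ R (Matrix.of fun i j =>
      f (if i ∈ I then z i else w i) j).det * ((∏ i ∈ I, a i) * ∏ i ∈ Iᶜ, b i) := by
  have h := (Matrix.detRowAlternating (R := R) (n := Fin n)).toMultilinearMap.map_add_univ
    (fun i j => a i * algebraMap ℝ R (f (z i) j)) (fun i j => b i * algebraMap ℝ R (f (w i) j))
  refine Eq.trans h (Finset.sum_congr rfl fun I _ => ?_)
  have e : (I.piecewise (fun i j => a i * algebraMap ℝ R (f (z i) j))
      (fun i j => b i * algebraMap ℝ R (f (w i) j)) : Fin n → Fin n → R) =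
      Matrix.of fun i j => (if i ∈ I then a i else b i) *
        (algebraMap ℝ R).mapMatrix (Matrix.of fun i j => f (if i ∈ I then z i else w i) j) i j := by
    funext i j
    by_cases hi : i ∈ I <;> simp [hi]
  rw [e]
  refine (Matrix.det_mul_column _ _).trans ?_
  rw [← RingHom.map_det, mul_comm, Finset.prod_ite]
  congr 3 <;> ext <;> simp

theorem prod_ltPairs {n : ℕ} {M : Type*} [CommMonoid M] (e : Fin n → Fin n → M) :
    ∏ p ∈ ltPairs n, e p.1 p.2 = ∏ i, ∏ j ∈ Finset.Ioi i, e i j := by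
  rw [ltPairs, Finset.prod_filter, ← Finset.univ_product_univ, Finset.prod_product]
  refine Finset.prod_congr rfl fun i _ => ?_
  rw [← Finset.prod_filter]
  congr 1
  ext j; simp

theorem det_vandermonde_ltPairs {n : ℕ} (y : Fin n → ℝ) :
    (Matrix.vandermonde y).det = ∏ p ∈ ltPairs n, (y p.2 - y p.1) := by
  rw [Matrix.det_vandermonde, prod_ltPairs fun i j => y j - y i]

theorem det_vandermonde_scaleOn {n : ℕ} (t : ℝ) {y : Fin n → ℝ} (hy : Function.Injective y)
    (J : Finset (Fin n)) :
    (Matrix.vandermonde (scaleOn t J y)).det = (Matrix.vandermonde y).det * vdmRatio t y J := by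
  rw [det_vandermonde_ltPairs, det_vandermonde_ltPairs, vdmRatio, ← Finset.prod_mul_distrib]
  refine Finset.prod_congr rfl fun p hp => ?_
  have : y p.2 - y p.1 ≠ 0 := sub_ne_zero.2 fun h =>
    (Finset.mem_filter.1 hp).2.ne' (hy h)
  field_simp

theorem det_vandermonde_ne_zero' {n : ℕ} {y : Fin n → ℝ} (hy : Function.Injective y) :
    (Matrix.vandermonde y).det ≠ 0 := Matrix.det_vandermonde_ne_zero_iff.2 hy

theorem vandermonde_mul_sum {n : ℕ} {R : Type*} [CommRing R] [Algebra ℝ R] (t : ℝ) {y : Fin n → ℝ}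
    (hy : Function.Injective y) (f g : Fin n → R) :
    algebraMap ℝ R (Matrix.vandermonde y).det * ∑ J : Finset (Fin n),
      algebraMap ℝ R (vdmRatio t y J) * ((∏ i ∈ J, f i) * ∏ i ∈ Jᶜ, g i) =
    (Matrix.of fun i (j : Fin n) => f i * algebraMap ℝ R ((t * y i) ^ (j : ℕ)) +
      g i * algebraMap ℝ R (y i ^ (j : ℕ))).det := by
  rw [det_add_rows f g (fun x j => x ^ (j : ℕ)), Finset.mul_sum]
  refine Finset.sum_congr rfl fun J _ => ?_
  rw [← mul_assoc, ← map_mul, ← det_vandermonde_scaleOn t hy]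
  rfl

theorem isUnit_algebraMap_of_ne_zero {R : Type*} [CommRing R] [Algebra ℝ R] {r : ℝ} (hr : r ≠ 0) :
    IsUnit (algebraMap ℝ R r) := (IsUnit.mk0 r hr).map _

/-- Summation of the steps with linear weights, when the top coefficient vanishes. -/
theorem sum_vdmRatio_linear_top {n : ℕ} {R : Type*} [CommRing R] [Algebra ℝ R] (t : ℝ)
    {y : Fin n → ℝ} (hy : Function.Injective y) (f₀ f₁ g₀ g₁ : R)
    (h : ∀ j, j + 1 = n → g₁ + algebraMap ℝ R (t ^ j) * f₁ = 0) :
    ∑ J : Finset (Fin n), algebraMap ℝ R (vdmRatio t y J) *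
      ((∏ i ∈ J, (f₀ + f₁ * algebraMap ℝ R (y i))) *
        ∏ i ∈ Jᶜ, (g₀ + g₁ * algebraMap ℝ R (y i))) =
    ∏ i ∈ Finset.range n, (g₀ + algebraMap ℝ R (t ^ i) * f₀) := by
  refine (isUnit_algebraMap_of_ne_zero (R := R) (det_vandermonde_ne_zero' hy)).mul_left_cancel ?_
  rw [vandermonde_mul_sum t hy]
  set N : Matrix (Fin n) (Fin n) R := Matrix.of fun l j =>
    if l = j then g₀ + algebraMap ℝ R (t ^ (j : ℕ)) * f₀ else
      if (l : ℕ) = j + 1 then g₁ + algebraMap ℝ R (t ^ (j : ℕ)) * f₁ else 0 with hN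
  have hM : (Matrix.of fun i (j : Fin n) => (f₀ + f₁ * algebraMap ℝ R (y i)) *
      algebraMap ℝ R ((t * y i) ^ (j : ℕ)) +
      (g₀ + g₁ * algebraMap ℝ R (y i)) * algebraMap ℝ R (y i ^ (j : ℕ))) =
      (algebraMap ℝ R).mapMatrix (Matrix.vandermonde y) * N := by
    ext i j
    have e (l : Fin n) : N l j = (if l = j then g₀ + algebraMap ℝ R (t ^ (j : ℕ)) * f₀ else 0) +
        if (l : ℕ) = j + 1 then g₁ + algebraMap ℝ R (t ^ (j : ℕ)) * f₁ else 0 := by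
      simp only [hN, Matrix.of_apply]
      by_cases h1 : l = j
      · simp [h1]
      · simp [h1]
    simp only [Matrix.mul_apply, e, mul_add, Finset.sum_add_distrib, Matrix.of_apply, mul_ite,
      mul_zero, Finset.sum_ite_eq', Finset.mem_univ, if_true, RingHom.mapMatrix_apply,
      Matrix.map_apply, Matrix.vandermonde_apply]
    have e2 : ∑ l : Fin n, (if (l : ℕ) = j + 1 then algebraMap ℝ R (y i ^ (l : ℕ)) * g₁ +
        algebraMap ℝ R (y i ^ (l : ℕ)) * (algebraMap ℝ R (t ^ (j : ℕ)) * f₁) else 0) =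
        algebraMap ℝ R (y i ^ ((j : ℕ) + 1)) * (g₁ + algebraMap ℝ R (t ^ (j : ℕ)) * f₁) := by
      by_cases hj : (j : ℕ) + 1 < n
      · rw [Finset.sum_eq_single ⟨j + 1, hj⟩]
        · simp [mul_add]
        · intro l _ hl
          exact if_neg fun h => hl (Fin.ext h)
        · simp
      · rw [h j (by omega), mul_zero]
        refine Finset.sum_eq_zero fun l _ => if_neg ?_
        omega
    rw [e2]
    simp only [mul_pow, map_mul, map_pow]
    ring
  rw [hM, Matrix.det_mul, ← RingHom.map_det]
  congr 1
  rw [Matrix.det_of_isLowerTriangular N]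
  · rw [Finset.prod_range]
    simp [hN]
  · intro i j hij
    have : i < j := hij
    simp only [hN, Matrix.of_apply]
    rw [if_neg this.ne, if_neg]
    have := Fin.lt_def.1 this
    omega

/-- Summation of the steps with linear weights, when the bottom coefficient vanishes. -/
theorem sum_vdmRatio_linear_bot {n : ℕ} {R : Type*} [CommRing R] [Algebra ℝ R] (t : ℝ)
    {y : Fin n → ℝ} (hy : Function.Injective y) (f₀ f₁ g₀ g₁ : R) (h : g₀ + f₀ = 0) :
    ∑ J : Finset (Fin n), algebraMap ℝ R (vdmRatio t y J) *
      ((∏ i ∈ J, (f₀ + f₁ * algebraMap ℝ R (y i))) *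
        ∏ i ∈ Jᶜ, (g₀ + g₁ * algebraMap ℝ R (y i))) =
    algebraMap ℝ R (∏ i, y i) * ∏ i ∈ Finset.range n, (g₁ + algebraMap ℝ R (t ^ i) * f₁) := by
  refine (isUnit_algebraMap_of_ne_zero (R := R) (det_vandermonde_ne_zero' hy)).mul_left_cancel ?_
  rw [vandermonde_mul_sum t hy]
  set N : Matrix (Fin n) (Fin n) R := Matrix.of fun l j =>
    if l = j then g₁ + algebraMap ℝ R (t ^ (j : ℕ)) * f₁ else
      if (l : ℕ) + 1 = j then g₀ + algebraMap ℝ R (t ^ (j : ℕ)) * f₀ else 0 with hN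
  have hM : (Matrix.of fun i (j : Fin n) => (f₀ + f₁ * algebraMap ℝ R (y i)) *
      algebraMap ℝ R ((t * y i) ^ (j : ℕ)) +
      (g₀ + g₁ * algebraMap ℝ R (y i)) * algebraMap ℝ R (y i ^ (j : ℕ))) =
      Matrix.of fun i j => algebraMap ℝ R (y i) *
        ((algebraMap ℝ R).mapMatrix (Matrix.vandermonde y) * N) i j := by
    ext i j
    have e (l : Fin n) : N l j = (if l = j then g₁ + algebraMap ℝ R (t ^ (j : ℕ)) * f₁ else 0) +
        if (l : ℕ) + 1 = j then g₀ + algebraMap ℝ R (t ^ (j : ℕ)) * f₀ else 0 := by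
      simp only [hN, Matrix.of_apply]
      by_cases h1 : l = j
      · simp [h1]
      · simp [h1]
    simp only [Matrix.mul_apply, e, mul_add, Finset.sum_add_distrib, Matrix.of_apply, mul_ite,
      mul_zero, Finset.sum_ite_eq', Finset.mem_univ, if_true, RingHom.mapMatrix_apply,
      Matrix.map_apply, Matrix.vandermonde_apply]
    have e2 : algebraMap ℝ R (y i) * ∑ l : Fin n, (if (l : ℕ) + 1 = j then
        algebraMap ℝ R (y i ^ (l : ℕ)) * g₀ +
        algebraMap ℝ R (y i ^ (l : ℕ)) * (algebraMap ℝ R (t ^ (j : ℕ)) * f₀) else 0) =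
        algebraMap ℝ R (y i ^ (j : ℕ)) * (g₀ + algebraMap ℝ R (t ^ (j : ℕ)) * f₀) := by
      rcases Nat.eq_zero_or_pos (j : ℕ) with hj | hj
      · rw [hj, pow_zero, map_one, pow_zero, map_one, one_mul, h, mul_zero, Finset.sum_eq_zero,
          mul_zero]
        intro l _
        exact if_neg (by omega)
      · have hj' : (j : ℕ) - 1 + 1 = j := by omega
        rw [Finset.sum_eq_single ⟨j - 1, by omega⟩]
        · simp only [hj', if_true]
          conv_rhs => rw [← hj', pow_succ, map_mul]
          simp only [hj']
          ring
        · intro l _ hl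
          exact if_neg fun h => hl (Fin.ext (by simp only; omega))
        · simp
    rw [e2]
    simp only [mul_pow, map_mul, map_pow]
    ring
  rw [hM, Matrix.det_mul_column, Matrix.det_mul, ← RingHom.map_det, map_prod, mul_left_comm]
  congr 2
  rw [Matrix.det_of_isUpperTriangular (M := N)]
  · rw [Finset.prod_range]
    simp [hN]
  · intro i j hij
    have : j < i := hij
    simp only [hN, Matrix.of_apply]
    rw [if_neg this.ne', if_neg]
    have := Fin.lt_def.1 this
    omega

theorem vdmRatio_mul_left {n : ℕ} (t : ℝ) {a : ℝ} (ha : a ≠ 0) (y : Fin n → ℝ)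
    (J : Finset (Fin n)) : vdmRatio t (fun i => a * y i) J = vdmRatio t y J := by
  refine Finset.prod_congr rfl fun p _ => ?_
  have e (i : Fin n) : scaleOn t J (fun i => a * y i) i = a * scaleOn t J y i := by
    unfold scaleOn; split_ifs <;> ring
  rw [e, e, ← mul_sub, ← mul_sub, mul_div_mul_left _ _ ha]

theorem exists_det_cauchy {n : ℕ} {y : Fin n → ℝ} (hy : Function.Injective y) :
    ∃ K ≠ 0, ∀ z : Fin n → ℝ, (∀ i j, y j - z i ≠ 0) →
      (Matrix.of fun i j => (y j - z i)⁻¹).det * ∏ i, ∏ j, (y j - z i) =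
        (Matrix.vandermonde z).det * K := by
  set p : Fin n → ℝ[X] := fun j => ∏ l ∈ Finset.univ.erase j, (C (y l) - X) with hp
  have hdeg (j : Fin n) : (p j).natDegree < n := by
    refine (natDegree_prod_le _ _).trans_lt ?_
    refine (Finset.sum_le_card_nsmul _ _ 1 fun l _ => ?_).trans_lt ?_
    · compute_degree
    · have : 0 < n := j.pos
      simp [Finset.card_erase_of_mem]
      omega
  have hM (z : Fin n → ℝ) : (Matrix.of fun i j => (p j).eval (z i)) =
      Matrix.vandermonde z * Matrix.of fun (l : Fin n) j => (p j).coeff l := by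
    ext i j
    rw [Matrix.mul_apply, Matrix.of_apply, eval_eq_sum_range' (hdeg j), Finset.sum_range]
    simp [mul_comm]
  have hev (z : Fin n → ℝ) (i j : Fin n) :
      (p j).eval (z i) = ∏ l ∈ Finset.univ.erase j, (y l - z i) := by
    simp [hp, eval_prod]
  refine ⟨(Matrix.of fun (l : Fin n) j => (p j).coeff l).det, fun h => ?_, fun z hz => ?_⟩
  · have h1 : (Matrix.of fun i j => (p j).eval (y i)) =
        Matrix.diagonal fun j => ∏ l ∈ Finset.univ.erase j, (y l - y j) := by
      ext i j
      rw [Matrix.of_apply, hev, Matrix.diagonal_apply]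
      split_ifs with hij
      · rw [hij]
      · exact Finset.prod_eq_zero (Finset.mem_erase.2 ⟨hij, Finset.mem_univ i⟩) (sub_self _)
    have h2 := congrArg Matrix.det (h1.symm.trans (hM y))
    rw [Matrix.det_mul, h, mul_zero, Matrix.det_diagonal, Finset.prod_eq_zero_iff] at h2
    obtain ⟨j, _, hj⟩ := h2
    obtain ⟨l, hl, hlj⟩ := Finset.prod_eq_zero_iff.1 hj
    exact (Finset.mem_erase.1 hl).1 (hy (sub_eq_zero.1 hlj))
  · rw [← Matrix.det_mul, ← hM, mul_comm, ← Matrix.det_mul_column]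
    congr 1
    ext i j
    simp only [Matrix.of_apply]
    rw [hev, ← Finset.mul_prod_erase _ _ (Finset.mem_univ j), mul_comm, ← mul_assoc,
      inv_mul_cancel₀ (hz i j), one_mul]

theorem det_cauchy_ne_zero {n : ℕ} {y z : Fin n → ℝ} (hy : Function.Injective y)
    (hz : Function.Injective z) (h : ∀ i j, y j - z i ≠ 0) :
    (Matrix.of fun i j => (y j - z i)⁻¹).det ≠ 0 := by
  obtain ⟨K, hK, hdet⟩ := exists_det_cauchy hy
  intro h0
  have := hdet z h
  rw [h0, zero_mul] at this
  exact mul_ne_zero (det_vandermonde_ne_zero' hz) hK this.symm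

theorem det_cauchy_scaleOn {n : ℕ} (t : ℝ) {y z : Fin n → ℝ} (hy : Function.Injective y)
    (hz : Function.Injective z) (h : ∀ i j, y j - z i ≠ 0) (h' : ∀ i j, y j - t * z i ≠ 0)
    (I : Finset (Fin n)) :
    (Matrix.of fun i j => (y j - if i ∈ I then t * z i else z i)⁻¹).det =
      (Matrix.of fun i j => (y j - z i)⁻¹).det * (vdmRatio t z I *
        ∏ i ∈ I, ∏ j, (y j - z i) / (y j - t * z i)) := by
  obtain ⟨K, hK, hdet⟩ := exists_det_cauchy hy
  have h1 := hdet z h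
  have h2 := hdet (scaleOn t I z) fun i j => by unfold scaleOn; split_ifs <;> simp [*]
  rw [det_vandermonde_scaleOn t hz] at h2
  have e : ∏ i, ∏ j, (y j - scaleOn t I z i) = (∏ i, ∏ j, (y j - z i)) /
      ∏ i ∈ I, ∏ j, (y j - z i) / (y j - t * z i) := by
    rw [eq_div_iff (Finset.prod_ne_zero_iff.2 fun i _ => Finset.prod_ne_zero_iff.2 fun j _ =>
      div_ne_zero (h i j) (h' i j)), ← Fintype.prod_ite_mem I,
      ← Finset.prod_mul_distrib]
    refine Finset.prod_congr rfl fun i _ => ?_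
    unfold scaleOn
    split_ifs
    · rw [← Finset.prod_mul_distrib]
      exact Finset.prod_congr rfl fun j _ => mul_div_cancel₀ _ (h' i j)
    · rw [mul_one]
  have h0 : ∏ i, ∏ j, (y j - z i) ≠ 0 :=
    Finset.prod_ne_zero_iff.2 fun i _ => Finset.prod_ne_zero_iff.2 fun j _ => h i j
  have h3 : ∏ i ∈ I, ∏ j, (y j - z i) / (y j - t * z i) ≠ 0 :=
    Finset.prod_ne_zero_iff.2 fun i _ => Finset.prod_ne_zero_iff.2 fun j _ =>
      div_ne_zero (h i j) (h' i j)
  rw [e] at h2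
  unfold scaleOn at h2
  refine mul_right_cancel₀ (div_ne_zero h0 h3) (h2.trans ?_)
  rw [mul_right_comm, ← h1, ← mul_assoc, mul_assoc _ _ (_ / _), mul_div_cancel₀ _ h3]
  ring

/-- Summation of the steps against a Cauchy kernel. -/
theorem det_cauchy_mul_sum {n : ℕ} (t : ℝ) {y z : Fin n → ℝ} (hy : Function.Injective y)
    (hz : Function.Injective z) (h : ∀ i j, y j - z i ≠ 0) (h' : ∀ i j, y j - t * z i ≠ 0)
    (a b : Fin n → ℝ) :
    (Matrix.of fun i j => (y j - z i)⁻¹).det * ∑ I : Finset (Fin n), vdmRatio t z I *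
      ((∏ i ∈ I, a i * ∏ j, (y j - z i) / (y j - t * z i)) * ∏ i ∈ Iᶜ, b i) =
    (Matrix.of fun i j => a i * (y j - t * z i)⁻¹ + b i * (y j - z i)⁻¹).det := by
  have := det_add_rows (R := ℝ) a b (fun x j => (y j - x)⁻¹) (fun i => t * z i) z
  simp only [Algebra.algebraMap_self, RingHom.id_apply] at this
  rw [this, Finset.mul_sum]
  refine Finset.sum_congr rfl fun I _ => ?_
  rw [det_cauchy_scaleOn t hy hz h h', Finset.prod_mul_distrib]
  ring

/-- The sum over all subsets of the coordinates with multiplicative weights and the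
Vandermonde ratio. -/
noncomputable def stepSum {n : ℕ} {R : Type*} [CommRing R] [Algebra ℝ R] (t : ℝ) (y : Fin n → ℝ)
    (a b : Fin n → R) : R :=
  ∑ J : Finset (Fin n), algebraMap ℝ R (vdmRatio t y J) * ((∏ i ∈ J, a i) * ∏ i ∈ Jᶜ, b i)

theorem map_stepSum {n : ℕ} {R S : Type*} [CommRing R] [Algebra ℝ R] [CommRing S] [Algebra ℝ S]
    (f : R →ₐ[ℝ] S) (t : ℝ) (y : Fin n → ℝ) (a b : Fin n → R) :
    f (stepSum t y a b) = stepSum t y (fun i => f (a i)) fun i => f (b i) := by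
  simp [stepSum, map_sum, map_mul, map_prod]

theorem sum_finset_fin_succ {n : ℕ} {M : Type*} [AddCommMonoid M] (F : Finset (Fin (n + 1)) → M) :
    ∑ I, F I = ∑ I : Finset (Fin n), (F (I.map (Fin.succEmb n)) +
      F (insert 0 (I.map (Fin.succEmb n)))) := by
  have h0 : (0 : Fin (n + 1)) ∉ Finset.univ.map (Fin.succEmb n) := by simp
  have e : (Finset.univ : Finset (Fin (n + 1))) = insert 0 (Finset.univ.map (Fin.succEmb n)) := by
    ext i
    cases i using Fin.cases <;> simp
  have hp : (Finset.univ.map (Fin.succEmb n)).powerset =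
      Finset.univ.image fun I : Finset (Fin n) => I.map (Fin.succEmb n) := by
    ext I
    simp only [Finset.mem_powerset, Finset.mem_image, Finset.mem_univ, true_and,
      Finset.subset_map_iff, Finset.subset_univ]
    exact exists_congr fun _ => eq_comm
  rw [← Finset.powerset_univ, e, Finset.sum_powerset_insert h0, hp,
    Finset.sum_image fun I _ J _ h => Finset.map_injective _ h,
    Finset.sum_image fun I _ J _ h => Finset.map_injective _ h, ← Finset.sum_add_distrib]

theorem prod_mul_prod_compl_eq_prod_ite {n : ℕ} {R : Type*} [CommRing R] (J : Finset (Fin n))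
    (a b : Fin n → R) : (∏ i ∈ J, a i) * ∏ i ∈ Jᶜ, b i = ∏ i, if i ∈ J then a i else b i := by
  rw [Finset.prod_ite]
  congr 1 <;> refine Finset.prod_congr (by ext; simp) fun _ _ => rfl

theorem vdmRatio_cons_zero {n : ℕ} (t : ℝ) {x : Fin n → ℝ} (hx : ∀ i, x i ≠ 0)
    (J : Finset (Fin (n + 1))) (I : Finset (Fin n)) (h : ∀ i : Fin n, i.succ ∈ J ↔ i ∈ I) :
    vdmRatio t (Fin.cons 0 x : Fin (n + 1) → ℝ) J =
      (∏ i, if i ∈ I then t else 1) * vdmRatio t x I := by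
  have hs (i : Fin n) : scaleOn t J (Fin.cons 0 x : Fin (n + 1) → ℝ) i.succ = scaleOn t I x i := by
    simp [scaleOn, h]
  have h0 : scaleOn t J (Fin.cons 0 x : Fin (n + 1) → ℝ) 0 = 0 := by simp [scaleOn]
  unfold vdmRatio
  rw [prod_ltPairs fun i j => (scaleOn t J (Fin.cons 0 x : Fin (n + 1) → ℝ) j -
      scaleOn t J (Fin.cons 0 x : Fin (n + 1) → ℝ) i) / ((Fin.cons 0 x : Fin (n + 1) → ℝ) j -
      (Fin.cons 0 x : Fin (n + 1) → ℝ) i),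
    prod_ltPairs fun i j => (scaleOn t I x j - scaleOn t I x i) / (x j - x i),
    Fin.prod_univ_succ, Fin.prod_Ioi_zero]
  congr 1
  · refine Finset.prod_congr rfl fun i _ => ?_
    rw [hs, h0, Fin.cons_succ, Fin.cons_zero, sub_zero, sub_zero, scaleOn]
    split_ifs
    · rw [mul_div_cancel_right₀ _ (hx i)]
    · rw [div_self (hx i)]
  · refine Finset.prod_congr rfl fun i _ => ?_
    rw [Fin.prod_Ioi_succ]
    simp only [hs, Fin.cons_succ]

theorem stepSum_cons_zero {n : ℕ} (t : ℝ) {x : Fin n → ℝ} (hx : ∀ i, x i ≠ 0)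
    (a b : Fin (n + 1) → ℝ) :
    stepSum t (Fin.cons 0 x : Fin (n + 1) → ℝ) a b =
      (b 0 + a 0) * stepSum t x (fun i => t * a i.succ) fun i => b i.succ := by
  unfold stepSum
  rw [sum_finset_fin_succ, Finset.mul_sum]
  refine Finset.sum_congr rfl fun I _ => ?_
  have e : ∏ i, (if i ∈ I then t * a i.succ else b i.succ) =
      (∏ i, if i ∈ I then t else 1) * ∏ i, if i ∈ I then a i.succ else b i.succ := by
    rw [← Finset.prod_mul_distrib]
    exact Finset.prod_congr rfl fun i _ => by split_ifs <;> simp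
  rw [vdmRatio_cons_zero t hx _ I (by simp), vdmRatio_cons_zero t hx _ I (by simp)]
  simp only [prod_mul_prod_compl_eq_prod_ite, Fin.prod_univ_succ, Algebra.algebraMap_self,
    RingHom.id_apply, e]
  simp
  ring

theorem continuousAt_stepSum {n : ℕ} (t : ℝ) {x : ℝ → Fin n → ℝ} {a b : ℝ → Fin n → ℝ} {e : ℝ}
    (hx : ∀ i, ContinuousAt (fun e => x e i) e) (ha : ∀ i, ContinuousAt (fun e => a e i) e)
    (hb : ∀ i, ContinuousAt (fun e => b e i) e) (hinj : Function.Injective (x e)) :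
    ContinuousAt (fun e => stepSum t (x e) (a e) (b e)) e := by
  simp only [stepSum, Algebra.algebraMap_self, RingHom.id_apply]
  refine tendsto_finsetSum _ fun J _ => ContinuousAt.mul ?_ (ContinuousAt.mul
    (tendsto_finsetProd _ fun i _ => ha i) (tendsto_finsetProd _ fun i _ => hb i))
  unfold vdmRatio
  refine tendsto_finsetProd _ fun p hp => ?_
  refine ContinuousAt.div ?_ ((hx _).sub (hx _)) (sub_ne_zero.2 fun h =>
    (Finset.mem_filter.1 hp).2.ne' (hinj h))
  unfold scaleOn
  refine ContinuousAt.sub ?_ ?_ <;> split_ifs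
  exacts [continuousAt_const.mul (hx _), hx _, continuousAt_const.mul (hx _), hx _]

/-- The source of the first family of coordinates. -/
noncomputable def sourceLeft {k n : ℕ} {R : Type*} [CommRing R] [Algebra ℝ R] (t : ℝ) (c : R)
    (x : Fin k → ℝ) (y : Fin n → ℝ) : R :=
  stepSum t x (fun i => c * algebraMap ℝ R ((1 - x i) * ∏ j, (t * y j - x i) / (y j - x i)))
    fun i => 1 + c * algebraMap ℝ R (t ^ k / t * x i)

/-- The source of the second family of coordinates. -/
noncomputable def sourceRight {k n : ℕ} {R : Type*} [CommRing R] [Algebra ℝ R] (t : ℝ) (c : R)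
    (x : Fin k → ℝ) (y : Fin n → ℝ) : R :=
  stepSum t⁻¹ y
    (fun j => c * algebraMap ℝ R (t ^ n / t * (1 - y j) * ∏ i, (t * y j - x i) / (y j - x i)))
    fun j => 1 + c * algebraMap ℝ R (t ^ k * y j)

theorem map_sourceLeft {k n : ℕ} {R S : Type*} [CommRing R] [Algebra ℝ R] [CommRing S] [Algebra ℝ S]
    (f : R →ₐ[ℝ] S) (t : ℝ) (c : R) (x : Fin k → ℝ) (y : Fin n → ℝ) :
    f (sourceLeft t c x y) = sourceLeft t (f c) x y := by
  simp [sourceLeft, map_stepSum]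

theorem map_sourceRight {k n : ℕ} {R S : Type*} [CommRing R] [Algebra ℝ R] [CommRing S]
    [Algebra ℝ S] (f : R →ₐ[ℝ] S) (t : ℝ) (c : R) (x : Fin k → ℝ) (y : Fin n → ℝ) :
    f (sourceRight t c x y) = sourceRight t (f c) x y := by
  simp [sourceRight, map_stepSum]

theorem sourceLeft_eq_sourceRight {n : ℕ} {t : ℝ} (ht : 0 < t) (c : ℝ) {x y : Fin n → ℝ}
    (hx : Function.Injective x) (hy : Function.Injective y) (h : ∀ i j, y j - x i ≠ 0)
    (h' : ∀ i j, t * y j - x i ≠ 0) : sourceLeft t c x y = sourceRight t c x y := by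
  set z : Fin n → ℝ := fun i => t⁻¹ * x i with hz
  have ht0 := ht.ne'
  have hxz (i) : x i = t * z i := by rw [hz]; field_simp
  have hzi : Function.Injective z := fun i j hij => hx (mul_left_cancel₀ (inv_ne_zero ht0) hij)
  have h1 (i j) : y j - z i ≠ 0 := fun e => h' i j (by rw [hxz]; linear_combination t * e)
  have h2 (i j) : y j - t * z i ≠ 0 := by rw [← hxz]; exact h i j
  have h3 (j i) : z i - y j ≠ 0 := fun e => h1 i j (by linear_combination -e)
  have h4 (j i) : z i - t⁻¹ * y j ≠ 0 := fun e => h2 i j (by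
    have : t * (z i - t⁻¹ * y j) = t * z i - y j := by field_simp
    rw [e] at this; linarith)
  have eX := det_cauchy_mul_sum t hy hzi h1 h2 (fun i => t ^ n * (c * (1 - x i)))
    fun i => 1 + c * (t ^ n / t * x i)
  have eY := det_cauchy_mul_sum t⁻¹ hzi hy h3 h4 (fun j => c * (t ^ n / t * (1 - y j)))
    fun j => 1 + c * (t ^ n * y j)
  have sX : sourceLeft t c x y = ∑ I : Finset (Fin n), vdmRatio t z I *
      ((∏ i ∈ I, t ^ n * (c * (1 - x i)) * ∏ j, (y j - z i) / (y j - t * z i)) *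
        ∏ i ∈ Iᶜ, (1 + c * (t ^ n / t * x i))) := by
    unfold sourceLeft stepSum
    refine Finset.sum_congr rfl fun I _ => ?_
    rw [hz, vdmRatio_mul_left t (inv_ne_zero ht0)]
    simp only [Algebra.algebraMap_self, RingHom.id_apply]
    congr 2
    refine Finset.prod_congr rfl fun i _ => ?_
    have e : ∏ j, (t * y j - x i) / (y j - x i) =
        t ^ n * ∏ j, (y j - t⁻¹ * x i) / (y j - t * (t⁻¹ * x i)) := by
      rw [← Fin.prod_const n t, ← Finset.prod_mul_distrib]
      refine Finset.prod_congr rfl fun j _ => ?_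
      rw [mul_inv_cancel_left₀ ht0, mul_div_assoc', mul_sub, mul_inv_cancel_left₀ ht0]
    rw [e]; ring
  have sY : sourceRight t c x y = ∑ J : Finset (Fin n), vdmRatio t⁻¹ y J *
      ((∏ j ∈ J, c * (t ^ n / t * (1 - y j)) * ∏ i, (z i - y j) / (z i - t⁻¹ * y j)) *
        ∏ j ∈ Jᶜ, (1 + c * (t ^ n * y j))) := by
    unfold sourceRight stepSum
    refine Finset.sum_congr rfl fun J _ => ?_
    simp only [Algebra.algebraMap_self, RingHom.id_apply]
    congr 2
    refine Finset.prod_congr rfl fun j _ => ?_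
    have e : ∏ i, (t * y j - x i) / (y j - x i) = ∏ i, (z i - y j) / (z i - t⁻¹ * y j) := by
      refine Finset.prod_congr rfl fun i _ => ?_
      rw [div_eq_div_iff (h i j) (h4 j i), hxz]
      field_simp
      ring
    rw [e]; ring
  rw [← sX] at eX
  rw [← sY] at eY
  have hD : (Matrix.of fun j i => (z i - y j)⁻¹) = -(Matrix.of fun i j => (y j - z i)⁻¹).transpose := by
    ext j i
    simp only [Matrix.of_apply, Matrix.neg_apply, Matrix.transpose_apply]
    rw [← inv_neg, neg_sub]
  have hN : (Matrix.of fun j i => c * (t ^ n / t * (1 - y j)) * (z i - t⁻¹ * y j)⁻¹ +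
      (1 + c * (t ^ n * y j)) * (z i - y j)⁻¹) =
      -(Matrix.of fun i j => t ^ n * (c * (1 - x i)) * (y j - t * z i)⁻¹ +
        (1 + c * (t ^ n / t * x i)) * (y j - z i)⁻¹).transpose := by
    ext j i
    simp only [Matrix.of_apply, Matrix.neg_apply, Matrix.transpose_apply]
    have e1 : (z i - t⁻¹ * y j)⁻¹ = -(t * (y j - t * z i)⁻¹) := by
      rw [← mul_neg, ← inv_neg, eq_comm, ← div_eq_mul_inv, div_eq_iff (neg_ne_zero.2 (h2 i j)),
        eq_comm, inv_mul_eq_iff_eq_mul₀ (h4 j i)]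
      field_simp
      ring
    have e2 : (z i - y j)⁻¹ = -(y j - z i)⁻¹ := by rw [← inv_neg, neg_sub]
    have e3 : (y j - z i) * (y j - z i)⁻¹ = 1 := mul_inv_cancel₀ (h1 i j)
    have e4 : (y j - t * z i) * (y j - t * z i)⁻¹ = 1 := mul_inv_cancel₀ (h2 i j)
    have e5 : t ^ n / t * t = t ^ n := div_mul_cancel₀ _ ht0
    rw [e1, e2, hxz]
    linear_combination (-c * t ^ n) * e3 + c * t ^ n * e4 -
      c * (1 - y j) * (y j - t * z i)⁻¹ * e5 + c * z i * (y j - z i)⁻¹ * e5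
  rw [hD, hN, Matrix.det_neg, Matrix.det_neg, Matrix.det_transpose, Matrix.det_transpose,
    mul_assoc, ← eX] at eY
  refine (mul_left_cancel₀ (det_cauchy_ne_zero hy hzi h1) ?_)
  exact (mul_left_cancel₀ (pow_ne_zero _ (by norm_num)) eY).symm

/-- Condition ensuring that all the factors of the source identity are finite and nonzero. -/
structure SourceGeneric {k n : ℕ} (t : ℝ) (x : Fin k → ℝ) (y : Fin n → ℝ) : Prop where
  injX : Function.Injective x
  injY : Function.Injective y
  neX : ∀ i, x i ≠ 0
  neY : ∀ j, y j ≠ 0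
  sub_ne : ∀ i j, y j - x i ≠ 0
  mul_sub_ne : ∀ i j, t * y j - x i ≠ 0

theorem eventually_ne_nhdsNE_zero {a : ℝ} (ha : a ≠ 0) : ∀ᶠ e in nhdsWithin (0 : ℝ) {0}ᶜ, e ≠ a :=
  nhdsWithin_le_nhds (isOpen_ne.mem_nhds ha.symm)

theorem SourceGeneric.eventually_cons_left {k n : ℕ} {t : ℝ} (ht : 0 < t) {x : Fin k → ℝ}
    {y : Fin n → ℝ} (h : SourceGeneric t x y) : ∀ᶠ e in nhdsWithin (0 : ℝ) {0}ᶜ,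
      SourceGeneric t (Fin.cons e x : Fin (k + 1) → ℝ) y := by
  filter_upwards [self_mem_nhdsWithin,
    Filter.eventually_all.2 fun i => eventually_ne_nhdsNE_zero (h.neX i),
    Filter.eventually_all.2 fun j => eventually_ne_nhdsNE_zero (h.neY j),
    Filter.eventually_all.2 fun j => eventually_ne_nhdsNE_zero (mul_ne_zero ht.ne' (h.neY j))]
    with e h0 h1 h2 h3
  refine ⟨Fin.cons_injective_iff.2 ⟨?_, h.injX⟩, h.injY, ?_, h.neY, ?_, ?_⟩
  · rintro ⟨i, hi⟩
    exact h1 i hi.symm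
  · exact Fin.cases h0 h.neX
  · exact Fin.cases (fun j => sub_ne_zero.2 (h2 j).symm) h.sub_ne
  · exact Fin.cases (fun j => sub_ne_zero.2 (h3 j).symm) h.mul_sub_ne

theorem SourceGeneric.eventually_cons_right {k n : ℕ} {t : ℝ} (ht : 0 < t) {x : Fin k → ℝ}
    {y : Fin n → ℝ} (h : SourceGeneric t x y) : ∀ᶠ e in nhdsWithin (0 : ℝ) {0}ᶜ,
      SourceGeneric t x (Fin.cons e y : Fin (n + 1) → ℝ) := by
  filter_upwards [self_mem_nhdsWithin,
    Filter.eventually_all.2 fun j => eventually_ne_nhdsNE_zero (h.neY j),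
    Filter.eventually_all.2 fun i => eventually_ne_nhdsNE_zero (h.neX i),
    Filter.eventually_all.2 fun i => eventually_ne_nhdsNE_zero (div_ne_zero (h.neX i) ht.ne')]
    with e h0 h1 h2 h3
  refine ⟨h.injX, Fin.cons_injective_iff.2 ⟨?_, h.injY⟩, h.neX, ?_, fun i => ?_, fun i => ?_⟩
  · rintro ⟨i, hi⟩
    exact h1 i hi.symm
  · exact Fin.cases h0 h.neY
  · exact Fin.cases (sub_ne_zero.2 (h2 i)) (h.sub_ne i)
  · refine Fin.cases (sub_ne_zero.2 fun hi => h3 i ?_) (h.mul_sub_ne i)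
    rw [eq_div_iff ht.ne', mul_comm]; exact hi

theorem SourceGeneric.continuousAt {k n : ℕ} {t c : ℝ} {x : ℝ → Fin k → ℝ} {y : ℝ → Fin n → ℝ}
    (hx : ∀ i, ContinuousAt (fun e => x e i) 0) (hy : ∀ j, ContinuousAt (fun e => y e j) 0)
    (hx0 : Function.Injective (x 0)) (hy0 : Function.Injective (y 0))
    (h : ∀ i j, y 0 j - x 0 i ≠ 0) :
    ContinuousAt (fun e => sourceLeft t c (x e) (y e)) 0 ∧
      ContinuousAt (fun e => sourceRight t c (x e) (y e)) 0 := by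
  have hf (i j) : ContinuousAt (fun e => (t * y e j - x e i) / (y e j - x e i)) 0 :=
    ((continuousAt_const.mul (hy j)).sub (hx i)).div ((hy j).sub (hx i)) (h i j)
  constructor
  · refine continuousAt_stepSum (x := x) t hx (fun i => ?_) (fun i => ?_) hx0
    · exact continuousAt_const.mul ((continuousAt_const.sub (hx i)).mul
        (tendsto_finsetProd _ fun j _ => hf i j))
    · exact continuousAt_const.add (continuousAt_const.mul (continuousAt_const.mul (hx i)))
  · refine continuousAt_stepSum (x := y) t⁻¹ hy (fun j => ?_) (fun j => ?_) hy0
    · exact continuousAt_const.mul ((continuousAt_const.mul (continuousAt_const.sub (hy j))).mul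
        (tendsto_finsetProd _ fun i _ => hf i j))
    · exact continuousAt_const.add (continuousAt_const.mul (continuousAt_const.mul (hy j)))

theorem sourceLeft_cons_zero {k n : ℕ} {t : ℝ} (ht : 0 < t) (c : ℝ) {x : Fin k → ℝ} {y : Fin n → ℝ}
    (h : SourceGeneric t x y) :
    sourceLeft t (c / t) (Fin.cons 0 x : Fin (k + 1) → ℝ) y =
      (1 + c / t * t ^ n) * sourceLeft t c x y := by
  rw [sourceLeft, stepSum_cons_zero t h.neX, sourceLeft]
  simp only [Fin.cons_zero, Fin.cons_succ, Algebra.algebraMap_self, RingHom.id_apply, mul_zero,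
    add_zero, sub_zero, one_mul]
  have e (j) : t * y j / y j = t := mul_div_cancel_right₀ _ (h.neY j)
  simp only [e, Fin.prod_const]
  congr 2 <;> funext i <;> field_simp
  ring

theorem sourceRight_cons_zero_left {k n : ℕ} {t : ℝ} (ht : 0 < t) (c : ℝ) {x : Fin k → ℝ}
    {y : Fin n → ℝ} (h : SourceGeneric t x y) :
    sourceRight t (c / t) (Fin.cons 0 x : Fin (k + 1) → ℝ) y = sourceRight t c x y := by
  rw [sourceRight, sourceRight]
  have e (j) : t * y j / y j = t := mul_div_cancel_right₀ _ (h.neY j)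
  simp only [Algebra.algebraMap_self, RingHom.id_apply, Fin.prod_univ_succ, Fin.cons_zero,
    Fin.cons_succ, sub_zero, e]
  congr 1 <;> funext i <;> field_simp
  ring

theorem sourceLeft_cons_zero_right {k n : ℕ} (t : ℝ) (c : ℝ) {x : Fin k → ℝ} {y : Fin n → ℝ}
    (h : SourceGeneric t x y) :
    sourceLeft t c x (Fin.cons 0 y : Fin (n + 1) → ℝ) = sourceLeft t c x y := by
  rw [sourceLeft, sourceLeft]
  have e (i) : -x i / -x i = 1 := div_self (neg_ne_zero.2 (h.neX i))
  simp only [Algebra.algebraMap_self, RingHom.id_apply, Fin.prod_univ_succ, Fin.cons_zero,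
    Fin.cons_succ, mul_zero, zero_sub, e, one_mul]

theorem sourceRight_cons_zero {k n : ℕ} {t : ℝ} (ht : 0 < t) (c : ℝ) {x : Fin k → ℝ} {y : Fin n → ℝ}
    (h : SourceGeneric t x y) :
    sourceRight t c x (Fin.cons 0 y : Fin (n + 1) → ℝ) =
      (1 + c * t ^ n) * sourceRight t c x y := by
  rw [sourceRight, stepSum_cons_zero t⁻¹ h.neY, sourceRight]
  have e (i) : -x i / -x i = 1 := div_self (neg_ne_zero.2 (h.neX i))
  simp only [Fin.cons_zero, Fin.cons_succ, Algebra.algebraMap_self, RingHom.id_apply, mul_zero,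
    add_zero, sub_zero, zero_sub, mul_one, e, Finset.prod_const_one]
  congr 2
  · field_simp
    ring
  · funext i; field_simp
    ring

theorem sourceLeft_mul_of_le {t : ℝ} (ht : 0 < t) (d : ℕ) : ∀ {k n : ℕ}, k + d = n →
    ∀ {c : ℝ}, 0 < c → ∀ {x : Fin k → ℝ} {y : Fin n → ℝ}, SourceGeneric t x y →
    (∏ i ∈ Finset.range n, (1 + c * t ^ i)) * sourceLeft t c x y =
      (∏ i ∈ Finset.range k, (1 + c * t ^ i)) * sourceRight t c x y := by
  induction d with
  | zero =>
    rintro k n rfl c hc x y h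
    rw [sourceLeft_eq_sourceRight ht c h.injX h.injY h.sub_ne h.mul_sub_ne]
    rfl
  | succ d ih =>
    intro k n hkn c hc x y h
    have key : ∀ᶠ e in nhdsWithin (0 : ℝ) {0}ᶜ,
        (∏ i ∈ Finset.range n, (1 + c / t * t ^ i)) *
          sourceLeft t (c / t) (Fin.cons e x : Fin (k + 1) → ℝ) y =
        (∏ i ∈ Finset.range (k + 1), (1 + c / t * t ^ i)) *
          sourceRight t (c / t) (Fin.cons e x : Fin (k + 1) → ℝ) y := by
      filter_upwards [h.eventually_cons_left ht] with e he
      exact ih (by omega) (div_pos hc ht) he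
    have hcont := SourceGeneric.continuousAt (t := t) (c := c / t)
      (x := fun e => (Fin.cons e x : Fin (k + 1) → ℝ)) (y := fun _ => y)
      (Fin.cases (by simp only [Fin.cons_zero]; exact continuousAt_id)
        fun i => by simp only [Fin.cons_succ]; exact continuousAt_const)
      (fun _ => continuousAt_const)
      (Fin.cons_injective_iff.2 ⟨by rintro ⟨i, hi⟩; exact h.neX i hi, h.injX⟩) h.injY
      (Fin.cases (by simpa using h.neY) (by simpa using h.sub_ne))
    have e0 := tendsto_nhds_unique_of_eventuallyEq
      ((hcont.1.tendsto.const_mul _).mono_left nhdsWithin_le_nhds)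
      ((hcont.2.tendsto.const_mul _).mono_left nhdsWithin_le_nhds) key
    rw [sourceLeft_cons_zero ht c h, sourceRight_cons_zero_left ht c h, ← mul_assoc,
      ← Finset.prod_range_succ fun i => 1 + c / t * t ^ i, Finset.prod_range_succ',
      Finset.prod_range_succ' _ k] at e0
    have e1 (i : ℕ) : c / t * t ^ (i + 1) = c * t ^ i := by rw [pow_succ]; field_simp
    simp only [e1] at e0
    have h1 : 1 + c / t * t ^ 0 ≠ 0 := by positivity
    refine mul_left_cancel₀ h1 ?_
    linear_combination e0

theorem sourceLeft_mul_of_ge {t : ℝ} (ht : 0 < t) (d : ℕ) : ∀ {k n : ℕ}, n + d = k →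
    ∀ {c : ℝ}, 0 < c → ∀ {x : Fin k → ℝ} {y : Fin n → ℝ}, SourceGeneric t x y →
    (∏ i ∈ Finset.range n, (1 + c * t ^ i)) * sourceLeft t c x y =
      (∏ i ∈ Finset.range k, (1 + c * t ^ i)) * sourceRight t c x y := by
  induction d with
  | zero => exact fun h => sourceLeft_mul_of_le ht 0 h.symm
  | succ d ih =>
    intro k n hkn c hc x y h
    have key : ∀ᶠ e in nhdsWithin (0 : ℝ) {0}ᶜ,
        (∏ i ∈ Finset.range (n + 1), (1 + c * t ^ i)) *
          sourceLeft t c x (Fin.cons e y : Fin (n + 1) → ℝ) =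
        (∏ i ∈ Finset.range k, (1 + c * t ^ i)) *
          sourceRight t c x (Fin.cons e y : Fin (n + 1) → ℝ) := by
      filter_upwards [h.eventually_cons_right ht] with e he
      exact ih (by omega) hc he
    have hcont := SourceGeneric.continuousAt (t := t) (c := c)
      (x := fun _ => x) (y := fun e => (Fin.cons e y : Fin (n + 1) → ℝ))
      (fun _ => continuousAt_const)
      (Fin.cases (by simp only [Fin.cons_zero]; exact continuousAt_id)
        fun i => by simp only [Fin.cons_succ]; exact continuousAt_const)
      h.injX (Fin.cons_injective_iff.2 ⟨by rintro ⟨i, hi⟩; exact h.neY i hi, h.injY⟩)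
      (fun i => Fin.cases (by simpa using h.neX i) (by simpa using h.sub_ne i))
    have e0 := tendsto_nhds_unique_of_eventuallyEq
      ((hcont.1.tendsto.const_mul _).mono_left nhdsWithin_le_nhds)
      ((hcont.2.tendsto.const_mul _).mono_left nhdsWithin_le_nhds) key
    rw [sourceLeft_cons_zero_right t c h, sourceRight_cons_zero ht c h,
      Finset.prod_range_succ] at e0
    have h1 : 1 + c * t ^ n ≠ 0 := by positivity
    refine mul_left_cancel₀ h1 ?_
    linear_combination e0

/-- The source identity relating the two families of coordinates. -/
theorem sourceLeft_mul {k n : ℕ} {R : Type*} [CommRing R] [Algebra ℝ R] {t : ℝ} (ht : 0 < t)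
    (c : R) {x : Fin k → ℝ} {y : Fin n → ℝ} (h : SourceGeneric t x y) :
    (∏ i ∈ Finset.range n, (1 + c * algebraMap ℝ R (t ^ i))) * sourceLeft t c x y =
      (∏ i ∈ Finset.range k, (1 + c * algebraMap ℝ R (t ^ i))) * sourceRight t c x y := by
  have hp : (∏ i ∈ Finset.range n, (1 + X * algebraMap ℝ ℝ[X] (t ^ i))) * sourceLeft t X x y =
      (∏ i ∈ Finset.range k, (1 + X * algebraMap ℝ ℝ[X] (t ^ i))) * sourceRight t X x y := by
    refine eq_of_infinite_eval_eq _ _ ((Set.Ioi_infinite (0 : ℝ)).mono fun c hc => ?_)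
    have hc : 0 < c := hc
    have := (le_total k n).elim
      (fun hkn => sourceLeft_mul_of_le ht (n - k) (by omega) hc h)
      fun hkn => sourceLeft_mul_of_ge ht (k - n) (by omega) hc h
    change (aeval c) _ = (aeval c) _
    simpa only [map_mul, map_prod, map_add, map_one, map_sourceLeft, map_sourceRight, aeval_X,
      AlgHom.commutes, Algebra.algebraMap_self, RingHom.id_apply] using this
  have := congrArg (aeval c) hp
  simpa only [map_mul, map_prod, map_add, map_one, map_sourceLeft, map_sourceRight, aeval_X,
    AlgHom.commutes] using this

/-- The real infinite `q`-Pochhammer symbol. -/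
noncomputable def qProd (q a : ℝ) : ℝ := ∏' i : ℕ, (1 - a * q ^ i)

section qProd

variable {q : ℝ}

theorem summable_norm_mul_pow (hq0 : 0 < q) (hq1 : q < 1) (a : ℝ) :
    Summable fun i : ℕ => ‖-(a * q ^ i)‖ := by
  simp only [norm_neg, norm_mul, norm_pow]
  exact (summable_geometric_of_lt_one (norm_nonneg _)
    (by rwa [Real.norm_of_nonneg hq0.le])).mul_left _

theorem multipliable_qProd (hq0 : 0 < q) (hq1 : q < 1) (a : ℝ) :
    Multipliable fun i : ℕ => 1 - a * q ^ i := by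
  simpa only [sub_eq_add_neg] using
    multipliable_one_add_of_summable (summable_norm_mul_pow hq0 hq1 a)

theorem tendsto_prod_qProd (hq0 : 0 < q) (hq1 : q < 1) (a : ℝ) :
    Filter.Tendsto (fun N => ∏ i ∈ Finset.range N, (1 - a * q ^ i)) Filter.atTop
      (nhds (qProd q a)) :=
  (multipliable_qProd hq0 hq1 a).tendsto_prod_tprod_nat

theorem qProd_ne_zero (hq0 : 0 < q) (hq1 : q < 1) {a : ℝ} (h : ∀ i : ℕ, a * q ^ i ≠ 1) :
    qProd q a ≠ 0 := by
  have := tprod_one_add_ne_zero_of_summable (f := fun i : ℕ => -(a * q ^ i))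
    (fun i h' => h i (by linarith)) (summable_norm_mul_pow hq0 hq1 a)
  simpa only [qProd, sub_eq_add_neg] using this

@[simp]
theorem qProd_zero (q : ℝ) : qProd q 0 = 1 := by simp [qProd]

theorem qProd_eq_mul (hq0 : 0 < q) (hq1 : q < 1) (a : ℝ) :
    qProd q a = (1 - a) * qProd q (q * a) := by
  refine tendsto_nhds_unique ((Filter.tendsto_add_atTop_iff_nat 1).2
    (tendsto_prod_qProd hq0 hq1 a)) (((tendsto_prod_qProd hq0 hq1 (q * a)).const_mul _).congr
      fun N => ?_)
  rw [Finset.prod_range_succ']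
  simp only [pow_zero, mul_one, pow_succ]
  rw [mul_comm]
  congr 1
  exact Finset.prod_congr rfl fun i _ => by ring

theorem qProd_eq_prod_mul (hq0 : 0 < q) (hq1 : q < 1) (a : ℝ) (N : ℕ) :
    qProd q a = (∏ i ∈ Finset.range N, (1 - a * q ^ i)) * qProd q (a * q ^ N) := by
  induction N with
  | zero => simp
  | succ N ih =>
    rw [Finset.prod_range_succ, ih, qProd_eq_mul hq0 hq1 (a * q ^ N)]
    rw [show q * (a * q ^ N) = a * q ^ (N + 1) by ring]
    ring

theorem pow_ne_one_of_abs_lt (hq0 : 0 < q) (hq1 : q < 1) {a : ℝ} (ha : |a| < 1) (i : ℕ) :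
    a * q ^ i ≠ 1 := by
  intro h
  have h1 : |a * q ^ i| < 1 := by
    rw [abs_mul, abs_of_pos (pow_pos hq0 i)]
    exact mul_lt_one_of_nonneg_of_lt_one_left (abs_nonneg a) ha (pow_le_one₀ hq0.le hq1.le)
  rw [h, abs_one] at h1
  exact h1.false

theorem tendsto_mul_pow (hq0 : 0 < q) (hq1 : q < 1) (a : ℝ) :
    Filter.Tendsto (fun N : ℕ => a * q ^ N) Filter.atTop (nhds 0) := by
  simpa using (tendsto_pow_atTop_nhds_zero_of_lt_one hq0.le hq1).const_mul a

theorem tendsto_qProd (hq0 : 0 < q) (hq1 : q < 1) (a : ℝ) :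
    Filter.Tendsto (fun N => qProd q (a * q ^ N)) Filter.atTop (nhds 1) := by
  have key {a : ℝ} (ha : |a| < 1) :
      Filter.Tendsto (fun N => qProd q (a * q ^ N)) Filter.atTop (nhds 1) := by
    have h0 : qProd q a ≠ 0 := qProd_ne_zero hq0 hq1 (pow_ne_one_of_abs_lt hq0 hq1 ha)
    have h1 := (tendsto_const_nhds (x := qProd q a)).div (tendsto_prod_qProd hq0 hq1 a) h0
    rw [div_self h0] at h1
    refine h1.congr fun N => ?_
    have h2 := qProd_eq_prod_mul hq0 hq1 a N
    have h3 : ∏ i ∈ Finset.range N, (1 - a * q ^ i) ≠ 0 := fun h => h0 (by rw [h2, h, zero_mul])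
    simp only [Pi.div_apply]
    rw [div_eq_iff h3, mul_comm]
    exact h2
  obtain ⟨N₀, hN⟩ := ((tendsto_mul_pow hq0 hq1 a).eventually
    (Metric.ball_mem_nhds (0 : ℝ) one_pos)).exists
  rw [← Filter.tendsto_add_atTop_iff_nat N₀]
  refine (key (a := a * q ^ N₀) (by simpa using hN)).congr fun N => ?_
  ring_nf

theorem abs_prod_le_qProd (hq0 : 0 < q) (hq1 : q < 1) {a c : ℝ} (h : |a| ≤ c) (N : ℕ) :
    |∏ i ∈ Finset.range N, (1 - a * q ^ i)| ≤ qProd q (-c) := by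
  have h1 : |∏ i ∈ Finset.range N, (1 - a * q ^ i)| ≤
      ∏ i ∈ Finset.range N, (1 - -c * q ^ i) := by
    rw [Finset.abs_prod]
    refine Finset.prod_le_prod (fun _ _ => abs_nonneg _) fun i _ => ?_
    refine (abs_sub _ _).trans ?_
    rw [abs_one, abs_mul, abs_of_pos (pow_pos hq0 i)]
    nlinarith [pow_pos hq0 i]
  refine h1.trans ?_
  have hc : 0 ≤ c := (abs_nonneg a).trans h
  refine Monotone.ge_of_tendsto (monotone_nat_of_le_succ fun N => ?_)
    (tendsto_prod_qProd hq0 hq1 (-c)) N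
  rw [Finset.prod_range_succ]
  refine le_mul_of_one_le_right (Finset.prod_nonneg fun i _ => ?_) ?_ <;>
  · rw [neg_mul, sub_neg_eq_add]
    have := mul_nonneg hc (pow_pos hq0 ‹_›).le
    linarith

theorem abs_qProd_le (hq0 : 0 < q) (hq1 : q < 1) {a c : ℝ} (h : |a| ≤ c) :
    |qProd q a| ≤ qProd q (-c) :=
  le_of_tendsto (tendsto_prod_qProd hq0 hq1 a).abs
    (Filter.Eventually.of_forall fun N => abs_prod_le_qProd hq0 hq1 h N)

theorem qProd_pos (hq0 : 0 < q) (hq1 : q < 1) {a : ℝ} (ha : 0 ≤ a) (ha1 : a < 1) :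
    0 < qProd q a := by
  have h0 : qProd q a ≠ 0 :=
    qProd_ne_zero hq0 hq1 (pow_ne_one_of_abs_lt hq0 hq1 (by rwa [abs_of_nonneg ha]))
  refine lt_of_le_of_ne (ge_of_tendsto' (tendsto_prod_qProd hq0 hq1 a) fun N => ?_) h0.symm
  refine Finset.prod_nonneg fun i _ => ?_
  have := mul_le_one₀ ha1.le (pow_pos hq0 i).le (pow_le_one₀ hq0.le hq1.le)
  linarith

theorem qProd_anti (hq0 : 0 < q) (hq1 : q < 1) {a c : ℝ} (hac : a ≤ c) (hc : c ≤ 1) :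
    qProd q c ≤ qProd q a := by
  refine le_of_tendsto_of_tendsto' (tendsto_prod_qProd hq0 hq1 c)
    (tendsto_prod_qProd hq0 hq1 a) fun N => Finset.prod_le_prod (fun i _ => ?_) fun i _ => ?_
  · have h1 : q ^ i ≤ 1 := pow_le_one₀ hq0.le hq1.le
    nlinarith [pow_pos hq0 i]
  · nlinarith [pow_pos hq0 i]

/-- A lower bound for `qProd` along a forward orbit of the shift. -/
theorem exists_le_abs_qProd (hq0 : 0 < q) (hq1 : q < 1) {a : ℝ} (h : ∀ i : ℕ, a * q ^ i ≠ 1) :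
    ∃ c, 0 < c ∧ ∀ N : ℕ, c ≤ |qProd q (a * q ^ N)| := by
  have hne (N : ℕ) : qProd q (a * q ^ N) ≠ 0 := by
    refine qProd_ne_zero hq0 hq1 fun i => ?_
    rw [mul_assoc, ← pow_add]
    exact h _
  have h1 : Filter.Tendsto (fun N => |qProd q (a * q ^ N)|⁻¹) Filter.atTop (nhds 1) := by
    simpa using (tendsto_qProd hq0 hq1 a).abs.inv₀ (by simp)
  obtain ⟨C, hC⟩ := h1.bddAbove_range
  have hC' (N : ℕ) : |qProd q (a * q ^ N)|⁻¹ ≤ C := hC ⟨N, rfl⟩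
  have hC0 : 0 < C := (inv_pos.2 (abs_pos.2 (hne 0))).trans_le (hC' 0)
  exact ⟨C⁻¹, inv_pos.2 hC0, fun N => inv_le_of_inv_le₀ (abs_pos.2 (hne N)) (hC' N)⟩

/-- An upper bound for `qProd` along a forward orbit of the shift. -/
theorem exists_abs_qProd_le (hq0 : 0 < q) (hq1 : q < 1) (a : ℝ) :
    ∃ C, 0 < C ∧ ∀ N : ℕ, |qProd q (a * q ^ N)| ≤ C := by
  refine ⟨qProd q (-|a|) + 1, ?_, fun N => ?_⟩
  · have := (abs_nonneg _).trans (abs_qProd_le hq0 hq1 (le_refl |a|))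
    linarith
  · have := abs_qProd_le hq0 hq1 (a := a * q ^ N) (c := |a|) (by
      rw [abs_mul, abs_of_pos (pow_pos hq0 N)]
      exact mul_le_of_le_one_right (abs_nonneg a) (pow_le_one₀ hq0.le hq1.le))
    linarith

/-- The ratio `(z; q)_∞ / (z / t; q)_∞` is bounded along a two-sided orbit of the shift. -/
theorem exists_abs_qProd_div_le (hq0 : 0 < q) (hq1 : q < 1) {t z : ℝ} (ht : 0 < t) (ht1 : t ≤ 1)
    (hz : z ≠ 0) (h : ∀ i : ℤ, z / t * q ^ i ≠ 1) :
    ∃ C, 0 < C ∧ ∀ i : ℤ, |qProd q (z * q ^ i) / qProd q (z / t * q ^ i)| ≤ C := by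
  obtain ⟨c, hc, hc'⟩ := exists_le_abs_qProd hq0 hq1 (a := z / t) fun i => by
    simpa using h i
  obtain ⟨C, hC, hC'⟩ := exists_abs_qProd_le hq0 hq1 z
  have htz : t * z⁻¹ = (z / t)⁻¹ := by field_simp
  obtain ⟨d, hd, hd'⟩ := exists_le_abs_qProd hq0 hq1 (a := q * (t * z⁻¹)) fun i hi => by
    refine h (-(i + 1 : ℕ)) ?_
    rw [htz] at hi
    have hzt : z / t ≠ 0 := div_ne_zero hz ht.ne'
    rw [zpow_neg, zpow_natCast, pow_succ]
    field_simp at hi ⊢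
    linarith
  set P := qProd q (-|q * z⁻¹|)
  have hP : 0 ≤ P := (abs_nonneg _).trans (abs_prod_le_qProd hq0 hq1 (le_refl |q * z⁻¹|) 0)
  obtain ⟨D', hD0, hD''⟩ := exists_abs_qProd_le hq0 hq1 (q * (t * z⁻¹))
  set e := |qProd q (q * (t * z⁻¹))|
  have he : 0 < e := hd.trans_le (by simpa using hd' 0)
  have hneg (M : ℕ) (w : ℝ) (hw : w ≠ 0) : qProd q (w * q ^ (-(M : ℤ))) =
      (-w) ^ M * (∏ i ∈ Finset.range M, (q ^ (i + 1))⁻¹) *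
        (∏ i ∈ Finset.range M, (1 - q * w⁻¹ * q ^ i)) * qProd q w := by
    induction M with
    | zero => simp
    | succ M ih =>
      rw [qProd_eq_mul hq0 hq1, show q * (w * q ^ (-((M + 1 : ℕ) : ℤ))) = w * q ^ (-(M : ℤ)) by
        rw [zpow_neg, zpow_neg, zpow_natCast, zpow_natCast, pow_succ]; field_simp, ih,
        Finset.prod_range_succ, Finset.prod_range_succ, zpow_neg, zpow_natCast]
      have : (1 - w * (q ^ (M + 1))⁻¹) = -w * (q ^ (M + 1))⁻¹ * (1 - q * w⁻¹ * q ^ M) := by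
        field_simp
        ring
      rw [this]
      ring
  refine ⟨C / c + D' / e * P * (C / c) + 1, by positivity, fun i => ?_⟩
  obtain ⟨M, rfl | rfl⟩ := i.eq_nat_or_neg
  · have h1 : |qProd q (z * q ^ (M : ℤ)) / qProd q (z / t * q ^ (M : ℤ))| ≤ C / c := by
      rw [abs_div, zpow_natCast]
      exact div_le_div₀ hC.le (hC' M) hc (hc' M)
    have h2 : 0 ≤ D' / e * P * (C / c) := by positivity
    linarith
  · have hzt : z / t ≠ 0 := div_ne_zero hz ht.ne'
    have h3 := qProd_eq_prod_mul hq0 hq1 (q * (t * z⁻¹)) M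
    have h4 : (∏ i ∈ Finset.range M, (1 - q * (t * z⁻¹) * q ^ i)) ≠ 0 := by
      intro h0
      rw [h0, zero_mul] at h3
      exact he.ne' (abs_eq_zero.2 h3)
    have h5 : qProd q (z * q ^ (-(M : ℤ))) / qProd q (z / t * q ^ (-(M : ℤ))) =
        t ^ M * (∏ i ∈ Finset.range M, (1 - q * z⁻¹ * q ^ i)) /
          (∏ i ∈ Finset.range M, (1 - q * (t * z⁻¹) * q ^ i)) * (qProd q z / qProd q (z / t)) := by
      rw [hneg M z hz, hneg M _ hzt, ← htz]
      have h6 : (-(z / t)) ^ M ≠ 0 := pow_ne_zero _ (neg_ne_zero.2 hzt)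
      have h7 : (∏ i ∈ Finset.range M, (q ^ (i + 1))⁻¹) ≠ 0 :=
        Finset.prod_ne_zero_iff.2 fun i _ => inv_ne_zero (pow_ne_zero _ hq0.ne')
      have h8 : (-z) ^ M = t ^ M * (-(z / t)) ^ M := by
        rw [← mul_pow]; congr 1; field_simp
      rw [h8]
      have h9 : qProd q (z / t) ≠ 0 := by
        have := hc.trans_le (hc' 0)
        simpa using this
      field_simp
    rw [h5]
    have h10 : |qProd q z / qProd q (z / t)| ≤ C / c := by
      rw [abs_div]
      exact div_le_div₀ hC.le (by simpa using hC' 0) hc (by simpa using hc' 0)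
    have h11 : |t ^ M * (∏ i ∈ Finset.range M, (1 - q * z⁻¹ * q ^ i)) /
          (∏ i ∈ Finset.range M, (1 - q * (t * z⁻¹) * q ^ i))| ≤ D' / e * P := by
      have h12 : e / D' ≤ |∏ i ∈ Finset.range M, (1 - q * (t * z⁻¹) * q ^ i)| := by
        rw [div_le_iff₀ hD0]
        have := congrArg abs h3
        rw [abs_mul] at this
        exact this.le.trans (mul_le_mul_of_nonneg_left (hD'' M) (abs_nonneg _))
      rw [abs_div, abs_mul, abs_of_pos (pow_pos ht M), div_le_iff₀ (abs_pos.2 h4)]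
      have h13 : t ^ M * |∏ i ∈ Finset.range M, (1 - q * z⁻¹ * q ^ i)| ≤ 1 * P :=
        mul_le_mul (pow_le_one₀ ht.le ht1) (abs_prod_le_qProd hq0 hq1 le_rfl M) (abs_nonneg _)
          zero_le_one
      have h14 : D' / e * P * (e / D') = P := by field_simp
      have := mul_le_mul_of_nonneg_left h12 (show 0 ≤ D' / e * P by positivity)
      linarith
    rw [abs_mul]
    have := mul_le_mul h11 h10 (abs_nonneg _) (by positivity)
    have h2 : 0 ≤ C / c := by positivity
    linarith

end qProd

/-- The contribution of a pair of lattice points with ratio `z` to `latDelta`. -/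
noncomputable def pairDelta (q t z : ℝ) : ℝ := (1 - z) * qProd q (q * z / t) / qProd q (t * z)

open Classical in

/-- The `q`-analogue of the `2γ`-th power of the Vandermonde product, at a lattice point. -/
noncomputable def latDelta {n : ℕ} (q t : ℝ) (ν : Fin n → ℕ) : ℝ :=
  if Antitone ν then
    ∏ p ∈ ltPairs n, t ^ (2 * ν p.2) * pairDelta q t (lat q t ν p.1 / lat q t ν p.2)
  else 0

section latDelta

variable {n : ℕ} {q t : ℝ} {ν : Fin n → ℕ}

theorem latDelta_of_not_antitone (h : ¬ Antitone ν) : latDelta q t ν = 0 := if_neg h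

theorem latDelta_of_antitone (h : Antitone ν) : latDelta q t ν =
    ∏ p ∈ ltPairs n, t ^ (2 * ν p.2) * pairDelta q t (lat q t ν p.1 / lat q t ν p.2) := if_pos h

theorem latDelta_add_inc (hq0 : 0 < q) (hq1 : q < 1) (ht : 0 < t) (ht1 : t < 1)
    (hν : Antitone ν) (J : Finset (Fin n)) :
    latDelta q t ν * vdmRatio t (lat q t ν) J =
      latDelta q t (ν + inc J) * vdmRatio t⁻¹ (lat q t (ν + inc J)) J := by
  by_cases h : Antitone (ν + inc J)
  swap
  · rw [vdmRatio_lat_eq_zero q t hν h, latDelta_of_not_antitone h, mul_zero, zero_mul]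
  rw [latDelta_of_antitone hν, latDelta_of_antitone h, vdmRatio, vdmRatio,
    ← Finset.prod_mul_distrib, ← Finset.prod_mul_distrib]
  refine Finset.prod_congr rfl fun p hp => ?_
  obtain ⟨i, j⟩ := p
  have hij : i < j := (Finset.mem_filter.1 hp).2
  have h1 := lat_le_of_lt hq0 hq1 ht ht1 hν hij
  have h2 := lat_le_of_lt hq0 hq1 ht ht1 h hij
  have h3 := lat_pos hq0 ht ν i
  have h4 := lat_pos hq0 ht ν j
  have h5 := lat_pos hq0 ht (ν + inc J) i
  have h6 := lat_pos hq0 ht (ν + inc J) j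
  rw [← scaleOn_lat] at h2 h5 h6 ⊢
  simp only [Pi.add_apply]
  set a := lat q t ν i with ha
  set b := lat q t ν j with hb
  have hne {z : ℝ} (hz : 0 < z) (hzt : z ≤ t) : qProd q (t * z) ≠ 0 :=
    (qProd_pos hq0 hq1 (by positivity) (by nlinarith)).ne'
  have hz1 : a / b ≤ t := (div_le_iff₀ h4).2 h1
  have hz0 : 0 < a / b := div_pos h3 h4
  by_cases hi : i ∈ J <;> by_cases hj : j ∈ J <;>
    simp only [scaleOn, hi, hj, if_true, if_false, inc, ← ha, ← hb] at h2 h5 h6 ⊢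
  · rw [mul_div_mul_left _ _ hq0.ne', ← mul_sub, ← mul_sub, ← mul_sub]
    have : b - a ≠ 0 := by nlinarith
    rw [mul_div_assoc, mul_div_assoc, mul_div_mul_left _ _ hq0.ne', div_self this]
    field_simp
    ring
  · have e1 : b - a ≠ 0 := by nlinarith
    have e2 : b - q * a ≠ 0 := by nlinarith
    rw [pairDelta, pairDelta]
    set z := a / b with hz
    have ez : q * a / b = q * z := by rw [hz]; ring
    have ea : a = z * b := by rw [hz]; field_simp
    rw [ez, ea] at *
    have f1 := hne hz0 hz1
    have f2 : qProd q (t * (q * z)) ≠ 0 := hne (mul_pos hq0 hz0) (by nlinarith)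
    have f3 : 1 - z ≠ 0 := by nlinarith
    have f4 : 1 - q * z ≠ 0 := by nlinarith
    have g1 := qProd_eq_mul hq0 hq1 (q * z / t)
    have g2 := qProd_eq_mul hq0 hq1 (t * z)
    rw [show q * (t * z) = t * (q * z) by ring] at g2
    rw [show q * (q * z / t) = q * (q * z) / t by ring] at g1
    have f5 : 1 - t * z ≠ 0 := fun h => f1 (by rw [g2, h, zero_mul])
    have r1 : (b - t * (z * b)) / (b - z * b) = (1 - t * z) / (1 - z) := by
      rw [show b - t * (z * b) = b * (1 - t * z) by ring, show b - z * b = b * (1 - z) by ring,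
        mul_div_mul_left _ _ h4.ne']
    have r2 : (b - t⁻¹ * (q * (z * b))) / (b - q * (z * b)) = (1 - q * z / t) / (1 - q * z) := by
      rw [show b - t⁻¹ * (q * (z * b)) = b * (1 - q * z / t) by ring,
        show b - q * (z * b) = b * (1 - q * z) by ring, mul_div_mul_left _ _ h4.ne']
    rw [r1, r2, g1, g2, add_zero]
    generalize 1 - q * z / t = A
    generalize qProd q (q * (q * z) / t) = B
    generalize qProd q (t * (q * z)) = D at f2 ⊢
    generalize 1 - t * z = E at f5 ⊢
    generalize 1 - q * z = F at f4 ⊢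
    field_simp
  · have e1 : b - a ≠ 0 := by nlinarith
    have e2 : q * b - a ≠ 0 := by nlinarith
    rw [pairDelta, pairDelta]
    set z := a / (q * b) with hz
    have hz' : 0 < z := by positivity
    have hzt : z ≤ t := (div_le_iff₀ (by positivity)).2 h2
    have ez : a / b = q * z := by rw [hz]; field_simp
    have ea : a = z * (q * b) := by rw [hz]; field_simp
    rw [ez] at hz0 hz1
    rw [ez, ea]
    rw [ea] at e1 e2
    have f1 : qProd q (t * z) ≠ 0 := hne hz' hzt
    have f2 : qProd q (t * (q * z)) ≠ 0 := hne hz0 hz1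
    have f3 : 1 - z ≠ 0 := by nlinarith
    have f4 : 1 - q * z ≠ 0 := by nlinarith
    have g1 := qProd_eq_mul hq0 hq1 (q * z / t)
    have g2 := qProd_eq_mul hq0 hq1 (t * z)
    rw [show q * (t * z) = t * (q * z) by ring] at g2
    have f5 : 1 - t * z ≠ 0 := fun h => f1 (by rw [g2, h, zero_mul])
    have r1 : (t * b - z * (q * b)) / (b - z * (q * b)) = (t - q * z) / (1 - q * z) := by
      rw [show t * b - z * (q * b) = b * (t - q * z) by ring,
        show b - z * (q * b) = b * (1 - q * z) by ring, mul_div_mul_left _ _ h4.ne']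
    have r2 : (t⁻¹ * (q * b) - z * (q * b)) / (q * b - z * (q * b)) = (t⁻¹ - z) / (1 - z) := by
      rw [show t⁻¹ * (q * b) - z * (q * b) = (q * b) * (t⁻¹ - z) by ring,
        show q * b - z * (q * b) = (q * b) * (1 - z) by ring, mul_div_mul_left _ _ h6.ne']
    have r3 : t⁻¹ - z = (1 - t * z) / t := by field_simp
    rw [show q * (q * z) / t = q * (q * z / t) by ring, r1, r2, r3, g1, g2]
    have r4 : 1 - q * z / t = (t - q * z) / t := by field_simp
    rw [r4]
    generalize qProd q (q * (q * z / t)) = B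
    generalize qProd q (t * (q * z)) = D at f2 ⊢
    generalize t - q * z = E
    generalize 1 - t * z = F at f5 ⊢
    generalize 1 - q * z = G at f4 ⊢
    field_simp
    ring
  · rw [add_zero]

theorem vdmRatio_inv_lat_eq_zero (ht : t ≠ 0) {i j : Fin n}
    (hij : (j : ℕ) = i + 1) (h : ν i = ν j) {J : Finset (Fin n)} (hi : i ∈ J) (hj : j ∉ J) :
    vdmRatio t⁻¹ (lat q t ν) J = 0 := by
  refine Finset.prod_eq_zero (i := (i, j)) ?_ ?_
  · simp only [ltPairs, Finset.mem_filter, Finset.mem_univ, true_and]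
    exact Fin.lt_def.2 (by omega)
  · have : (i.rev : ℕ) = j.rev + 1 := by
      rw [Fin.val_rev, Fin.val_rev]; omega
    simp only [scaleOn, hi, hj, if_true, if_false, lat, h, this]
    field_simp
    ring

theorem latDelta_sub_inc (hq0 : 0 < q) (hq1 : q < 1) (ht : 0 < t) (ht1 : t < 1)
    {J : Finset (Fin n)} (hJ : inc J ≤ ν) :
    latDelta q t (ν - inc J) * vdmRatio t (lat q t (ν - inc J)) J =
      latDelta q t ν * vdmRatio t⁻¹ (lat q t ν) J := by
  by_cases h : Antitone (ν - inc J)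
  · rw [latDelta_add_inc hq0 hq1 ht ht1 h, tsub_add_cancel_of_le hJ]
  rw [latDelta_of_not_antitone h, zero_mul]
  by_cases hν : Antitone ν
  swap
  · rw [latDelta_of_not_antitone hν, zero_mul]
  have : ∃ i j : Fin n, (j : ℕ) = i + 1 ∧ ν i = ν j ∧ i ∈ J ∧ j ∉ J := by
    obtain _ | n := n
    · exact absurd (fun i => i.elim0) h
    by_contra hc
    refine h (Fin.antitone_iff_succ_le.2 fun i => ?_)
    have h1 := hν (Fin.castSucc_le_succ i)
    push Not at hc
    have h2 := hc i.castSucc i.succ (by simp)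
    have h5 := hJ i.castSucc
    have h6 := hJ i.succ
    simp only [Pi.sub_apply, inc] at h5 h6 ⊢
    by_cases h3 : i.castSucc ∈ J <;> by_cases h4 : i.succ ∈ J <;> simp only [h3, h4, if_true,
      if_false] at h5 h6 ⊢ <;> grind
  obtain ⟨i, j, hij, h1, hi, hj⟩ := this
  rw [vdmRatio_inv_lat_eq_zero ht.ne' hij h1 hi hj, mul_zero]

theorem latDelta_mul_vdmRatio_inv_eq_zero (ht : t ≠ 0)
    {J : Finset (Fin n)} (hJ : ¬ inc J ≤ ν) :
    latDelta q t ν * vdmRatio t⁻¹ (lat q t ν) J * ∏ j ∈ J, (1 - lat q t ν j) = 0 := by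
  by_cases hν : Antitone ν
  swap
  · rw [latDelta_of_not_antitone hν, zero_mul, zero_mul]
  obtain ⟨j, hj⟩ := not_forall.1 hJ
  have hjJ : j ∈ J := by
    by_contra h
    simp [inc, h] at hj
  have hj0 : ν j = 0 := by
    simp only [inc, hjJ, if_true] at hj
    omega
  set m := J.max' ⟨j, hjJ⟩ with hm
  have hmJ : m ∈ J := J.max'_mem _
  have hm0 : ν m = 0 := Nat.le_zero.1 (hj0 ▸ hν (J.le_max' j hjJ))
  by_cases hlast : (m : ℕ) + 1 < n
  · have h1 : (⟨m + 1, hlast⟩ : Fin n) ∉ J := fun h => by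
      have := J.le_max' _ h
      rw [← hm, Fin.le_def] at this
      simp at this
    have h2 : ν ⟨m + 1, hlast⟩ = 0 :=
      Nat.le_zero.1 (hm0 ▸ hν (show m ≤ ⟨m + 1, hlast⟩ from Fin.le_def.2 (Nat.le_succ _)))
    rw [vdmRatio_inv_lat_eq_zero ht (i := m) (j := ⟨m + 1, hlast⟩) rfl (by rw [hm0, h2]) hmJ h1,
      mul_zero, zero_mul]
  · rw [Finset.prod_eq_zero hmJ, mul_zero]
    have : (m.rev : ℕ) = 0 := by rw [Fin.val_rev]; omega
    rw [lat, hm0, this, pow_zero, pow_zero, mul_one, sub_self]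

theorem exists_latDelta_le (hq0 : 0 < q) (hq1 : q < 1) (ht : 0 < t) (ht1 : t < 1) (n : ℕ) :
    ∃ C, 0 < C ∧ ∀ ν : Fin n → ℕ, |latDelta q t ν| ≤ C := by
  have h1 : 0 < qProd q (-q) := lt_of_lt_of_le one_pos (by
    simpa using qProd_anti hq0 hq1 (show -q ≤ 0 by linarith) zero_le_one)
  have h2 : 0 < qProd q t := qProd_pos hq0 hq1 ht.le ht1
  refine ⟨∏ p ∈ ltPairs n, (qProd q (-q) / qProd q t), Finset.prod_pos fun _ _ => div_pos h1 h2,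
    fun ν => ?_⟩
  by_cases hν : Antitone ν
  swap
  · rw [latDelta_of_not_antitone hν, abs_zero]
    exact Finset.prod_nonneg fun _ _ => (div_pos h1 h2).le
  rw [latDelta_of_antitone hν, Finset.abs_prod]
  refine Finset.prod_le_prod (fun _ _ => abs_nonneg _) fun p hp => ?_
  have h3 := lat_pos hq0 ht ν p.1
  have h4 := lat_pos hq0 ht ν p.2
  have hz1 := (div_le_iff₀ h4).2 (lat_le_of_lt hq0 hq1 ht ht1 hν (Finset.mem_filter.1 hp).2)
  have hz0 := div_pos h3 h4
  set z := lat q t ν p.1 / lat q t ν p.2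
  have h5 : |qProd q (q * z / t)| ≤ qProd q (-q) := by
    refine abs_qProd_le hq0 hq1 ?_
    rw [abs_of_nonneg (by positivity), div_le_iff₀ ht]
    exact mul_le_mul_of_nonneg_left hz1 hq0.le
  have h6 : qProd q t ≤ |qProd q (t * z)| :=
    (qProd_anti hq0 hq1 (by nlinarith) ht1.le).trans (le_abs_self _)
  rw [abs_mul, abs_of_pos (pow_pos ht _), pairDelta, abs_div, abs_mul]
  have h7 : |1 - z| ≤ 1 := by rw [abs_le]; constructor <;> linarith
  calc t ^ (2 * ν p.2) * (|1 - z| * |qProd q (q * z / t)| / |qProd q (t * z)|)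
      ≤ 1 * (1 * qProd q (-q) / qProd q t) := by
        gcongr
        exact pow_le_one₀ ht.le ht1.le
    _ = _ := by ring

end latDelta

/-- The product `∏ j, (b * t ^ (n - 1 - j); q)_{ν j}`. -/
noncomputable def finPoch {n : ℕ} {R : Type*} [CommRing R] [Algebra ℝ R] (q t : ℝ) (b : R)
    (ν : Fin n → ℕ) : R :=
  ∏ j : Fin n, ∏ m ∈ Finset.range (ν j), (1 - b * algebraMap ℝ R (t ^ (j.rev : ℕ) * q ^ m))

/-- The weight of the `q`-Selberg density with exponential parameter `B`. -/
noncomputable def baseWeight {n : ℕ} (q t B : ℝ) (ν : Fin n → ℕ) : ℝ :=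
  latDelta q t ν * B ^ (∑ j, ν j) * ∏ j, qProd q (q * lat q t ν j)

/-- The Kadell-type density, with a parameter `b` in an `ℝ`-algebra. -/
noncomputable def baseSol {n : ℕ} {R : Type*} [CommRing R] [Algebra ℝ R] (q t B : ℝ) (b : R)
    (ν : Fin n → ℕ) : R :=
  algebraMap ℝ R (baseWeight q t B ν) * finPoch q t b ν

section baseSol

variable {n : ℕ} {R : Type*} [CommRing R] [Algebra ℝ R] {q t B : ℝ}

theorem map_finPoch {S : Type*} [CommRing S] [Algebra ℝ S] (f : R →ₐ[ℝ] S) (q t : ℝ) (b : R)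
    (ν : Fin n → ℕ) : f (finPoch q t b ν) = finPoch q t (f b) ν := by
  simp only [finPoch, map_prod, map_sub, map_one, map_mul, AlgHom.commutes]

theorem map_baseSol {S : Type*} [CommRing S] [Algebra ℝ S] (f : R →ₐ[ℝ] S) (q t B : ℝ) (b : R)
    (ν : Fin n → ℕ) : f (baseSol q t B b ν) = baseSol q t B (f b) ν := by
  rw [baseSol, map_mul, map_finPoch, AlgHom.commutes, baseSol]

theorem prod_sub_inc_pow_sum {M : Type*} [CommMonoid M] (B : M) {ν : Fin n → ℕ} {J : Finset (Fin n)} (hJ : inc J ≤ ν) :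
    B ^ (∑ j, ν j) = B ^ (∑ j, (ν - inc J) j) * ∏ _j ∈ J, B := by
  have h1 : ∑ j, ν j = ∑ j, (ν - inc J) j + J.card := by
    have h2 : J.card = ∑ j, inc J j := by simp [inc]
    rw [h2, ← Finset.sum_add_distrib]
    refine Finset.sum_congr rfl fun j _ => ?_
    rw [Pi.sub_apply, tsub_add_cancel_of_le (hJ j)]
  rw [h1, pow_add, Finset.prod_const]

theorem lat_sub_inc_of_mem {ν : Fin n → ℕ} {J : Finset (Fin n)} (hJ : inc J ≤ ν) {j : Fin n}
    (hj : j ∈ J) : lat q t ν j = q * lat q t (ν - inc J) j := by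
  have := congrFun (scaleOn_lat q t (ν - inc J) J) j
  rw [tsub_add_cancel_of_le hJ] at this
  rw [← this, scaleOn, if_pos hj]

theorem lat_sub_inc_of_notMem {ν : Fin n → ℕ} {J : Finset (Fin n)} {j : Fin n}
    (hj : j ∉ J) : lat q t (ν - inc J) j = lat q t ν j := by
  simp [lat, inc, hj]

theorem prod_qProd_sub_inc (hq0 : 0 < q) (hq1 : q < 1) {ν : Fin n → ℕ} {J : Finset (Fin n)}
    (hJ : inc J ≤ ν) :
    ∏ j, qProd q (q * lat q t (ν - inc J) j) =
      (∏ j ∈ J, (1 - lat q t ν j)) * ∏ j, qProd q (q * lat q t ν j) := by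
  rw [← Fintype.prod_ite_mem J, ← Finset.prod_mul_distrib]
  refine Finset.prod_congr rfl fun j _ => ?_
  split_ifs with hj
  · rw [← lat_sub_inc_of_mem hJ hj, qProd_eq_mul hq0 hq1]
  · rw [lat_sub_inc_of_notMem hj, one_mul]

theorem baseWeight_sub_inc (hq0 : 0 < q) (hq1 : q < 1) (ht : 0 < t) (ht1 : t < 1)
    {ν : Fin n → ℕ} {J : Finset (Fin n)} (hJ : inc J ≤ ν) :
    baseWeight q t B (ν - inc J) * vdmRatio t (lat q t (ν - inc J)) J * ∏ _j ∈ J, B =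
      baseWeight q t B ν * vdmRatio t⁻¹ (lat q t ν) J * ∏ j ∈ J, (1 - lat q t ν j) := by
  have h1 := latDelta_sub_inc hq0 hq1 ht ht1 hJ
  rw [baseWeight, baseWeight, prod_qProd_sub_inc hq0 hq1 hJ, prod_sub_inc_pow_sum B hJ]
  linear_combination (B ^ (∑ j, (ν - inc J) j) * (∏ _j ∈ J, B) * (∏ j ∈ J, (1 - lat q t ν j)) *
    ∏ j, qProd q (q * lat q t ν j)) * h1

theorem finPoch_sub_inc (q t : ℝ) (b : R) {ν : Fin n → ℕ} {J : Finset (Fin n)} (hJ : inc J ≤ ν) :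
    (∏ j : Fin n, (1 - b * algebraMap ℝ R (t ^ (j.rev : ℕ)))) *
      finPoch q t (algebraMap ℝ R q * b) (ν - inc J) =
      finPoch q t b ν * ∏ j ∈ Jᶜ, (1 - b * algebraMap ℝ R (lat q t ν j)) := by
  rw [finPoch, finPoch, ← Fintype.prod_ite_mem Jᶜ, ← Finset.prod_mul_distrib,
    ← Finset.prod_mul_distrib]
  refine Finset.prod_congr rfl fun j _ => ?_
  have h1 (m : ℕ) : (1 - b * algebraMap ℝ R (t ^ (j.rev : ℕ))) *
      ∏ m ∈ Finset.range m, (1 - algebraMap ℝ R q * b * algebraMap ℝ R (t ^ (j.rev : ℕ) * q ^ m)) =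
      ∏ m ∈ Finset.range (m + 1), (1 - b * algebraMap ℝ R (t ^ (j.rev : ℕ) * q ^ m)) := by
    rw [Finset.prod_range_succ', pow_zero, mul_one, mul_comm]
    congr 1
    refine Finset.prod_congr rfl fun i _ => ?_
    simp only [pow_succ, map_mul]
    ring
  rw [h1]
  by_cases hj : j ∈ J
  · have h2 : (ν - inc J) j + 1 = ν j := by
      have h3 := hJ j
      simp only [inc, hj, if_true, Pi.sub_apply] at h3 ⊢
      omega
    rw [h2, if_neg (by simpa using hj), mul_one]
  · have h2 : (ν - inc J) j = ν j := by simp [inc, hj]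
    rw [h2, if_pos (by simpa using hj), Finset.prod_range_succ, lat, mul_comm (q ^ ν j)]

theorem sum_vdmRatio_inv_base (ht : 0 < t) {y : Fin n → ℝ} (hy : Function.Injective y) (b : R) :
    ∑ J : Finset (Fin n), algebraMap ℝ R (vdmRatio t⁻¹ y J) *
      ((∏ j ∈ J, -(b * algebraMap ℝ R (t ^ (n - 1) * (1 - y j)))) *
        ∏ j ∈ Jᶜ, (1 - b * algebraMap ℝ R (y j))) =
      ∏ j : Fin n, (1 - b * algebraMap ℝ R (t ^ (j.rev : ℕ))) := by
  have h := sum_vdmRatio_linear_top (R := R) t⁻¹ hy (-(b * algebraMap ℝ R (t ^ (n - 1))))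
    (b * algebraMap ℝ R (t ^ (n - 1))) 1 (-b) (fun j hj => by
      rw [show b * algebraMap ℝ R (t ^ (n - 1)) = algebraMap ℝ R (t ^ (n - 1)) * b by ring,
        ← mul_assoc, ← map_mul, show n - 1 = j by omega, ← mul_pow, inv_mul_cancel₀ ht.ne',
        one_pow, map_one, one_mul, neg_add_cancel])
  rw [← Fin.prod_univ_eq_prod_range (fun i => 1 + algebraMap ℝ R (t⁻¹ ^ i) *
    -(b * algebraMap ℝ R (t ^ (n - 1)))) n] at h
  refine Eq.trans (Finset.sum_congr rfl fun J _ => ?_) (h.trans (Finset.prod_congr rfl fun j _ => ?_))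
  · congr 2 <;> refine Finset.prod_congr rfl fun j _ => ?_
    · rw [map_mul, map_sub, map_one]
      ring
    · ring
  · have h1 : t ^ (j.rev : ℕ) = t⁻¹ ^ (j : ℕ) * t ^ (n - 1) := by
      rw [Fin.val_rev, show n - 1 = (n - (j + 1)) + j by omega, pow_add, inv_pow]
      field_simp
    rw [h1, map_mul]
    ring

theorem lat_injective (hq0 : 0 < q) (hq1 : q < 1) (ht : 0 < t) (ht1 : t < 1) {ν : Fin n → ℕ}
    (hν : Antitone ν) : Function.Injective (lat q t ν) := by
  refine StrictMono.injective fun i j hij => ?_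
  have := lat_sub_pos hq0 hq1 ht ht1 hν hij
  linarith

open Classical in

theorem prod_mul_sum_step_base (hq0 : 0 < q) (hq1 : q < 1) (ht : 0 < t) (ht1 : t < 1) (b : R)
    (ν : Fin n → ℕ) :
    (∏ j : Fin n, (1 - b * algebraMap ℝ R (t ^ (j.rev : ℕ)))) *
      (∑ J : Finset (Fin n), if inc J ≤ ν then
        stepWeight t (b * algebraMap ℝ R (B * t ^ (n - 1))) 0 0 (lat q t (ν - inc J)) J *
          baseSol q t B (algebraMap ℝ R q * b) (ν - inc J) else 0) =
      (∏ j : Fin n, (1 - b * algebraMap ℝ R (t ^ (j.rev : ℕ)))) * baseSol q t B b ν := by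
  have key : ∀ J : Finset (Fin n), (∏ j : Fin n, (1 - b * algebraMap ℝ R (t ^ (j.rev : ℕ)))) *
      (if inc J ≤ ν then
        stepWeight t (b * algebraMap ℝ R (B * t ^ (n - 1))) 0 0 (lat q t (ν - inc J)) J *
          baseSol q t B (algebraMap ℝ R q * b) (ν - inc J) else 0) =
      baseSol q t B b ν * (algebraMap ℝ R (vdmRatio t⁻¹ (lat q t ν) J) *
      ((∏ j ∈ J, -(b * algebraMap ℝ R (t ^ (n - 1) * (1 - lat q t ν j)))) *
        ∏ j ∈ Jᶜ, (1 - b * algebraMap ℝ R (lat q t ν j)))) := by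
    intro J
    have e1 : (∏ j ∈ J, -(b * algebraMap ℝ R (t ^ (n - 1) * (1 - lat q t ν j)))) =
        (∏ j ∈ J, -(b * algebraMap ℝ R (t ^ (n - 1)))) *
          algebraMap ℝ R (∏ j ∈ J, (1 - lat q t ν j)) := by
      rw [map_prod, ← Finset.prod_mul_distrib]
      refine Finset.prod_congr rfl fun j _ => ?_
      rw [map_mul]
      ring
    split_ifs with hJ
    · have h1 := congrArg (algebraMap ℝ R) (baseWeight_sub_inc (B := B) hq0 hq1 ht ht1 hJ)
      have h2 := finPoch_sub_inc q t b hJ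
      simp only [map_mul] at h1
      have e2 : (∏ j ∈ J, -(b * algebraMap ℝ R (B * t ^ (n - 1)))) =
          (∏ j ∈ J, -(b * algebraMap ℝ R (t ^ (n - 1)))) * algebraMap ℝ R (∏ _j ∈ J, B) := by
        rw [map_prod, ← Finset.prod_mul_distrib]
        refine Finset.prod_congr rfl fun j _ => ?_
        rw [map_mul]
        ring
      simp only [stepWeight, zero_mul, sub_zero, mul_one, Finset.prod_const_one, baseSol]
      rw [e2, e1]
      linear_combination (algebraMap ℝ R (vdmRatio t (lat q t (ν - inc J)) J) *
        (∏ j ∈ J, -(b * algebraMap ℝ R (t ^ (n - 1)))) * algebraMap ℝ R (∏ _j ∈ J, B) *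
        algebraMap ℝ R (baseWeight q t B (ν - inc J))) * h2 +
        (∏ j ∈ J, -(b * algebraMap ℝ R (t ^ (n - 1)))) * finPoch q t b ν *
        (∏ j ∈ Jᶜ, (1 - b * algebraMap ℝ R (lat q t ν j))) * h1
    · have h1 := congrArg (algebraMap ℝ R)
        (latDelta_mul_vdmRatio_inv_eq_zero (q := q) ht.ne' hJ)
      simp only [map_mul, map_zero] at h1
      rw [e1, mul_zero, baseSol, baseWeight]
      simp only [map_mul]
      linear_combination (-(∏ j ∈ J, -(b * algebraMap ℝ R (t ^ (n - 1)))) * finPoch q t b ν *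
        (∏ j ∈ Jᶜ, (1 - b * algebraMap ℝ R (lat q t ν j))) * algebraMap ℝ R (B ^ (∑ j, ν j)) *
        algebraMap ℝ R (∏ j, qProd q (q * lat q t ν j))) * h1
  rw [Finset.mul_sum, Finset.sum_congr rfl fun J _ => key J, ← Finset.mul_sum]
  by_cases hν : Antitone ν
  · rw [sum_vdmRatio_inv_base ht (lat_injective hq0 hq1 ht ht1 hν), mul_comm]
  · simp [baseSol, baseWeight, latDelta_of_not_antitone hν]

open Classical in

/-- The Kadell-type densities with parameters `q * b` and `b` are related by a step operator. -/
theorem sum_step_base (hq0 : 0 < q) (hq1 : q < 1) (ht : 0 < t) (ht1 : t < 1) (b : R)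
    (ν : Fin n → ℕ) :
    (∑ J : Finset (Fin n), if inc J ≤ ν then
        stepWeight t (b * algebraMap ℝ R (B * t ^ (n - 1))) 0 0 (lat q t (ν - inc J)) J *
          baseSol q t B (algebraMap ℝ R q * b) (ν - inc J) else 0) = baseSol q t B b ν := by
  have h1 := prod_mul_sum_step_base (R := ℝ[X]) (B := B) hq0 hq1 ht ht1 X ν
  have h2 := congrArg (aeval b) (mul_left_cancel₀ (Finset.prod_ne_zero_iff.2 fun j _ h0 => by
    have := congrArg (eval 0) h0
    simp at this) h1)
  rw [map_baseSol, map_sum, aeval_X] at h2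
  rw [← h2]
  refine Finset.sum_congr rfl fun J _ => ?_
  split_ifs
  · rw [map_mul (aeval b), map_baseSol, map_stepWeight]
    simp only [map_mul, aeval_X, AlgHom.commutes, map_zero]
  · rw [map_zero]

end baseSol

/-- All coefficients of the family `L` are summable. -/
def CoeffSummable {ι : Type*} (L : ι → PowerSeries ℝ) : Prop :=
  ∀ m, Summable fun i => PowerSeries.coeff m (L i)

/-- The coefficientwise sum of a family of power series. -/
noncomputable def coeffSum {ι : Type*} (L : ι → PowerSeries ℝ) : PowerSeries ℝ :=
  PowerSeries.mk fun m => ∑' i, PowerSeries.coeff m (L i)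

section coeffSum

variable {ι κ : Type*} {L : ι → PowerSeries ℝ}

theorem coeffSum_rescale (q : ℝ) (L : ι → PowerSeries ℝ) :
    coeffSum (fun i => PowerSeries.rescale q (L i)) = PowerSeries.rescale q (coeffSum L) := by
  ext m
  simp only [coeffSum, PowerSeries.coeff_mk, PowerSeries.coeff_rescale, tsum_mul_left]

theorem CoeffSummable.mul (hL : CoeffSummable L) (g : PowerSeries ℝ) :
    CoeffSummable fun i => g * L i := fun m => by
  simp only [PowerSeries.coeff_mul]
  exact summable_sum fun p _ => (hL p.2).mul_left _

theorem CoeffSummable.coeffSum_mul (hL : CoeffSummable L) (g : PowerSeries ℝ) :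
    coeffSum (fun i => g * L i) = g * coeffSum L := by
  ext m
  simp only [coeffSum, PowerSeries.coeff_mk, PowerSeries.coeff_mul]
  refine (Summable.tsum_finsetSum (f := fun (p : ℕ × ℕ) i => PowerSeries.coeff p.1 g *
    PowerSeries.coeff p.2 (L i)) fun p _ => (hL p.2).mul_left _).trans ?_
  exact Finset.sum_congr rfl fun p _ => tsum_mul_left

theorem CoeffSummable.sum {s : Finset κ} {L : κ → ι → PowerSeries ℝ}
    (hL : ∀ k ∈ s, CoeffSummable (L k)) : CoeffSummable fun i => ∑ k ∈ s, L k i := fun m => by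
  simp only [map_sum]
  exact summable_sum fun k hk => hL k hk m

theorem coeffSum_sum {s : Finset κ} {L : κ → ι → PowerSeries ℝ}
    (hL : ∀ k ∈ s, CoeffSummable (L k)) :
    coeffSum (fun i => ∑ k ∈ s, L k i) = ∑ k ∈ s, coeffSum (L k) := by
  ext m
  simp only [coeffSum, PowerSeries.coeff_mk, map_sum]
  exact Summable.tsum_finsetSum fun k hk => hL k hk m

theorem CoeffSummable.smul_of_bdd (hL : CoeffSummable L) {c : ι → ℝ} {M : ℝ}
    (hc : ∀ i, PowerSeries.C (c i) * L i = 0 ∨ |c i| ≤ M) :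
    CoeffSummable fun i => PowerSeries.C (c i) * L i := fun m => by
  refine Summable.of_norm_bounded ((hL m).norm.mul_left |M|) fun i => ?_
  simp only
  rcases hc i with h | h
  · rw [h, map_zero, norm_zero]; positivity
  · rw [PowerSeries.coeff_C_mul, norm_mul, Real.norm_eq_abs]
    exact mul_le_mul_of_nonneg_right (h.trans (le_abs_self M)) (norm_nonneg _)

open Classical in

theorem hasSum_shift {n : ℕ} (d : Fin n → ℕ) {f : (Fin n → ℕ) → ℝ} {S : ℝ} (hf : HasSum f S) :
    HasSum (fun ν => if d ≤ ν then f (ν - d) else 0) S := by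
  rw [← (add_left_injective d).hasSum_iff]
  · refine hf.congr_fun fun ν => ?_
    simp
  · intro ν hν
    refine if_neg fun h => hν ⟨ν - d, tsub_add_cancel_of_le h⟩

open Classical in

theorem CoeffSummable.shift {n : ℕ} {L : (Fin n → ℕ) → PowerSeries ℝ} (hL : CoeffSummable L)
    (d : Fin n → ℕ) : CoeffSummable (fun ν => if d ≤ ν then L (ν - d) else 0) ∧
      coeffSum (fun ν => if d ≤ ν then L (ν - d) else 0) = coeffSum L := by
  have h (m : ℕ) : HasSum (fun ν => PowerSeries.coeff m (if d ≤ ν then L (ν - d) else 0))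
      (∑' ν, PowerSeries.coeff m (L ν)) := by
    simpa only [apply_ite (PowerSeries.coeff m), map_zero] using hasSum_shift d (hL m).hasSum
  refine ⟨fun m => (h m).summable, ?_⟩
  ext m
  simp only [coeffSum, PowerSeries.coeff_mk]
  exact (h m).tsum_eq

theorem CoeffSummable.stepAct {n : ℕ} {q t : ℝ} (hq0 : 0 < q) (hq1 : q < 1) (ht : 0 < t)
    (ht1 : t < 1) {L : (Fin n → ℕ) → PowerSeries ℝ} (hL : CoeffSummable L)
    (hL' : AntitoneSupported L) (σ : PowerSeries ℝ) :
    CoeffSummable (stepAct q t σ 0 0 L) ∧ coeffSum (stepAct q t σ 0 0 L) =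
      (∏ i ∈ Finset.range n, (1 - PowerSeries.C (t ^ i) * σ)) * coeffSum L := by
  classical
  have h1 (J : Finset (Fin n)) :
      CoeffSummable fun ν => PowerSeries.C (vdmRatio t (lat q t ν) J) * L ν := by
    refine hL.smul_of_bdd (M := ∏ p ∈ ltPairs n, (1 - t)⁻¹) fun ν => ?_
    by_cases hν : Antitone ν
    · exact Or.inr (abs_vdmRatio_lat_le hq0 hq1 ht ht1 hν J)
    · exact Or.inl (by rw [hL' ν hν, mul_zero])
  have h2 (J : Finset (Fin n)) := (h1 J).mul (∏ _j ∈ J, -σ)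
  have h3 (J : Finset (Fin n)) := (h2 J).shift (inc J)
  have h4 : _root_.stepAct q t σ 0 0 L = fun ν => ∑ J : Finset (Fin n), if inc J ≤ ν then
      (∏ _j ∈ J, -σ) * (PowerSeries.C (vdmRatio t (lat q t (ν - inc J)) J) * L (ν - inc J))
      else 0 := by
    funext ν
    refine Finset.sum_congr rfl fun J _ => ?_
    split_ifs
    · simp only [stepWeight, zero_mul, sub_zero, mul_one, Finset.prod_const_one]
      change PowerSeries.C _ * _ * _ = _
      ring
    · rfl
  rw [h4]
  refine ⟨CoeffSummable.sum fun J _ => (h3 J).1, ?_⟩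
  rw [coeffSum_sum fun J _ => (h3 J).1, Finset.sum_congr rfl fun J _ => (h3 J).2,
    ← coeffSum_sum fun J _ => h2 J, ← hL.coeffSum_mul]
  congr 1
  funext ν
  by_cases hν : Antitone ν
  · have h5 := sum_vdmRatio_linear_top (R := PowerSeries ℝ) t (lat_injective hq0 hq1 ht ht1 hν)
      (-σ) 0 1 0 (by simp)
    simp only [zero_mul, add_zero, Finset.prod_const_one, mul_one] at h5
    have h6 : ∏ i ∈ Finset.range n, (1 - PowerSeries.C (t ^ i) * σ) =
        ∏ i ∈ Finset.range n, (1 + algebraMap ℝ (PowerSeries ℝ) (t ^ i) * -σ) :=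
      Finset.prod_congr rfl fun i _ => by
        rw [mul_neg, ← sub_eq_add_neg]; rfl
    rw [h6, ← h5, Finset.sum_mul]
    refine Finset.sum_congr rfl fun J _ => ?_
    change _ = PowerSeries.C _ * _ * _
    ring
  · simp [hL' ν hν]

end coeffSum

/-- The equation `g (q X) = h g` has a solution with constant coefficient `1`. -/
theorem exists_rescale_eq_mul {q : ℝ} (hq0 : 0 < q) (hq1 : q < 1) {h : PowerSeries ℝ}
    (hh : PowerSeries.constantCoeff h = 1) :
    ∃ g : PowerSeries ℝ, PowerSeries.constantCoeff g = 1 ∧ PowerSeries.rescale q g = h * g := by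
  obtain ⟨L, -, hL, h0⟩ := exists_isTwisted (n := 1) (t := 1 / 2) (s := 0) (u := 1 - h) hq0 hq1
    (by norm_num) (by norm_num) 0 (map_zero _) (by rw [map_sub, hh, map_one, sub_self])
    (L₀ := fun _ => 1) (fun ν hν => absurd (Subsingleton.antitone ν) hν)
  refine ⟨L 0, h0 0, ?_⟩
  rw [hL 0, stepAct, Finset.sum_eq_single ∅]
  · rw [if_pos (by rw [inc_empty]), inc_empty, stepWeight,
      vdmRatio_lat_empty hq0 hq1 (by norm_num) (by norm_num) (Subsingleton.antitone _)]
    simp [lat]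
  · intro J _ hJ
    rw [if_neg]
    obtain ⟨j, hj⟩ := Finset.nonempty_iff_ne_empty.2 hJ
    intro h
    simpa [inc, hj] using h j
  · simp

theorem summable_pow_sum {B : ℝ} (hB : 0 ≤ B) (hB1 : B < 1) (n : ℕ) :
    Summable fun ν : Fin n → ℕ => B ^ ∑ j, ν j := by
  induction n with
  | zero => exact Summable.of_finite
  | succ n ih =>
    rw [← (Fin.consEquiv fun _ => ℕ).summable_iff]
    refine ((summable_geometric_of_lt_one hB hB1).mul_of_nonneg ih (fun _ => pow_nonneg hB _)
      fun _ => pow_nonneg hB _).congr fun p => ?_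
    simp [Fin.consEquiv, Fin.sum_univ_succ, pow_add]

section bounds

variable {n : ℕ} {q t B : ℝ}

theorem abs_qProd_mul_lat_le_one (hq0 : 0 < q) (hq1 : q < 1) (ht : 0 < t) (ht1 : t < 1)
    (ν : Fin n → ℕ) (j : Fin n) : |qProd q (q * lat q t ν j)| ≤ 1 := by
  have h1 := lat_le_one hq0 hq1 ht ht1 ν j
  have h2 := lat_pos hq0 ht ν j
  have h3 : q * lat q t ν j < 1 := by nlinarith
  rw [abs_of_pos (qProd_pos hq0 hq1 (by positivity) h3), ← qProd_zero q]
  exact qProd_anti hq0 hq1 (by positivity) h3.le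

theorem exists_baseWeight_le (hq0 : 0 < q) (hq1 : q < 1) (ht : 0 < t) (ht1 : t < 1) (hB : 0 < B) :
    ∃ C, 0 < C ∧ ∀ ν : Fin n → ℕ, |baseWeight q t B ν| ≤ C * B ^ ∑ j, ν j := by
  obtain ⟨C, hC, h⟩ := exists_latDelta_le hq0 hq1 ht ht1 n
  refine ⟨C, hC, fun ν => ?_⟩
  rw [baseWeight, abs_mul, abs_mul, abs_of_pos (pow_pos hB _), Finset.abs_prod]
  exact (mul_le_of_le_one_right (mul_nonneg (abs_nonneg _) (pow_nonneg hB.le _))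
    (Finset.prod_le_one (fun _ _ => abs_nonneg _) fun j _ =>
      abs_qProd_mul_lat_le_one hq0 hq1 ht ht1 ν j)).trans
    (mul_le_mul_of_nonneg_right (h ν) (pow_nonneg hB.le _))

theorem abs_finPoch_le (hq0 : 0 < q) (hq1 : q < 1) (ht : 0 < t) (ht1 : t < 1) {b M : ℝ}
    (hb : |b| ≤ M) (ν : Fin n → ℕ) : |finPoch q t b ν| ≤ qProd q (-M) ^ n := by
  rw [finPoch, Finset.abs_prod]
  refine (Finset.prod_le_prod (fun _ _ => abs_nonneg _) fun j _ => ?_).trans_eq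
    (by rw [Finset.prod_const, Finset.card_fin])
  refine (Eq.trans_le ?_ (abs_prod_le_qProd hq0 hq1 (a := b * t ^ (j.rev : ℕ)) ?_ (ν j)))
  · congr 1
    refine Finset.prod_congr rfl fun m _ => ?_
    simp only [Algebra.algebraMap_self, RingHom.id_apply]
    ring
  · rw [abs_mul, abs_of_pos (pow_pos ht _)]
    exact (mul_le_of_le_one_right (abs_nonneg _) (pow_le_one₀ ht.le ht1.le)).trans hb

theorem exists_baseSol_le (hq0 : 0 < q) (hq1 : q < 1) (ht : 0 < t) (ht1 : t < 1) (hB : 0 < B)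
    (M : ℝ) : ∃ C, ∀ b : ℝ, |b| ≤ M → ∀ ν : Fin n → ℕ,
      |baseSol q t B b ν| ≤ C * B ^ ∑ j, ν j := by
  obtain ⟨C, hC, h⟩ := exists_baseWeight_le (n := n) hq0 hq1 ht ht1 hB
  refine ⟨C * qProd q (-M) ^ n, fun b hb ν => ?_⟩
  rw [baseSol, Algebra.algebraMap_self, RingHom.id_apply, abs_mul, mul_right_comm]
  exact mul_le_mul (h ν) (abs_finPoch_le hq0 hq1 ht ht1 hb ν) (abs_nonneg _)
    (mul_nonneg hC.le (pow_nonneg hB.le _))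

theorem GeomBdd.coeffSummable {ι : Type*} (hB : 0 ≤ B) (hB1 : B < 1)
    {L : ι → (Fin n → ℕ) → PowerSeries ℝ} (h : GeomBdd B L) (i : ι) : CoeffSummable (L i) :=
  fun m => by
    obtain ⟨C, hC⟩ := h m
    exact Summable.of_norm_bounded ((summable_pow_sum hB hB1 n).mul_left C) fun ν => hC i ν

theorem baseSol_supported (q t B : ℝ) {R : Type*} [CommRing R] [Algebra ℝ R] (b : R)
    {ν : Fin n → ℕ} (hν : ¬ Antitone ν) : baseSol q t B b ν = 0 := by
  simp [baseSol, baseWeight, latDelta_of_not_antitone hν]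

theorem continuous_baseSol (q t B : ℝ) (ν : Fin n → ℕ) :
    Continuous fun b : ℝ => baseSol q t B b ν := by
  unfold baseSol finPoch
  fun_prop

end bounds

section base

variable {n : ℕ} {q t B : ℝ}

theorem stepAct_C_baseSol (hq0 : 0 < q) (hq1 : q < 1) (ht : 0 < t) (ht1 : t < 1)
    (b : PowerSeries ℝ) (ν : Fin n → ℕ) :
    stepAct q t (b * PowerSeries.C (B * t ^ (n - 1))) 0 0
      (fun ν => baseSol q t B (PowerSeries.C q * b) ν) ν = baseSol q t B b ν := by
  rw [← sum_step_base hq0 hq1 ht ht1 b ν, stepAct]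
  exact Finset.sum_congr rfl fun J _ => by congr!

theorem constantCoeff_stepAct_C (σ : ℝ) (L : (Fin n → ℕ) → PowerSeries ℝ) (ν : Fin n → ℕ) :
    PowerSeries.constantCoeff (stepAct q t (PowerSeries.C σ) 0 0 L ν) =
      PowerSeries.constantCoeff (stepAct q t (PowerSeries.C σ) 0 0
        (fun ν => PowerSeries.C (PowerSeries.constantCoeff (L ν))) ν) := by
  rw [stepAct, stepAct, map_sum, map_sum]
  refine Finset.sum_congr rfl fun J _ => ?_
  split_ifs
  · rw [map_mul, map_mul, PowerSeries.constantCoeff_C]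
  · rfl

theorem C_baseSol (b : ℝ) (ν : Fin n → ℕ) : PowerSeries.C (baseSol q t B b ν) =
    baseSol q t B (PowerSeries.C b : PowerSeries ℝ) ν :=
  map_baseSol (Algebra.ofId ℝ (PowerSeries ℝ)) q t B b ν

theorem IsTwisted.stepAct (hq0 : 0 < q) (hq1 : q < 1) (ht : 0 < t) (ht1 : t < 1)
    {s s' s₃ s₄ u v v' : ℝ[X]} (hv : v = C q * v') (hs : s + s' = s₃ + s₄)
    (hss : s * s' = s₃ * s₄) (hsv : s * v + s' * u = s₃ * (u * C q) + s₄ * v')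
    (hr : PowerSeries.rescale q (s₃ : PowerSeries ℝ) = s')
    {L : (Fin n → ℕ) → PowerSeries ℝ} (hL : AntitoneSupported L)
    (hT : IsTwisted q t (s : PowerSeries ℝ) u v L) :
    IsTwisted q t (s₄ : PowerSeries ℝ) u v' (_root_.stepAct q t (s₃ : PowerSeries ℝ) 0 0 L) := by
  intro ν
  rw [rescale_stepAct, map_zero, hr, funext hT,
    stepAct_exchange hq0 hq1 ht ht1 hv hs hss hsv hL]

theorem rescale_C_mul_X (s : ℝ) : PowerSeries.rescale q (PowerSeries.C s * PowerSeries.X) =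
    PowerSeries.C (q * s) * PowerSeries.X := by
  ext m
  rw [PowerSeries.coeff_rescale, PowerSeries.coeff_C_mul, PowerSeries.coeff_C_mul,
    PowerSeries.coeff_X]
  split_ifs with h
  · rw [h]; ring
  · simp

theorem rescale_C (s : ℝ) : PowerSeries.rescale q (PowerSeries.C s) = PowerSeries.C s := by
  ext m
  rw [PowerSeries.coeff_rescale, PowerSeries.coeff_C]
  split_ifs with h
  · rw [h]; ring
  · simp

/-- The relation between the twisted families with parameters `s` and `q * s`. -/
theorem stepAct_isTwisted_eq (hq0 : 0 < q) (hq1 : q < 1) (ht : 0 < t) (ht1 : t < 1)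
    {s u v b : ℝ} (hb : b * (B * t ^ (n - 1)) * u = s * v) {L L' : (Fin n → ℕ) → PowerSeries ℝ}
    (hL : AntitoneSupported L) (hL' : AntitoneSupported L')
    (hT : IsTwisted q t (PowerSeries.C s * PowerSeries.X)
      (PowerSeries.C u * PowerSeries.X) (PowerSeries.C v) L)
    (hT' : IsTwisted q t (PowerSeries.C (q * s) * PowerSeries.X)
      (PowerSeries.C u * PowerSeries.X) (PowerSeries.C v) L')
    (h0 : ∀ ν, PowerSeries.constantCoeff (L ν) = baseSol q t B b ν)
    (h0' : ∀ ν, PowerSeries.constantCoeff (L' ν) = baseSol q t B (q * b) ν) :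
    stepAct q t (PowerSeries.C (b * (B * t ^ (n - 1)))) 0 0 L' =
      stepAct q t (PowerSeries.C s * PowerSeries.X) 0 0 L := by
  refine IsTwisted.ext hq0 hq1 ht ht1 (s := PowerSeries.C (q * s) * PowerSeries.X)
    (u := PowerSeries.C u * PowerSeries.X) (v := PowerSeries.C (v / q)) (by simp) (by simp)
    (stepAct_supported _ _ _ _ _ hL') (stepAct_supported _ _ _ _ _ hL) ?_ ?_ ?_
  · have := IsTwisted.stepAct hq0 hq1 ht ht1 (s := C (q * s) * X)
      (s' := C (b * (B * t ^ (n - 1)))) (s₃ := C (b * (B * t ^ (n - 1)))) (s₄ := C (q * s) * X)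
      (u := C u * X) (v := C v) (v' := C (v / q)) ?_ ?_ ?_ ?_ ?_ hL' (by simpa using hT')
    · simpa using this
    · rw [← C_mul, mul_div_cancel₀ _ hq0.ne']
    · ring
    · ring
    · have h1 := congrArg (C (R := ℝ)) hb
      have h2 := congrArg (C (R := ℝ)) (mul_div_cancel₀ v hq0.ne')
      simp only [C_mul] at h1 h2 ⊢
      linear_combination X * (1 - C q) * h1 - C s * X * h2
    · rw [Polynomial.coe_C, rescale_C]
  · have := IsTwisted.stepAct hq0 hq1 ht ht1 (s := C s * X) (s' := C (q * s) * X)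
      (s₃ := C s * X) (s₄ := C (q * s) * X) (u := C u * X) (v := C v)
      (v' := C (v / q)) ?_ ?_ ?_ ?_ ?_ hL (by simpa using hT)
    · simpa using this
    · rw [← C_mul, mul_div_cancel₀ _ hq0.ne']
    · ring
    · ring
    · have h2 := congrArg (C (R := ℝ)) (mul_div_cancel₀ v hq0.ne')
      simp only [C_mul] at h2 ⊢
      linear_combination - C s * X * h2
    · rw [Polynomial.coe_mul, Polynomial.coe_C, Polynomial.coe_X, rescale_C_mul_X]; simp
  · intro ν
    rw [constantCoeff_stepAct_C, ← PowerSeries.coeff_zero_eq_constantCoeff_apply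
      (stepAct q t (PowerSeries.C s * PowerSeries.X) 0 0 L ν),
      coeff_stepAct hq0 hq1 ht ht1 _ (by simp) (by simp) hL]
    simp only [h0', PowerSeries.coeff_zero_eq_constantCoeff_apply, h0]
    rw [lowerAct, Finset.sum_eq_zero (fun J _ => by simp), add_zero]
    simp only [C_baseSol, map_mul PowerSeries.C q]
    have := stepAct_C_baseSol (B := B) hq0 hq1 ht ht1 (PowerSeries.C b) ν
    rw [← map_mul] at this
    rw [this, ← C_baseSol, PowerSeries.constantCoeff_C]

end base

section base

variable {n : ℕ} {q t B : ℝ}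

theorem prod_rev_eq_prod_range {R : Type*} [CommRing R] (f : ℕ → R) :
    ∏ j : Fin n, f (j.rev : ℕ) = ∏ i ∈ Finset.range n, f i := by
  rw [← Fin.prod_univ_eq_prod_range]
  exact Fintype.prod_equiv Fin.revPerm _ _ fun j => by simp

theorem CoeffSummable.rescale {ι : Type*} {L : ι → PowerSeries ℝ} (hL : CoeffSummable L) (q : ℝ) :
    CoeffSummable fun i => PowerSeries.rescale q (L i) := fun m => by
  simp only [PowerSeries.coeff_rescale]
  exact (hL m).mul_left _

theorem rescale_baseSol (b : PowerSeries ℝ) (ν : Fin n → ℕ) :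
    PowerSeries.rescale q (baseSol q t B b ν) = baseSol q t B (PowerSeries.rescale q b) ν := by
  have := map_baseSol (PowerSeries.rescaleAlgHom q) q t B b ν
  rwa [← RingHom.coe_coe, PowerSeries.coe_rescaleAlgHom] at this

theorem constantCoeff_baseSol (b : PowerSeries ℝ) (ν : Fin n → ℕ) :
    PowerSeries.constantCoeff (baseSol q t B b ν) =
      baseSol q t B (PowerSeries.constantCoeff b) ν := by
  simp [baseSol, finPoch, map_prod]

theorem stepAct_zero_left (hq0 : 0 < q) (hq1 : q < 1) (ht : 0 < t) (ht1 : t < 1)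
    (u v : PowerSeries ℝ) {L : (Fin n → ℕ) → PowerSeries ℝ} (hL : AntitoneSupported L)
    (ν : Fin n → ℕ) : stepAct q t 0 u v L ν =
      (∏ j, (1 - u * PowerSeries.C (lat q t ν j))) * L ν := by
  by_cases hν : Antitone ν
  swap
  · rw [hL ν hν, mul_zero, stepAct_supported _ _ _ _ _ hL ν hν]
  rw [stepAct, Finset.sum_eq_single ∅]
  · rw [if_pos (by rw [inc_empty]; exact zero_le)]
    simp only [inc_empty, tsub_zero, stepWeight, vdmRatio_lat_empty hq0 hq1 ht ht1 hν,
      map_one, one_mul, Finset.prod_empty, Finset.compl_empty]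
    rfl
  · intro J _ hJ
    split_ifs
    · have : J.card ≠ 0 := Finset.card_ne_zero.2 (Finset.nonempty_iff_ne_empty.2 hJ)
      simp [stepWeight, zero_pow this]
    · rfl
  · simp

theorem rescale_coeffSum_zero (hq0 : 0 < q) (hq1 : q < 1) (ht : 0 < t) (ht1 : t < 1)
    {u v : ℝ} {L : (Fin n → ℕ) → PowerSeries ℝ} (hL : AntitoneSupported L)
    (hT : IsTwisted q t 0 (PowerSeries.C u * PowerSeries.X) (PowerSeries.C v) L)
    (h0 : ∀ ν, PowerSeries.constantCoeff (L ν) = baseSol q t B 0 ν) (hs : CoeffSummable L) :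
    (∏ i ∈ Finset.range n, (1 - PowerSeries.C (u * (B * t ^ (n - 1)) * t ^ i) * PowerSeries.X)) *
        PowerSeries.rescale q (coeffSum L) =
      (∏ i ∈ Finset.range n, (1 - PowerSeries.C (u * t ^ i) * PowerSeries.X)) * coeffSum L := by
  set b : PowerSeries ℝ := PowerSeries.C u * PowerSeries.X with hb
  set h : PowerSeries ℝ := ∏ i ∈ Finset.range n, (1 - PowerSeries.C (u * t ^ i) * PowerSeries.X)
    with hh
  have hh' : h = ∏ j : Fin n, (1 - b * algebraMap ℝ (PowerSeries ℝ) (t ^ (j.rev : ℕ))) := by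
    rw [prod_rev_eq_prod_range fun i => 1 - b * algebraMap ℝ (PowerSeries ℝ) (t ^ i), hh]
    refine Finset.prod_congr rfl fun i _ => ?_
    change _ = 1 - b * PowerSeries.C _
    rw [hb, map_mul]
    ring
  obtain ⟨g, hg0, hg⟩ := exists_rescale_eq_mul hq0 hq1 (h := h) (by simp [hh, map_prod])
  have hb' : PowerSeries.rescale q b = algebraMap ℝ (PowerSeries ℝ) q * b := by
    rw [hb, rescale_C_mul_X, map_mul, mul_assoc]; rfl
  have hK : AntitoneSupported fun ν : Fin n → ℕ => baseSol q t B b ν := fun ν hν =>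
    baseSol_supported _ _ _ _ hν
  have hfin (ν : Fin n → ℕ) : h * baseSol q t B (algebraMap ℝ (PowerSeries ℝ) q * b) ν =
      (∏ j, (1 - b * PowerSeries.C (lat q t ν j))) * baseSol q t B b ν := by
    have := finPoch_sub_inc q t b (ν := ν) (J := ∅) (by rw [inc_empty]; exact zero_le)
    rw [inc_empty, tsub_zero, ← hh', Finset.compl_empty] at this
    change _ = _ * ∏ j, (1 - b * PowerSeries.C (lat q t ν j)) at this
    rw [baseSol, baseSol]
    linear_combination (algebraMap ℝ (PowerSeries ℝ) (baseWeight q t B ν)) * this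
  have hLK : L = fun ν => g * baseSol q t B b ν := by
    refine IsTwisted.ext hq0 hq1 ht ht1 (map_zero _) (by simp [hb]) hL
      (fun ν hν => mul_eq_zero_of_right _ (hK ν hν)) hT (fun ν => ?_) fun ν => ?_
    · rw [stepAct_mul, stepAct_zero_left hq0 hq1 ht ht1 _ _ hK, map_mul, rescale_baseSol, hb', hg]
      linear_combination g * hfin ν
    · rw [h0, map_mul, hg0, one_mul, constantCoeff_baseSol]
      simp [hb]
  have h1 := hs.rescale q |>.stepAct hq0 hq1 ht ht1
    (fun ν hν => by simp only [hL ν hν, map_zero]) (b * PowerSeries.C (B * t ^ (n - 1)))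
  have h2 : stepAct q t (b * PowerSeries.C (B * t ^ (n - 1))) 0 0
      (fun ν => PowerSeries.rescale q (L ν)) = fun ν => h * L ν := by
    funext ν
    have h3 : (fun ν => PowerSeries.rescale q (L ν)) = fun ν : Fin n → ℕ =>
        (h * g) * baseSol q t B (PowerSeries.C q * b) ν := by
      funext ν
      rw [hLK, map_mul, rescale_baseSol, hb', hg]
      rfl
    rw [h3, stepAct_mul, stepAct_C_baseSol hq0 hq1 ht ht1, hLK, mul_assoc]
  rw [h2, coeffSum_rescale, hs.coeffSum_mul] at h1
  rw [h1.2]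
  congr 1
  refine Finset.prod_congr rfl fun i _ => ?_
  simp only [hb, map_mul]
  ring

end base

section base

variable {n : ℕ} {q t B : ℝ}

theorem eq_zero_of_isTwisted_recurrence (hq0 : 0 < q) (hq1 : q < 1) {Q p : ℝ → PowerSeries ℝ}
    (κ : Fin n → ℝ) (h : ∀ s, PowerSeries.C (∏ i, (1 - κ i * s)) * Q (q * s) = p s * Q s)
    (hp : ∀ s, PowerSeries.constantCoeff (p s) = 1)
    (h0 : ∀ s m, Filter.Tendsto (fun N : ℕ => PowerSeries.coeff m (Q (s * q ^ N))) Filter.atTop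
      (nhds 0)) (s : ℝ) : Q s = 0 := by
  ext m
  rw [map_zero]
  induction m using Nat.strong_induction_on generalizing s with
  | _ m ih =>
  have h1 (s : ℝ) : PowerSeries.coeff m (Q s) =
      (∏ i, (1 - κ i * s)) * PowerSeries.coeff m (Q (q * s)) := by
    have := congrArg (PowerSeries.coeff m) (h s)
    rw [PowerSeries.coeff_C_mul, PowerSeries.coeff_mul, Finset.sum_eq_single (0, m)] at this
    · rw [this, PowerSeries.coeff_zero_eq_constantCoeff_apply, hp, one_mul]
    · rintro ⟨a, b⟩ hab hne
      rw [Finset.HasAntidiagonal.mem_antidiagonal] at hab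
      simp only at hab
      have : b < m := by
        rcases Nat.eq_zero_or_pos a with rfl | ha
        · exact absurd (by simp [← hab]) hne
        · omega
      rw [ih b this s, mul_zero]
    · simp
  have h2 (N : ℕ) : PowerSeries.coeff m (Q s) =
      (∏ i, ∏ j ∈ Finset.range N, (1 - κ i * s * q ^ j)) *
        PowerSeries.coeff m (Q (s * q ^ N)) := by
    induction N with
    | zero => simp
    | succ N ihN =>
      rw [ihN, h1 (s * q ^ N)]
      simp only [Finset.prod_range_succ, Finset.prod_mul_distrib]
      rw [pow_succ, mul_comm q, mul_assoc s, mul_assoc (∏ i, _)]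
      simp only [mul_assoc]
  refine tendsto_nhds_unique (l := (Filter.atTop : Filter ℕ)) tendsto_const_nhds
    (squeeze_zero_norm (a := fun N => (∏ i, qProd q (-|κ i * s|)) *
      ‖PowerSeries.coeff m (Q (s * q ^ N))‖) (fun N => ?_) ?_)

  · rw [h2 N, norm_mul, Real.norm_eq_abs (∏ i, _), Finset.abs_prod]
    exact mul_le_mul_of_nonneg_right (Finset.prod_le_prod (fun _ _ => abs_nonneg _) fun i _ =>
      abs_prod_le_qProd hq0 hq1 le_rfl N) (norm_nonneg _)
  · simpa using ((h0 s m).norm.const_mul (∏ i, qProd q (-|κ i * s|)))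

end base

section base

variable {n : ℕ} {q t B : ℝ}

open scoped PowerSeries.WithPiTopology in

/-- The `q`-difference equation for the sum of a twisted family. -/
theorem rescale_coeffSum_of_isTwisted (hq0 : 0 < q) (hq1 : q < 1) (ht : 0 < t) (ht1 : t < 1)
    (hB : 0 < B) (hB1 : B < 1) {u v s κ : ℝ} (hκ : κ * (B * t ^ (n - 1)) * u = v)
    {L : (Fin n → ℕ) → PowerSeries ℝ} (hL : AntitoneSupported L)
    (hT : IsTwisted q t (PowerSeries.C s * PowerSeries.X)
      (PowerSeries.C u * PowerSeries.X) (PowerSeries.C v) L)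
    (h0 : ∀ ν, PowerSeries.constantCoeff (L ν) = baseSol q t B (s * κ) ν) :
    CoeffSummable L ∧
    (∏ i ∈ Finset.range n, (1 - PowerSeries.C (u * (B * t ^ (n - 1)) * t ^ i) * PowerSeries.X)) *
        PowerSeries.rescale q (coeffSum L) =
      (∏ i ∈ Finset.range n, (1 - PowerSeries.C (u * t ^ i) * PowerSeries.X)) *
        (∏ i ∈ Finset.range n, (1 - PowerSeries.C (s * t ^ i) * PowerSeries.X)) * coeffSum L := by
  have hex (s : ℝ) : ∃ L : (Fin n → ℕ) → PowerSeries ℝ, AntitoneSupported L ∧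
      IsTwisted q t (PowerSeries.C s * PowerSeries.X) (PowerSeries.C u * PowerSeries.X)
        (PowerSeries.C v) L ∧ ∀ ν, PowerSeries.constantCoeff (L ν) = baseSol q t B (s * κ) ν :=
    exists_isTwisted hq0 hq1 ht ht1 _ (by simp) (by simp)
      fun ν hν => baseSol_supported q t B (s * κ) hν
  choose F hF hFT hF0 using hex
  obtain rfl : L = F s := IsTwisted.ext hq0 hq1 ht ht1 (by simp) (by simp) hL (hF s) hT (hFT s)
    fun ν => by rw [h0, hF0]
  have hbdd (s : ℝ) : GeomBdd B fun N : ℕ => F (s * q ^ N) := by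
    have habs (N : ℕ) : |s * q ^ N| ≤ |s| := by
      rw [abs_mul, abs_of_pos (pow_pos hq0 N)]
      exact mul_le_of_le_one_right (abs_nonneg _) (pow_le_one₀ hq0.le hq1.le)
    refine geomBdd_of_isTwisted hq0 hq1 ht ht1 hB hB1 habs u v (fun N => hF _) (fun N => hFT _) ?_
    obtain ⟨D, hD⟩ := exists_baseSol_le (n := n) hq0 hq1 ht ht1 hB (|s| * |κ|)
    refine ⟨D, fun N ν => ?_⟩
    rw [hF0]
    refine hD _ ?_ ν
    rw [abs_mul]
    exact mul_le_mul_of_nonneg_right (habs N) (abs_nonneg _)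
  have hsum (s : ℝ) : CoeffSummable (F s) := by
    simpa using (hbdd s).coeffSummable hB.le hB1 0
  refine ⟨hsum s, ?_⟩
  set U : PowerSeries ℝ := ∏ i ∈ Finset.range n,
    (1 - PowerSeries.C (u * (B * t ^ (n - 1)) * t ^ i) * PowerSeries.X)
  set H : PowerSeries ℝ := ∏ i ∈ Finset.range n, (1 - PowerSeries.C (u * t ^ i) * PowerSeries.X)
  set p : ℝ → PowerSeries ℝ := fun s =>
    ∏ i ∈ Finset.range n, (1 - PowerSeries.C (s * t ^ i) * PowerSeries.X) with hp
  set f : ℝ → PowerSeries ℝ := fun s => coeffSum (F s) with hf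
  set Q : ℝ → PowerSeries ℝ := fun s => U * PowerSeries.rescale q (f s) - H * p s * f s with hQ
  set κ' : Fin n → ℝ := fun i => t ^ (i : ℕ) * (κ * (B * t ^ (n - 1))) with hκ'
  have hstep (s : ℝ) : PowerSeries.C (∏ i, (1 - κ' i * s)) * f (q * s) = p s * f s := by
    have h1 := stepAct_isTwisted_eq hq0 hq1 ht ht1 (b := s * κ) (B := B)
      (by rw [← hκ]; ring) (hF s) (hF (q * s))
      (hFT s) (hFT (q * s)) (hF0 s) (fun ν => by rw [hF0, mul_assoc])
    have h2 := ((hsum (q * s)).stepAct hq0 hq1 ht ht1 (hF _)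
      (PowerSeries.C (s * κ * (B * t ^ (n - 1))))).2
    rw [h1, ((hsum s).stepAct hq0 hq1 ht ht1 (hF _) _).2] at h2
    convert h2.symm using 2
    · rw [Fin.prod_univ_eq_prod_range (fun i => 1 - t ^ i * (κ * (B * t ^ (n - 1))) * s), map_prod]
      refine Finset.prod_congr rfl fun i _ => ?_
      rw [← map_mul, map_sub, map_one]
      congr 2
      ring
    · refine Finset.prod_congr rfl fun i _ => ?_
      rw [map_mul]
      ring
  have hpr (s : ℝ) : PowerSeries.rescale q (p s) = p (q * s) := by
    simp only [hp, map_prod, map_sub, map_one, rescale_C_mul_X, mul_assoc]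
  have hrec (s : ℝ) : PowerSeries.C (∏ i, (1 - κ' i * s)) * Q (q * s) = p (q * s) * Q s := by
    have h1 := hstep s
    have h2 := congrArg (PowerSeries.rescale q) h1
    rw [map_mul, map_mul, rescale_C, hpr] at h2
    simp only [hQ]
    linear_combination U * h2 - H * p (q * s) * h1
  have hQ0 : Q 0 = 0 := by
    have hT0 := hFT 0
    rw [map_zero, zero_mul] at hT0
    have := rescale_coeffSum_zero hq0 hq1 ht ht1 (hF 0) hT0 (by simpa using hF0 0) (hsum 0)
    simp only [hQ, hp, hf, sub_eq_zero]
    have hp0 : ∏ i ∈ Finset.range n, (1 - PowerSeries.C ((0 : ℝ) * t ^ i) * PowerSeries.X) = 1 := by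
      simp
    rw [hp0, mul_one, this]
  have hsq (s : ℝ) : Filter.Tendsto (fun N : ℕ => s * q ^ N) Filter.atTop (nhds 0) := by
    simpa using (tendsto_pow_atTop_nhds_zero_of_lt_one hq0.le hq1).const_mul s
  have hft (s : ℝ) : Filter.Tendsto (fun N : ℕ => f (s * q ^ N)) Filter.atTop (nhds (f 0)) := by
    rw [PowerSeries.WithPiTopology.tendsto_iff_coeff_tendsto]
    intro m
    obtain ⟨D, hD⟩ := hbdd s m
    simp only [hf, coeffSum, PowerSeries.coeff_mk]
    refine tendsto_tsum_of_dominated_convergence ((summable_pow_sum hB.le hB1 n).mul_left D)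
      (fun ν => ?_) (Filter.Eventually.of_forall fun N ν => hD N ν)
    refine tendsto_coeff_of_isTwisted hq0 hq1 ht ht1 (hsq s) u v (fun N => hF _) (hF 0)
      (fun N => hFT _) (hFT 0) (fun ν => ?_) m ν
    simp only [hF0]
    exact ((continuous_baseSol q t B ν).tendsto (0 * κ)).comp ((hsq s).mul_const κ)
  have hpc : Continuous p := by
    have := PowerSeries.WithPiTopology.continuous_C (R := ℝ)
    simp only [hp]
    fun_prop
  have hQt (s : ℝ) : Filter.Tendsto (fun N : ℕ => Q (s * q ^ N)) Filter.atTop (nhds (Q 0)) := by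
    refine ((Filter.Tendsto.const_mul U ?_).sub (Filter.Tendsto.mul
      (((hpc.tendsto 0).comp (hsq s)).const_mul H) (hft s)))
    have := hft s
    rw [PowerSeries.WithPiTopology.tendsto_iff_coeff_tendsto] at this ⊢
    intro m
    simpa only [PowerSeries.coeff_rescale] using (this m).const_mul (q ^ m)
  have := eq_zero_of_isTwisted_recurrence hq0 hq1 (Q := Q) κ' hrec
    (fun s => by simp [hp, map_prod]) (fun s m => by
      have := (PowerSeries.WithPiTopology.tendsto_iff_coeff_tendsto _ _ _ _).1 (hQt s) m
      rwa [hQ0, map_zero] at this) s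
  exact sub_eq_zero.1 this

end base

/-- No element of the lattice `b t ^ ℤ q ^ ℤ` equals `1`. -/
def LatGeneric (q t b : ℝ) : Prop := ∀ m l : ℤ, b * t ^ m * q ^ l ≠ 1

/-- The part of the summand that depends on one coordinate `x` of the first family. -/
noncomputable def leftFactor {n : ℕ} (q t b : ℝ) (ν : Fin n → ℕ) (x : ℝ) : ℝ :=
  qProd q (q * x) / qProd q (b * x) * ∏ j, (t ^ ν j)⁻¹ *
    (qProd q (b * x / lat q t ν j) / qProd q (b * x / (t * lat q t ν j)))

/-- The part of the summand that depends on one coordinate `y` of the second family. -/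
noncomputable def rightFactor {k : ℕ} (q t b B v : ℝ) (η : Fin k → ℕ) (y : ℝ) (m : ℕ) : ℝ :=
  B ^ m * (qProd q (q * y) / qProd q (v * y)) * ∏ i, (t ^ m)⁻¹ *
    (qProd q (b * lat q t η i / y) / qProd q (b * lat q t η i / (t * y)))

section factors

variable {k n : ℕ} {q t b B v : ℝ}

theorem qProd_div_qProd_mul_left (hq0 : 0 < q) (hq1 : q < 1) (ht : 0 < t) {x y : ℝ} (hy : y ≠ 0)
    (h1 : y - x ≠ 0) (h2 : t * y - x ≠ 0) :
    qProd q (q * x / y) / qProd q (q * x / (t * y)) =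
      qProd q (x / y) / qProd q (x / (t * y)) * ((t * y - x) / (t * (y - x))) := by
  rw [qProd_eq_mul hq0 hq1 (x / y), qProd_eq_mul hq0 hq1 (x / (t * y)), ← mul_div_assoc,
    ← mul_div_assoc, show 1 - x / y = (y - x) / y by field_simp,
    show 1 - x / (t * y) = (t * y - x) / (t * y) by field_simp]
  generalize y - x = a at *
  generalize t * y - x = c at *
  field_simp

theorem leftFactor_mul (hq0 : 0 < q) (hq1 : q < 1) (ht : 0 < t) (ν : Fin n → ℕ) {x : ℝ}
    (hx : 1 - b * x ≠ 0) (h1 : ∀ j, lat q t ν j - b * x ≠ 0)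
    (h2 : ∀ j, t * lat q t ν j - b * x ≠ 0) :
    leftFactor q t b ν (q * x) * (1 - q * x) = leftFactor q t b ν x * (1 - b * x) *
      ∏ j, (t * lat q t ν j - b * x) / (t * (lat q t ν j - b * x)) := by
  have h3 : ∏ j, (t ^ ν j)⁻¹ * (qProd q (b * (q * x) / lat q t ν j) /
      qProd q (b * (q * x) / (t * lat q t ν j))) = (∏ j, (t ^ ν j)⁻¹ *
      (qProd q (b * x / lat q t ν j) / qProd q (b * x / (t * lat q t ν j)))) *
      ∏ j, (t * lat q t ν j - b * x) / (t * (lat q t ν j - b * x)) := by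
    rw [← Finset.prod_mul_distrib]
    refine Finset.prod_congr rfl fun j _ => ?_
    rw [mul_left_comm, qProd_div_qProd_mul_left hq0 hq1 ht (lat_pos hq0 ht ν j).ne' (h1 j) (h2 j),
      mul_assoc]
  rw [leftFactor, leftFactor, h3, qProd_eq_mul hq0 hq1 (q * x), qProd_eq_mul hq0 hq1 (b * x),
    mul_left_comm b]
  generalize 1 - b * x = c at *
  generalize (∏ j : Fin n, _ : ℝ) = P
  generalize (∏ j : Fin n, _ : ℝ) = Q
  field_simp

theorem rightFactor_mul (hq0 : 0 < q) (hq1 : q < 1) (ht : 0 < t) (η : Fin k → ℕ) {y : ℝ}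
    (hy : y ≠ 0) (m : ℕ) (hv : 1 - v * y ≠ 0) (h1 : ∀ i, q * y - b * lat q t η i ≠ 0)
    (h2 : ∀ i, t * (q * y) - b * lat q t η i ≠ 0) :
    rightFactor q t b B v η (q * y) (m + 1) * ((1 - q * y) *
      ∏ i, (t * (q * y) - b * lat q t η i) / (q * y - b * lat q t η i)) =
      B * (1 - v * y) * rightFactor q t b B v η y m := by
  have h3 : (∏ i, (t ^ (m + 1))⁻¹ * (qProd q (b * lat q t η i / (q * y)) /
      qProd q (b * lat q t η i / (t * (q * y))))) *
      ∏ i, (t * (q * y) - b * lat q t η i) / (q * y - b * lat q t η i) = ∏ i, (t ^ m)⁻¹ *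
      (qProd q (b * lat q t η i / y) / qProd q (b * lat q t η i / (t * y))) := by
    rw [← Finset.prod_mul_distrib]
    refine Finset.prod_congr rfl fun i _ => ?_
    have h4 := qProd_div_qProd_mul_left hq0 hq1 ht (mul_ne_zero hq0.ne' hy) (h1 i) (h2 i)
    have h5 := h1 i
    have h6 := h2 i
    rw [show q * (b * lat q t η i) / (q * y) = b * lat q t η i / y by field_simp,
      show q * (b * lat q t η i) / (t * (q * y)) = b * lat q t η i / (t * y) by field_simp] at h4
    rw [h4]
    generalize q * y - b * lat q t η i = a at *
    generalize t * (q * y) - b * lat q t η i = c at *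
    field_simp
    ring
  rw [rightFactor, rightFactor, ← h3, qProd_eq_mul hq0 hq1 (q * y), qProd_eq_mul hq0 hq1 (v * y),
    mul_left_comm v]
  generalize 1 - v * y = c at *
  generalize (∏ i : Fin k, _ : ℝ) = P
  generalize (∏ i : Fin k, _ : ℝ) = Q
  field_simp
  ring

end factors

theorem LatGeneric.mul_lat_ne {q t b : ℝ} (hq0 : 0 < q) (ht : 0 < t) (h : LatGeneric q t b)
    {k : ℕ} (η : Fin k → ℕ) (i : Fin k) (m l : ℤ) : t ^ m * q ^ l ≠ b * lat q t η i := by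
  intro h0
  refine h ((i.rev : ℕ) - m) (η i - l) ?_
  rw [zpow_sub₀ ht.ne', zpow_sub₀ hq0.ne', zpow_natCast, zpow_natCast]
  have h1 : t ^ m ≠ 0 := (zpow_pos ht m).ne'
  have h2 : q ^ l ≠ 0 := (zpow_pos hq0 l).ne'
  rw [lat] at h0
  generalize t ^ m = a at *
  generalize q ^ l = c at *
  field_simp
  linarith

theorem LatGeneric.one_sub_ne {q t b : ℝ} (hq0 : 0 < q) (ht : 0 < t) (h : LatGeneric q t b)
    {k : ℕ} (η : Fin k → ℕ) (i : Fin k) : 1 - b * lat q t η i ≠ 0 := by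
  have := h.mul_lat_ne hq0 ht η i 0 0
  rw [zpow_zero, zpow_zero, one_mul] at this
  exact sub_ne_zero.2 this

theorem LatGeneric.sub_ne {q t b : ℝ} (hq0 : 0 < q) (ht : 0 < t) (h : LatGeneric q t b)
    {k n : ℕ} (η : Fin k → ℕ) (ν : Fin n → ℕ) (i : Fin k) (j : Fin n) :
    lat q t ν j - b * lat q t η i ≠ 0 := by
  have := h.mul_lat_ne hq0 ht η i (j.rev : ℕ) (ν j : ℕ)
  rw [zpow_natCast, zpow_natCast, mul_comm] at this
  exact sub_ne_zero.2 this

theorem LatGeneric.mul_sub_ne {q t b : ℝ} (hq0 : 0 < q) (ht : 0 < t) (h : LatGeneric q t b)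
    {k n : ℕ} (η : Fin k → ℕ) (ν : Fin n → ℕ) (i : Fin k) (j : Fin n) :
    t * lat q t ν j - b * lat q t η i ≠ 0 := by
  have := h.mul_lat_ne hq0 ht η i ((j.rev : ℕ) + 1 : ℕ) (ν j : ℕ)
  rw [zpow_natCast, zpow_natCast, pow_succ', mul_assoc, mul_comm (t ^ _)] at this
  exact sub_ne_zero.2 this

theorem LatGeneric.sourceGeneric {q t b : ℝ} (hq0 : 0 < q) (hq1 : q < 1) (ht : 0 < t) (ht1 : t < 1)
    (h : LatGeneric q t b) (hb : b ≠ 0) {k n : ℕ} {η : Fin k → ℕ} {ν : Fin n → ℕ}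
    (hη : Antitone η) (hν : Antitone ν) :
    SourceGeneric t (fun i => b * lat q t η i) (lat q t ν) where
  injX := (mul_right_injective₀ hb).comp (lat_injective hq0 hq1 ht ht1 hη)
  injY := lat_injective hq0 hq1 ht ht1 hν
  neX i := mul_ne_zero hb (lat_pos hq0 ht η i).ne'
  neY j := (lat_pos hq0 ht ν j).ne'
  sub_ne i j := h.sub_ne hq0 ht η ν i j
  mul_sub_ne i j := h.mul_sub_ne hq0 ht η ν i j

theorem LatGeneric.dual {q t b : ℝ} (hq0 : 0 < q) (ht : 0 < t) (h : LatGeneric q t b) (hb : b ≠ 0) :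
    LatGeneric q t (t * q / b) := by
  intro m l h0
  refine h (-(m + 1)) (-(l + 1)) ?_
  rw [zpow_neg, zpow_neg, zpow_add_one₀ ht.ne', zpow_add_one₀ hq0.ne']
  have h1 : t ^ m ≠ 0 := (zpow_pos ht m).ne'
  have h2 : q ^ l ≠ 0 := (zpow_pos hq0 l).ne'
  generalize t ^ m = a at *
  generalize q ^ l = c at *
  field_simp at h0 ⊢
  linarith

/-- The part of the summand depending on the first partition. -/
noncomputable def leftWeight {k n : ℕ} (q t b : ℝ) (ν : Fin n → ℕ) (η : Fin k → ℕ) : ℝ :=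
  latDelta q t η * ∏ i, leftFactor q t b ν (lat q t η i)

/-- The part of the summand depending on the second partition. -/
noncomputable def rightWeight {k n : ℕ} (q t b B v : ℝ) (η : Fin k → ℕ) (ν : Fin n → ℕ) : ℝ :=
  latDelta q t ν * ∏ j, rightFactor q t b B v η (lat q t ν j) (ν j)

section weights

variable {k n : ℕ} {q t b B v : ℝ}

theorem leftWeight_sub_inc (hq0 : 0 < q) (hq1 : q < 1) (ht : 0 < t) (ht1 : t < 1)
    (hb : LatGeneric q t b) (ν : Fin n → ℕ) {η : Fin k → ℕ} {I : Finset (Fin k)}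
    (hI : inc I ≤ η) :
    leftWeight q t b ν η * vdmRatio t⁻¹ (lat q t η) I * ∏ i ∈ I, (1 - lat q t η i) =
      leftWeight q t b ν (η - inc I) * vdmRatio t (lat q t (η - inc I)) I *
        ∏ i ∈ I, (t ^ n)⁻¹ * ((1 - b * lat q t (η - inc I) i) *
          ∏ j, (t * lat q t ν j - b * lat q t (η - inc I) i) /
            (lat q t ν j - b * lat q t (η - inc I) i)) := by
  have h1 := latDelta_sub_inc hq0 hq1 ht ht1 hI
  have h2 : (∏ i, leftFactor q t b ν (lat q t η i)) * ∏ i ∈ I, (1 - lat q t η i) =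
      (∏ i, leftFactor q t b ν (lat q t (η - inc I) i)) *
        ∏ i ∈ I, (t ^ n)⁻¹ * ((1 - b * lat q t (η - inc I) i) *
          ∏ j, (t * lat q t ν j - b * lat q t (η - inc I) i) /
            (lat q t ν j - b * lat q t (η - inc I) i)) := by
    rw [← Fintype.prod_ite_mem I, ← Fintype.prod_ite_mem I, ← Finset.prod_mul_distrib,
      ← Finset.prod_mul_distrib]
    refine Finset.prod_congr rfl fun i _ => ?_
    split_ifs with hi
    · rw [lat_sub_inc_of_mem hI hi, leftFactor_mul hq0 hq1 ht ν (hb.one_sub_ne hq0 ht _ i)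
        (fun j => hb.sub_ne hq0 ht _ ν i j) fun j => hb.mul_sub_ne hq0 ht _ ν i j]
      have h3 : (t ^ n)⁻¹ = ∏ _j : Fin n, t⁻¹ := by simp
      rw [h3, mul_left_comm _ (1 - _), ← Finset.prod_mul_distrib, mul_assoc]
      congr 2
      refine Finset.prod_congr rfl fun j _ => ?_
      rw [div_mul_eq_div_div_swap, div_eq_mul_inv _ t, mul_comm]
    · rw [lat_sub_inc_of_notMem hi]
  rw [leftWeight, leftWeight]
  linear_combination (latDelta q t η * vdmRatio t⁻¹ (lat q t η) I) * h2 -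
    ((∏ i, leftFactor q t b ν (lat q t (η - inc I) i)) *
        ∏ i ∈ I, (t ^ n)⁻¹ * ((1 - b * lat q t (η - inc I) i) *
          ∏ j, (t * lat q t ν j - b * lat q t (η - inc I) i) /
            (lat q t ν j - b * lat q t (η - inc I) i))) * h1

theorem rightWeight_sub_inc (hq0 : 0 < q) (hq1 : q < 1) (ht : 0 < t) (ht1 : t < 1)
    (hb : LatGeneric q t b) (hv : LatGeneric q t v) (η : Fin k → ℕ) {ν : Fin n → ℕ}
    {J : Finset (Fin n)} (hJ : inc J ≤ ν) :
    rightWeight q t b B v η ν * vdmRatio t⁻¹ (lat q t ν) J * ∏ j ∈ J, ((1 - lat q t ν j) *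
      ∏ i, (t * lat q t ν j - b * lat q t η i) / (lat q t ν j - b * lat q t η i)) =
      rightWeight q t b B v η (ν - inc J) * vdmRatio t (lat q t (ν - inc J)) J *
        ∏ j ∈ J, B * (1 - v * lat q t (ν - inc J) j) := by
  have h1 := latDelta_sub_inc hq0 hq1 ht ht1 hJ
  have h2 : (∏ j, rightFactor q t b B v η (lat q t ν j) (ν j)) *
      ∏ j ∈ J, ((1 - lat q t ν j) *
        ∏ i, (t * lat q t ν j - b * lat q t η i) / (lat q t ν j - b * lat q t η i)) =
      (∏ j, rightFactor q t b B v η (lat q t (ν - inc J) j) ((ν - inc J) j)) *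
        ∏ j ∈ J, B * (1 - v * lat q t (ν - inc J) j) := by
    rw [← Fintype.prod_ite_mem J, ← Fintype.prod_ite_mem J, ← Finset.prod_mul_distrib,
      ← Finset.prod_mul_distrib]
    refine Finset.prod_congr rfl fun j _ => ?_
    split_ifs with hj
    · have h3 : ν j = (ν - inc J) j + 1 := by
        have := hJ j
        simp only [inc, hj, if_true, Pi.sub_apply] at this ⊢
        omega
      have h4 := hb.sub_ne hq0 ht η ν (j := j)
      have h5 := hb.mul_sub_ne hq0 ht η ν (j := j)
      rw [lat_sub_inc_of_mem hJ hj] at h4 h5 ⊢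
      rw [h3, rightFactor_mul hq0 hq1 ht η (lat_pos hq0 ht _ j).ne' _ (hv.one_sub_ne hq0 ht _ j)
        h4 h5, mul_comm]
    · rw [lat_sub_inc_of_notMem hj, show (ν - inc J) j = ν j by simp [inc, hj]]
  rw [rightWeight, rightWeight]
  linear_combination (latDelta q t ν * vdmRatio t⁻¹ (lat q t ν) J) * h2 -
    ((∏ j, rightFactor q t b B v η (lat q t (ν - inc J) j) ((ν - inc J) j)) *
        ∏ j ∈ J, B * (1 - v * lat q t (ν - inc J) j)) * h1

end weights

theorem coeffSummable_mul_X_pow_sum {k : ℕ} (g : (Fin k → ℕ) → PowerSeries ℝ) :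
    CoeffSummable fun η => g η * PowerSeries.X ^ (∑ i, η i) := fun m => by
  refine summable_of_hasFiniteSupport ((Set.finite_Iic fun _ : Fin k => m).subset fun η hη i => ?_)
  rw [Function.mem_support, PowerSeries.coeff_mul_X_pow', ne_eq, ite_eq_right_iff,
    Classical.not_imp] at hη
  exact (Finset.single_le_sum (fun _ _ => Nat.zero_le _) (Finset.mem_univ i)).trans hη.1

theorem prod_lat {k : ℕ} (q t : ℝ) (η : Fin k → ℕ) :
    ∏ i, lat q t η i = q ^ (∑ i, η i) * ∏ i ∈ Finset.range k, t ^ i := by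
  simp only [lat, Finset.prod_mul_distrib]
  rw [Finset.prod_pow_eq_pow_sum, prod_rev_eq_prod_range fun i => t ^ i]

section leftSum

variable {k n : ℕ} {q t b : ℝ}

/-- One term of the sum expressing the source of the first family. -/
noncomputable def leftTerm (q t b : ℝ) (c : PowerSeries ℝ) (ν : Fin n → ℕ) (I : Finset (Fin k))
    (η : Fin k → ℕ) : PowerSeries ℝ :=
  algebraMap ℝ (PowerSeries ℝ) (leftWeight q t b ν η * vdmRatio t (lat q t η) I) *
    ((∏ i ∈ I, c * algebraMap ℝ (PowerSeries ℝ) ((1 - b * lat q t η i) *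
      ∏ j, (t * lat q t ν j - b * lat q t η i) / (lat q t ν j - b * lat q t η i))) *
    ∏ i ∈ Iᶜ, (1 + c * algebraMap ℝ (PowerSeries ℝ) (t ^ k / t * (b * lat q t η i)))) *
    PowerSeries.X ^ (∑ i, η i)

theorem sum_leftTerm (hb : b ≠ 0) (c : PowerSeries ℝ) (ν : Fin n → ℕ) (η : Fin k → ℕ) :
    ∑ I, leftTerm q t b c ν I η = algebraMap ℝ (PowerSeries ℝ) (leftWeight q t b ν η) *
      sourceLeft t c (fun i => b * lat q t η i) (lat q t ν) * PowerSeries.X ^ (∑ i, η i) := by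
  rw [sourceLeft, stepSum, Finset.mul_sum, Finset.sum_mul]
  refine Finset.sum_congr rfl fun I _ => ?_
  rw [leftTerm, vdmRatio_mul_left t hb, map_mul, mul_assoc (algebraMap ℝ _ _)]

open Classical in

theorem leftWeight_mul_step (hq0 : 0 < q) (hq1 : q < 1) (ht : 0 < t) (ht1 : t < 1)
    (hb : LatGeneric q t b) {c : PowerSeries ℝ}
    (hc : c * algebraMap ℝ (PowerSeries ℝ) (t ^ n) = -PowerSeries.X)
    (ν : Fin n → ℕ) (I : Finset (Fin k)) (η : Fin k → ℕ) :
    algebraMap ℝ (PowerSeries ℝ) (leftWeight q t b ν η) * PowerSeries.X ^ (∑ i, η i) *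
      (algebraMap ℝ (PowerSeries ℝ) (vdmRatio t⁻¹ (lat q t η) I) *
        ((∏ i ∈ I, (-1 + 1 * algebraMap ℝ (PowerSeries ℝ) (lat q t η i))) *
          ∏ i ∈ Iᶜ, (1 + c * algebraMap ℝ (PowerSeries ℝ) (t ^ k / t * b) *
            algebraMap ℝ (PowerSeries ℝ) (lat q t η i)))) =
      if inc I ≤ η then leftTerm q t b c ν I (η - inc I) else 0 := by
  have h1 : ∏ i ∈ I, (-1 + 1 * algebraMap ℝ (PowerSeries ℝ) (lat q t η i)) =
      (∏ _i ∈ I, (-1 : PowerSeries ℝ)) *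
        algebraMap ℝ (PowerSeries ℝ) (∏ i ∈ I, (1 - lat q t η i)) := by
    rw [map_prod, ← Finset.prod_mul_distrib]
    refine Finset.prod_congr rfl fun i _ => ?_
    rw [map_sub, map_one]
    ring
  rw [h1]
  split_ifs with hI
  · have h2 := congrArg (algebraMap ℝ (PowerSeries ℝ)) (leftWeight_sub_inc hq0 hq1 ht ht1 hb ν hI)
    have h3 : (∏ _i ∈ I, (-1 : PowerSeries ℝ)) * (∏ _i ∈ I, PowerSeries.X) *
        algebraMap ℝ (PowerSeries ℝ) (∏ i ∈ I, (t ^ n)⁻¹ * ((1 - b * lat q t (η - inc I) i) *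
          ∏ j, (t * lat q t ν j - b * lat q t (η - inc I) i) /
            (lat q t ν j - b * lat q t (η - inc I) i))) =
        ∏ i ∈ I, c * algebraMap ℝ (PowerSeries ℝ) ((1 - b * lat q t (η - inc I) i) *
          ∏ j, (t * lat q t ν j - b * lat q t (η - inc I) i) /
            (lat q t ν j - b * lat q t (η - inc I) i)) := by
      rw [map_prod, ← Finset.prod_mul_distrib, ← Finset.prod_mul_distrib]
      refine Finset.prod_congr rfl fun i _ => ?_
      rw [neg_one_mul, ← hc, map_mul, mul_assoc c, ← mul_assoc (algebraMap ℝ _ (t ^ n)), ← map_mul,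
        mul_inv_cancel₀ (pow_pos ht n).ne', map_one, one_mul]
    have h4 : ∏ i ∈ Iᶜ, (1 + c * algebraMap ℝ (PowerSeries ℝ) (t ^ k / t * b) *
        algebraMap ℝ (PowerSeries ℝ) (lat q t η i)) = ∏ i ∈ Iᶜ,
        (1 + c * algebraMap ℝ (PowerSeries ℝ) (t ^ k / t * (b * lat q t (η - inc I) i))) := by
      refine Finset.prod_congr rfl fun i hi => ?_
      rw [lat_sub_inc_of_notMem (Finset.mem_compl.1 hi), mul_assoc c, ← map_mul, mul_assoc _ b]
    rw [leftTerm, ← h3, h4, prod_sub_inc_pow_sum PowerSeries.X hI]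
    rw [map_mul, map_mul, map_mul, map_mul _ (leftWeight q t b ν (η - inc I))] at h2
    rw [map_mul _ (leftWeight q t b ν (η - inc I))]
    generalize (∏ i ∈ Iᶜ, _ : PowerSeries ℝ) = P
    linear_combination (PowerSeries.X ^ (∑ i, (η - inc I) i) * (∏ _i ∈ I, PowerSeries.X) *
      (∏ _i ∈ I, (-1 : PowerSeries ℝ)) * P) * h2
  · have h2 := congrArg (algebraMap ℝ (PowerSeries ℝ))
      (latDelta_mul_vdmRatio_inv_eq_zero (q := q) ht.ne' hI)
    rw [map_mul, map_mul, map_zero] at h2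
    rw [leftWeight, map_mul]
    linear_combination (algebraMap ℝ (PowerSeries ℝ) (∏ i, leftFactor q t b ν (lat q t η i)) *
      PowerSeries.X ^ (∑ i, η i) * (∏ _i ∈ I, (-1 : PowerSeries ℝ)) *
      ∏ i ∈ Iᶜ, (1 + c * algebraMap ℝ (PowerSeries ℝ) (t ^ k / t * b) *
            algebraMap ℝ (PowerSeries ℝ) (lat q t η i))) * h2

theorem sum_left_step (hq0 : 0 < q) (hq1 : q < 1) (ht : 0 < t) (ht1 : t < 1)
    (c : PowerSeries ℝ) (ν : Fin n → ℕ) (η : Fin k → ℕ) :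
    algebraMap ℝ (PowerSeries ℝ) (leftWeight q t b ν η) * PowerSeries.X ^ (∑ i, η i) *
      (∑ I, algebraMap ℝ (PowerSeries ℝ) (vdmRatio t⁻¹ (lat q t η) I) *
        ((∏ i ∈ I, (-1 + 1 * algebraMap ℝ (PowerSeries ℝ) (lat q t η i))) *
          ∏ i ∈ Iᶜ, (1 + c * algebraMap ℝ (PowerSeries ℝ) (t ^ k / t * b) *
            algebraMap ℝ (PowerSeries ℝ) (lat q t η i)))) =
    (∏ i ∈ Finset.range k, (1 + c * algebraMap ℝ (PowerSeries ℝ) (t ^ k / t * b * t ^ i))) *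
      PowerSeries.rescale q (algebraMap ℝ (PowerSeries ℝ) (leftWeight q t b ν η) *
        PowerSeries.X ^ (∑ i, η i)) := by
  by_cases hη : Antitone η
  swap
  · simp [leftWeight, latDelta_of_not_antitone hη]
  rw [sum_vdmRatio_linear_bot _ (lat_injective hq0 hq1 ht ht1 hη) _ _ _ _ (by ring), prod_lat,
    map_mul, map_prod, mul_assoc (algebraMap ℝ _ _) (∏ i ∈ _, _), ← Finset.prod_mul_distrib,
    map_mul (PowerSeries.rescale q), map_pow (PowerSeries.rescale q), PowerSeries.rescale_X,
    show algebraMap ℝ (PowerSeries ℝ) = PowerSeries.C from rfl, rescale_C, mul_pow, map_pow]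
  have h1 : ∏ i ∈ Finset.range k, PowerSeries.C (t ^ i) *
      (c * PowerSeries.C (t ^ k / t * b) + PowerSeries.C (t⁻¹ ^ i) * 1) =
      ∏ i ∈ Finset.range k, (1 + c * PowerSeries.C (t ^ k / t * b * t ^ i)) := by
    refine Finset.prod_congr rfl fun i _ => ?_
    have h2 : (PowerSeries.C (t ^ i) * PowerSeries.C (t⁻¹ ^ i) : PowerSeries ℝ) = 1 := by
      rw [← map_mul, ← mul_pow, mul_inv_cancel₀ ht.ne', one_pow, map_one]
    rw [map_mul _ _ (t ^ i)]
    linear_combination h2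
  rw [h1]
  ring

theorem prod_mul_rescale_coeffSum_left (hq0 : 0 < q) (hq1 : q < 1) (ht : 0 < t) (ht1 : t < 1)
    (hb : LatGeneric q t b) (hb0 : b ≠ 0) {c : PowerSeries ℝ}
    (hc : c * algebraMap ℝ (PowerSeries ℝ) (t ^ n) = -PowerSeries.X) (ν : Fin n → ℕ) :
    (∏ i ∈ Finset.range k, (1 + c * algebraMap ℝ (PowerSeries ℝ) (t ^ k / t * b * t ^ i))) *
      PowerSeries.rescale q (coeffSum fun η : Fin k → ℕ =>
        algebraMap ℝ (PowerSeries ℝ) (leftWeight q t b ν η) * PowerSeries.X ^ (∑ i, η i)) =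
      coeffSum fun η : Fin k → ℕ => algebraMap ℝ (PowerSeries ℝ) (leftWeight q t b ν η) *
        sourceLeft t c (fun i => b * lat q t η i) (lat q t ν) * PowerSeries.X ^ (∑ i, η i) := by
  classical
  have h1 (η : Fin k → ℕ) : PowerSeries.rescale q (algebraMap ℝ (PowerSeries ℝ)
      (leftWeight q t b ν η) * PowerSeries.X ^ (∑ i, η i)) =
      PowerSeries.C (leftWeight q t b ν η * q ^ (∑ i, η i)) * PowerSeries.X ^ (∑ i, η i) := by
    rw [map_mul, map_pow, PowerSeries.rescale_X,
      show algebraMap ℝ (PowerSeries ℝ) = PowerSeries.C from rfl, rescale_C, mul_pow, map_mul,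
      map_pow, mul_assoc]
  have h2 (I : Finset (Fin k)) : CoeffSummable (leftTerm q t b c ν I) :=
    coeffSummable_mul_X_pow_sum _
  have h3 : CoeffSummable fun η : Fin k → ℕ => PowerSeries.rescale q
      (algebraMap ℝ (PowerSeries ℝ) (leftWeight q t b ν η) * PowerSeries.X ^ (∑ i, η i)) := by
    simp only [h1]
    exact coeffSummable_mul_X_pow_sum _
  rw [← coeffSum_rescale, ← h3.coeffSum_mul]
  simp only [← sum_left_step hq0 hq1 ht ht1, ← sum_leftTerm hb0, Finset.mul_sum,
    leftWeight_mul_step hq0 hq1 ht ht1 hb hc]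
  rw [coeffSum_sum fun I _ => ((h2 I).shift (inc I)).1, coeffSum_sum fun I _ => h2 I]
  exact Finset.sum_congr rfl fun I _ => ((h2 I).shift (inc I)).2

end leftSum

/-- The summand of the `sl(3)` `q`-Selberg sum, without the powers of `q ^ α₁`. -/
noncomputable def pairWeight {k n : ℕ} (q t b B v : ℝ) (η : Fin k → ℕ) (ν : Fin n → ℕ) : ℝ :=
  latDelta q t η * latDelta q t ν * (∏ i, qProd q (q * lat q t η i) / qProd q (b * lat q t η i)) *
    (∏ j, B ^ ν j * (qProd q (q * lat q t ν j) / qProd q (v * lat q t ν j))) *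
    ∏ i, ∏ j, (t ^ ν j)⁻¹ * (qProd q (b * lat q t η i / lat q t ν j) /
      qProd q (b * lat q t η i / (t * lat q t ν j)))

section pairWeight

variable {k n : ℕ} {q t b B v : ℝ}

theorem pairWeight_eq_left (η : Fin k → ℕ) (ν : Fin n → ℕ) : pairWeight q t b B v η ν =
    (latDelta q t ν * ∏ j, B ^ ν j * (qProd q (q * lat q t ν j) / qProd q (v * lat q t ν j))) *
      leftWeight q t b ν η := by
  simp only [pairWeight, leftWeight, leftFactor, Finset.prod_mul_distrib]
  ring

theorem pairWeight_eq_right (η : Fin k → ℕ) (ν : Fin n → ℕ) : pairWeight q t b B v η ν =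
    (latDelta q t η * ∏ i, qProd q (q * lat q t η i) / qProd q (b * lat q t η i)) *
      rightWeight q t b B v η ν := by
  rw [pairWeight, rightWeight, Finset.prod_comm]
  simp only [rightFactor, Finset.prod_mul_distrib]
  ring

/-- The generating series of `pairWeight` over the first partition. -/
noncomputable def pairSeries (k : ℕ) (q t b B v : ℝ) (ν : Fin n → ℕ) : PowerSeries ℝ :=
  coeffSum fun η : Fin k → ℕ =>
    algebraMap ℝ (PowerSeries ℝ) (pairWeight q t b B v η ν) * PowerSeries.X ^ (∑ i, η i)

theorem pairSeries_supported : AntitoneSupported (pairSeries (n := n) k q t b B v) := by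
  intro ν hν
  ext m
  simp [pairSeries, coeffSum, pairWeight, latDelta_of_not_antitone hν]

open Classical in

theorem rightWeight_mul_step (hq0 : 0 < q) (hq1 : q < 1) (ht : 0 < t) (ht1 : t < 1)
    (hb : LatGeneric q t b) (hv : LatGeneric q t v) {c : PowerSeries ℝ}
    (hc : c * algebraMap ℝ (PowerSeries ℝ) (t ^ n) = -PowerSeries.X) (η : Fin k → ℕ)
    (ν : Fin n → ℕ) (J : Finset (Fin n)) :
    algebraMap ℝ (PowerSeries ℝ) (rightWeight q t b B v η ν) *
      (algebraMap ℝ (PowerSeries ℝ) (vdmRatio t⁻¹ (lat q t ν) J) *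
        ((∏ j ∈ J, c * algebraMap ℝ (PowerSeries ℝ) (t ^ n / t * (1 - lat q t ν j) *
            ∏ i, (t * lat q t ν j - b * lat q t η i) / (lat q t ν j - b * lat q t η i))) *
          ∏ j ∈ Jᶜ, (1 + c * algebraMap ℝ (PowerSeries ℝ) (t ^ k * lat q t ν j)))) =
      if inc J ≤ ν then
        stepWeight t (PowerSeries.C (B / t) * PowerSeries.X)
          (PowerSeries.C (t ^ k / t ^ n) * PowerSeries.X) (PowerSeries.C v)
          (lat q t (ν - inc J)) J *
          algebraMap ℝ (PowerSeries ℝ) (rightWeight q t b B v η (ν - inc J)) else 0 := by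
  have h1 : ∏ j ∈ J, c * algebraMap ℝ (PowerSeries ℝ) (t ^ n / t * (1 - lat q t ν j) *
      ∏ i, (t * lat q t ν j - b * lat q t η i) / (lat q t ν j - b * lat q t η i)) =
      (∏ _j ∈ J, -(PowerSeries.C t⁻¹ * PowerSeries.X)) * algebraMap ℝ (PowerSeries ℝ)
        (∏ j ∈ J, ((1 - lat q t ν j) *
          ∏ i, (t * lat q t ν j - b * lat q t η i) / (lat q t ν j - b * lat q t η i))) := by
    rw [map_prod, ← Finset.prod_mul_distrib]
    refine Finset.prod_congr rfl fun j _ => ?_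
    rw [mul_assoc, map_mul, div_eq_mul_inv, map_mul, ← mul_assoc, ← mul_assoc, hc,
      show algebraMap ℝ (PowerSeries ℝ) = PowerSeries.C from rfl]
    ring
  rw [h1]
  split_ifs with hJ
  · have h2 := congrArg (algebraMap ℝ (PowerSeries ℝ))
      (rightWeight_sub_inc (B := B) hq0 hq1 ht ht1 hb hv η hJ)
    have h3 : (∏ _j ∈ J, -(PowerSeries.C t⁻¹ * PowerSeries.X)) * algebraMap ℝ (PowerSeries ℝ)
        (∏ j ∈ J, B * (1 - v * lat q t (ν - inc J) j)) =
        ∏ j ∈ J, -(PowerSeries.C (B / t) * PowerSeries.X) *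
          (1 - PowerSeries.C v * algebraMap ℝ (PowerSeries ℝ) (lat q t (ν - inc J) j)) := by
      rw [map_prod, ← Finset.prod_mul_distrib]
      refine Finset.prod_congr rfl fun j _ => ?_
      rw [map_mul, map_sub, map_one, map_mul, div_eq_mul_inv, map_mul,
        show algebraMap ℝ (PowerSeries ℝ) = PowerSeries.C from rfl]
      ring
    have h4 : ∏ j ∈ Jᶜ, (1 + c * algebraMap ℝ (PowerSeries ℝ) (t ^ k * lat q t ν j)) =
        ∏ j ∈ Jᶜ, (1 - PowerSeries.C (t ^ k / t ^ n) * PowerSeries.X *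
          algebraMap ℝ (PowerSeries ℝ) (lat q t (ν - inc J) j)) := by
      refine Finset.prod_congr rfl fun j hj => ?_
      rw [lat_sub_inc_of_notMem (Finset.mem_compl.1 hj),
        show t ^ k * lat q t ν j = t ^ n * (t ^ k / t ^ n * lat q t ν j) by field_simp, map_mul,
        ← mul_assoc, hc, map_mul, show algebraMap ℝ (PowerSeries ℝ) = PowerSeries.C from rfl]
      ring
    rw [stepWeight, ← h3, h4]
    rw [map_mul, map_mul, map_mul, map_mul _ (rightWeight q t b B v η (ν - inc J))] at h2
    generalize (∏ j ∈ Jᶜ, _ : PowerSeries ℝ) = P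
    linear_combination ((∏ _j ∈ J, -(PowerSeries.C t⁻¹ * PowerSeries.X)) * P) * h2
  · have h2 := congrArg (algebraMap ℝ (PowerSeries ℝ))
      (latDelta_mul_vdmRatio_inv_eq_zero (q := q) ht.ne' hJ)
    rw [map_mul, map_mul, map_zero] at h2
    rw [rightWeight, map_mul, Finset.prod_mul_distrib, map_mul]
    generalize (∏ j ∈ Jᶜ, _ : PowerSeries ℝ) = P
    generalize algebraMap ℝ (PowerSeries ℝ) (∏ j : Fin n, _ : ℝ) = Q
    generalize algebraMap ℝ (PowerSeries ℝ) (∏ j ∈ J, ∏ i : Fin k, _ : ℝ) = S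
    linear_combination (P * Q * S * ∏ _j ∈ J, -(PowerSeries.C t⁻¹ * PowerSeries.X)) * h2

theorem prod_mul_pairWeight_source (hq0 : 0 < q) (hq1 : q < 1) (ht : 0 < t) (ht1 : t < 1)
    (hb : LatGeneric q t b) (hb0 : b ≠ 0) (c : PowerSeries ℝ) (η : Fin k → ℕ) (ν : Fin n → ℕ) :
    (∏ i ∈ Finset.range n, (1 + c * algebraMap ℝ (PowerSeries ℝ) (t ^ i))) *
      (algebraMap ℝ (PowerSeries ℝ) (pairWeight q t b B v η ν) *
        sourceLeft t c (fun i => b * lat q t η i) (lat q t ν)) =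
    (∏ i ∈ Finset.range k, (1 + c * algebraMap ℝ (PowerSeries ℝ) (t ^ i))) *
      (algebraMap ℝ (PowerSeries ℝ) (pairWeight q t b B v η ν) *
        sourceRight t c (fun i => b * lat q t η i) (lat q t ν)) := by
  by_cases hη : Antitone η
  swap
  · simp [pairWeight, latDelta_of_not_antitone hη]
  by_cases hν : Antitone ν
  swap
  · simp [pairWeight, latDelta_of_not_antitone hν]
  rw [mul_left_comm, mul_left_comm (∏ i ∈ Finset.range k, _), sourceLeft_mul ht c
    (hb.sourceGeneric hq0 hq1 ht ht1 hb0 hη hν)]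

open Classical in

theorem pairWeight_mul_sourceRight (hq0 : 0 < q) (hq1 : q < 1) (ht : 0 < t) (ht1 : t < 1)
    (hb : LatGeneric q t b) (hv : LatGeneric q t v) {c : PowerSeries ℝ}
    (hc : c * algebraMap ℝ (PowerSeries ℝ) (t ^ n) = -PowerSeries.X) (η : Fin k → ℕ)
    (ν : Fin n → ℕ) :
    algebraMap ℝ (PowerSeries ℝ) (pairWeight q t b B v η ν) *
      sourceRight t c (fun i => b * lat q t η i) (lat q t ν) =
      ∑ J, if inc J ≤ ν then
        stepWeight t (PowerSeries.C (B / t) * PowerSeries.X)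
          (PowerSeries.C (t ^ k / t ^ n) * PowerSeries.X) (PowerSeries.C v)
          (lat q t (ν - inc J)) J *
          algebraMap ℝ (PowerSeries ℝ) (pairWeight q t b B v η (ν - inc J)) else 0 := by
  rw [pairWeight_eq_right, map_mul, mul_assoc, sourceRight, stepSum, Finset.mul_sum]
  simp only [rightWeight_mul_step hq0 hq1 ht ht1 hb hv hc]
  rw [Finset.mul_sum]
  refine Finset.sum_congr rfl fun J _ => ?_
  rw [mul_ite, mul_zero]
  refine if_congr Iff.rfl ?_ rfl
  rw [pairWeight_eq_right, mul_left_comm, ← map_mul]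

theorem prod_mul_rescale_pairSeries (hq0 : 0 < q) (hq1 : q < 1) (ht : 0 < t) (ht1 : t < 1)
    (hb : LatGeneric q t b) (hb0 : b ≠ 0) (hv : LatGeneric q t v) {c : PowerSeries ℝ}
    (hc : c * algebraMap ℝ (PowerSeries ℝ) (t ^ n) = -PowerSeries.X) (ν : Fin n → ℕ) :
    (∏ i ∈ Finset.range n, (1 + c * algebraMap ℝ (PowerSeries ℝ) (t ^ i))) *
      ((∏ i ∈ Finset.range k, (1 + c * algebraMap ℝ (PowerSeries ℝ) (t ^ k / t * b * t ^ i))) *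
        PowerSeries.rescale q (pairSeries k q t b B v ν)) =
    (∏ i ∈ Finset.range k, (1 + c * algebraMap ℝ (PowerSeries ℝ) (t ^ i))) *
      stepAct q t (PowerSeries.C (B / t) * PowerSeries.X)
        (PowerSeries.C (t ^ k / t ^ n) * PowerSeries.X) (PowerSeries.C v)
        (pairSeries k q t b B v) ν := by
  classical
  have h1 (g : (Fin k → ℕ) → PowerSeries ℝ) :=
    (coeffSummable_mul_X_pow_sum g).coeffSum_mul
  have h2 : (∏ i ∈ Finset.range k, (1 + c * algebraMap ℝ (PowerSeries ℝ) (t ^ k / t * b * t ^ i))) *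
      PowerSeries.rescale q (pairSeries k q t b B v ν) = coeffSum fun η : Fin k → ℕ =>
        algebraMap ℝ (PowerSeries ℝ) (pairWeight q t b B v η ν) *
          sourceLeft t c (fun i => b * lat q t η i) (lat q t ν) * PowerSeries.X ^ (∑ i, η i) := by
    obtain ⟨Y, hY⟩ : ∃ Y : ℝ, ∀ η : Fin k → ℕ,
        pairWeight q t b B v η ν = Y * leftWeight q t b ν η := ⟨_, fun η => pairWeight_eq_left η ν⟩
    simp only [pairSeries, hY, map_mul (algebraMap ℝ (PowerSeries ℝ)),
      mul_assoc (algebraMap ℝ (PowerSeries ℝ) Y)]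
    rw [h1 (fun η => algebraMap ℝ (PowerSeries ℝ) (leftWeight q t b ν η)),
      h1 (fun η => algebraMap ℝ (PowerSeries ℝ) (leftWeight q t b ν η) *
        sourceLeft t c (fun i => b * lat q t η i) (lat q t ν)),
      ← prod_mul_rescale_coeffSum_left hq0 hq1 ht ht1 hb hb0 hc, map_mul,
      show algebraMap ℝ (PowerSeries ℝ) = PowerSeries.C from rfl, rescale_C, ← map_mul]
    simp only [← map_mul]
    ring
  rw [h2, ← h1]
  have h3 (η : Fin k → ℕ) :
      (∏ i ∈ Finset.range n, (1 + c * algebraMap ℝ (PowerSeries ℝ) (t ^ i))) *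
        (algebraMap ℝ (PowerSeries ℝ) (pairWeight q t b B v η ν) *
          sourceLeft t c (fun i => b * lat q t η i) (lat q t ν) * PowerSeries.X ^ (∑ i, η i)) =
      ∑ J, (if inc J ≤ ν then
        (∏ i ∈ Finset.range k, (1 + c * algebraMap ℝ (PowerSeries ℝ) (t ^ i))) *
        stepWeight t (PowerSeries.C (B / t) * PowerSeries.X)
          (PowerSeries.C (t ^ k / t ^ n) * PowerSeries.X) (PowerSeries.C v)
          (lat q t (ν - inc J)) J *
          algebraMap ℝ (PowerSeries ℝ) (pairWeight q t b B v η (ν - inc J)) else 0) *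
            PowerSeries.X ^ (∑ i, η i) := by
    rw [← mul_assoc, prod_mul_pairWeight_source hq0 hq1 ht ht1 hb hb0,
      pairWeight_mul_sourceRight hq0 hq1 ht ht1 hb hv hc, ← Finset.sum_mul, Finset.mul_sum]
    simp only [mul_ite, mul_zero, mul_assoc]
  simp only [h3]
  rw [coeffSum_sum fun J _ => coeffSummable_mul_X_pow_sum _, stepAct, Finset.mul_sum]
  refine Finset.sum_congr rfl fun J _ => ?_
  split_ifs with hJ
  · rw [pairSeries, ← mul_assoc, ← h1]
    simp only [mul_assoc]
  · ext m
    simp [coeffSum]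

end pairWeight

section initial

variable {k n : ℕ} {q t b B v : ℝ}

theorem LatGeneric.qProd_ne_zero (hq0 : 0 < q) (hq1 : q < 1) (h : LatGeneric q t b) {x : ℝ}
    (hx : ∃ m l : ℤ, x = b * t ^ m * q ^ l) : qProd q x ≠ 0 := by
  obtain ⟨m, l, rfl⟩ := hx
  refine _root_.qProd_ne_zero hq0 hq1 fun i => ?_
  rw [mul_assoc, ← zpow_natCast, ← zpow_add₀ hq0.ne']
  exact h m _

theorem prod_range_div_of_ne_zero {K : Type*} [Field K] (f : ℕ → K) (k : ℕ) (h : ∀ i, f i ≠ 0) :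
    ∏ i ∈ Finset.range k, f (i + 1) / f i = f k / f 0 := by
  induction k with
  | zero => rw [Finset.prod_range_zero, div_self (h 0)]
  | succ k ih =>
    rw [Finset.prod_range_succ, ih]
    have := h k
    field_simp

theorem prod_qProd_lat_zero (hq0 : 0 < q) (hq1 : q < 1) (ht : 0 < t) (hb : LatGeneric q t b)
    (ν : Fin n → ℕ) (j : Fin n) :
    ∏ i : Fin k, qProd q (b * lat q t 0 i / lat q t ν j) /
      qProd q (b * lat q t 0 i / (t * lat q t ν j)) =
      qProd q (b * t ^ k / (t * lat q t ν j)) / qProd q (b / (t * lat q t ν j)) := by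
  have h1 (i : ℕ) : qProd q (b * t ^ i / (t * lat q t ν j)) ≠ 0 := by
    refine hb.qProd_ne_zero hq0 hq1 ⟨i - 1 - (j.rev : ℕ), -ν j, ?_⟩
    rw [lat, zpow_sub₀ ht.ne', zpow_sub₀ ht.ne', zpow_neg]
    simp only [zpow_natCast, zpow_one]
    field_simp
  have h2 := prod_range_div_of_ne_zero _ k h1
  rw [pow_zero, mul_one] at h2
  rw [← h2, ← prod_rev_eq_prod_range fun i =>
    qProd q (b * t ^ (i + 1) / (t * lat q t ν j)) / qProd q (b * t ^ i / (t * lat q t ν j))]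
  refine Finset.prod_congr rfl fun i _ => ?_
  congr 2
  · simp only [lat, Pi.zero_apply, pow_zero, one_mul]
    rw [pow_succ]
    field_simp
  · simp only [lat, Pi.zero_apply, pow_zero, one_mul]

/-- Reflection of a quotient of shifted `q`-products. -/
theorem qProd_reflect (hq0 : 0 < q) (hq1 : q < 1) {w T : ℝ} (hw : w ≠ 0) (hT : T ≠ 0)
    (h : ∀ l : ℤ, w * q ^ l ≠ 1) (m : ℕ) :
    (T ^ m)⁻¹ * (qProd q (T * (q / w) / q ^ m) / qProd q (q / w / q ^ m)) / qProd q (w * q ^ m) =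
      (∏ i ∈ Finset.range m, (1 - w / T * q ^ i)) *
        (qProd q (T * (q / w)) / qProd q (q / w) / qProd q w) := by
  induction m with
  | zero => simp
  | succ m ih =>
    rw [Finset.prod_range_succ, mul_right_comm, ← ih]
    have h1 : 1 - w * q ^ m ≠ 0 := by
      have := h m
      rw [zpow_natCast] at this
      exact sub_ne_zero.2 this.symm
    have e1 (a : ℝ) : qProd q (a / q ^ (m + 1)) = (1 - a / q ^ (m + 1)) * qProd q (a / q ^ m) := by
      rw [qProd_eq_mul hq0 hq1, pow_succ]
      congr 2
      field_simp
    have e2 : qProd q (w * q ^ m) = (1 - w * q ^ m) * qProd q (w * q ^ (m + 1)) := by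
      rw [qProd_eq_mul hq0 hq1, pow_succ]
      congr 2
      ring
    have e3 : 1 - q / w / q ^ (m + 1) = -(1 - w * q ^ m) / (w * q ^ m) := by
      rw [pow_succ]
      field_simp
      ring
    have e4 : 1 - T * (q / w) / q ^ (m + 1) = -(T * (1 - w / T * q ^ m)) / (w * q ^ m) := by
      rw [pow_succ]
      field_simp
      ring
    rw [e1, e1, e2, e3, e4, pow_succ]
    generalize qProd q (T * (q / w) / q ^ m) = a1
    generalize qProd q (q / w / q ^ m) = a2
    generalize qProd q (w * q ^ (m + 1)) = a3
    generalize 1 - w * q ^ m = a4 at *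
    generalize 1 - w / T * q ^ m = a5
    field_simp

/-- The constant relating `pairWeight` at the empty first partition to `baseSol`. -/
noncomputable def initConst (k n : ℕ) (q t b v : ℝ) : ℝ :=
  latDelta q t (0 : Fin k → ℕ) *
    (∏ i ∈ Finset.range k, qProd q (q * t ^ i) / qProd q (b * t ^ i)) *
    ∏ j ∈ Finset.range n, qProd q (t ^ k * (b / (t * t ^ j))) / qProd q (b / (t * t ^ j)) /
      qProd q (v * t ^ j)

theorem pairWeight_zero_left (hq0 : 0 < q) (hq1 : q < 1) (ht : 0 < t) (hb : LatGeneric q t b)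
    (hb0 : b ≠ 0) (hv : v = t * q / b) {b' : ℝ} (hb' : 0 < n → b' = v / t ^ k) (ν : Fin n → ℕ) :
    pairWeight q t b B v (0 : Fin k → ℕ) ν = initConst k n q t b v * baseSol q t B b' ν := by
  have h1 : ∏ i : Fin k, qProd q (q * lat q t 0 i) / qProd q (b * lat q t 0 i) =
      ∏ i ∈ Finset.range k, qProd q (q * t ^ i) / qProd q (b * t ^ i) := by
    rw [← prod_rev_eq_prod_range fun i => qProd q (q * t ^ i) / qProd q (b * t ^ i)]
    simp [lat]
  have hvg : LatGeneric q t v := hv ▸ hb.dual hq0 ht hb0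
  have hv0 : v ≠ 0 := by rw [hv]; positivity
  have h2 : (∏ j, B ^ ν j * (qProd q (q * lat q t ν j) / qProd q (v * lat q t ν j))) *
      ∏ i : Fin k, ∏ j, (t ^ ν j)⁻¹ * (qProd q (b * lat q t 0 i / lat q t ν j) /
        qProd q (b * lat q t 0 i / (t * lat q t ν j))) =
      (∏ j ∈ Finset.range n, qProd q (t ^ k * (b / (t * t ^ j))) / qProd q (b / (t * t ^ j)) /
        qProd q (v * t ^ j)) * (B ^ (∑ j, ν j) * (∏ j, qProd q (q * lat q t ν j)) *
          ∏ j : Fin n, ∏ m ∈ Finset.range (ν j), (1 - b' * (t ^ (j.rev : ℕ) * q ^ m))) := by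
    rw [Finset.prod_comm, ← prod_rev_eq_prod_range fun j => qProd q (t ^ k * (b / (t * t ^ j))) /
        qProd q (b / (t * t ^ j)) / qProd q (v * t ^ j), ← Finset.prod_pow_eq_pow_sum]
    simp only [← Finset.prod_mul_distrib]
    refine Finset.prod_congr rfl fun j _ => ?_
    have hw : ∀ l : ℤ, v * t ^ (j.rev : ℕ) * q ^ l ≠ 1 := fun l => by
      have := hvg (j.rev : ℕ) l
      rwa [zpow_natCast] at this
    have h3 := qProd_reflect hq0 hq1 (mul_ne_zero hv0 (pow_pos ht _).ne') (pow_pos ht k).ne' hw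
      (ν j)
    have e1 : q / (v * t ^ (j.rev : ℕ)) = b / (t * t ^ (j.rev : ℕ)) := by
      rw [hv]
      field_simp
    have e2 : b * t ^ k / (t * lat q t ν j) = t ^ k * (b / (t * t ^ (j.rev : ℕ))) / q ^ ν j := by
      rw [lat]
      field_simp
    have e3 : b / (t * lat q t ν j) = b / (t * t ^ (j.rev : ℕ)) / q ^ ν j := by
      rw [lat]
      field_simp
    have e4 : ∏ m ∈ Finset.range (ν j), (1 - b' * (t ^ (j.rev : ℕ) * q ^ m)) =
        ∏ m ∈ Finset.range (ν j), (1 - v * t ^ (j.rev : ℕ) / t ^ k * q ^ m) := by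
      refine Finset.prod_congr rfl fun m _ => ?_
      rw [hb' (Fin.pos j)]
      ring
    rw [Finset.prod_mul_distrib, prod_qProd_lat_zero hq0 hq1 ht hb, e2, e3, e4, Finset.prod_const,
      Finset.card_univ, Fintype.card_fin, inv_pow, ← pow_mul, mul_comm (ν j), pow_mul,
      show v * lat q t ν j = v * t ^ (j.rev : ℕ) * q ^ ν j by rw [lat]; ring]
    rw [e1] at h3
    linear_combination (B ^ ν j * qProd q (q * lat q t ν j)) * h3
  rw [pairWeight, h1, mul_assoc _ (∏ j, _) (∏ i, _), h2, initConst, baseSol, finPoch, baseWeight]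
  simp only [Algebra.algebraMap_self, RingHom.id_apply]
  ring

theorem lat_zero_div_lat_zero (ht : t ≠ 0) {i j : Fin n} (hij : i < j) :
    lat q t 0 i / lat q t 0 j = t ^ ((j : ℕ) - i : ℕ) := by
  simp only [lat, Pi.zero_apply, pow_zero, one_mul]
  rw [div_eq_iff (pow_ne_zero _ ht), ← pow_add]
  congr 1
  simp only [Fin.val_rev]
  have : (i : ℕ) < j := hij
  omega

theorem pairDelta_pow_pos (hq0 : 0 < q) (hq1 : q < 1) (ht : 0 < t) (ht1 : t < 1) {d : ℕ}
    (hd : d ≠ 0) : 0 < pairDelta q t (t ^ d) := by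
  obtain ⟨d, rfl⟩ := Nat.exists_eq_succ_of_ne_zero hd
  have h1 : t ^ (d + 1) < 1 := pow_lt_one₀ ht.le ht1 d.succ_ne_zero
  have h2 : t ^ d ≤ 1 := pow_le_one₀ ht.le ht1.le
  refine div_pos (mul_pos (sub_pos.2 h1) (qProd_pos hq0 hq1 (by positivity) ?_))
    (qProd_pos hq0 hq1 (by positivity) ?_)
  · rw [pow_succ, ← mul_assoc, mul_div_cancel_right₀ _ ht.ne']
    nlinarith
  · rw [← pow_succ']
    exact pow_lt_one₀ ht.le ht1 (Nat.succ_ne_zero _)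

theorem latDelta_zero (ht : t ≠ 0) : latDelta q t (0 : Fin n → ℕ) =
    ∏ p ∈ ltPairs n, pairDelta q t (t ^ ((p.2 : ℕ) - p.1 : ℕ)) := by
  rw [latDelta_of_antitone (show Antitone (0 : Fin n → ℕ) from antitone_const)]
  refine Finset.prod_congr rfl fun p hp => ?_
  rw [Pi.zero_apply, mul_zero, pow_zero, one_mul, lat_zero_div_lat_zero ht
    (Finset.mem_filter.1 hp).2]

theorem latDelta_zero_pos (hq0 : 0 < q) (hq1 : q < 1) (ht : 0 < t) (ht1 : t < 1) :
    0 < latDelta q t (0 : Fin n → ℕ) := by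
  rw [latDelta_zero ht.ne']
  refine Finset.prod_pos fun p hp => pairDelta_pow_pos hq0 hq1 ht ht1 ?_
  have : (p.1 : ℕ) < p.2 := (Finset.mem_filter.1 hp).2
  omega

theorem initConst_ne_zero (hq0 : 0 < q) (hq1 : q < 1) (ht : 0 < t) (ht1 : t < 1)
    (hb : LatGeneric q t b) (hv : LatGeneric q t v) : initConst k n q t b v ≠ 0 := by
  refine mul_ne_zero (mul_ne_zero (latDelta_zero_pos hq0 hq1 ht ht1).ne' ?_) ?_ <;>
    refine Finset.prod_ne_zero_iff.2 fun i _ => ?_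
  · refine div_ne_zero (qProd_pos hq0 hq1 (by positivity) ?_).ne'
      (hb.qProd_ne_zero hq0 hq1 ⟨i, 0, by simp⟩)
    have : t ^ i ≤ 1 := pow_le_one₀ ht.le ht1.le
    nlinarith
  · refine div_ne_zero (div_ne_zero (hb.qProd_ne_zero hq0 hq1 ⟨k - 1 - i, 0, ?_⟩)
      (hb.qProd_ne_zero hq0 hq1 ⟨-1 - i, 0, ?_⟩)) (hv.qProd_ne_zero hq0 hq1 ⟨i, 0, by simp⟩)
    all_goals
      simp only [zpow_sub₀ ht.ne', zpow_natCast, zpow_one, zpow_neg, zpow_zero]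
      field_simp

end initial

/-- The product of the linear factors `1 - s t ^ i X` for `i < n`. -/
noncomputable def linProd (t s : ℝ) (n : ℕ) : PowerSeries ℝ :=
  ∏ i ∈ Finset.range n, (1 - PowerSeries.C (s * t ^ i) * PowerSeries.X)

theorem constantCoeff_linProd (t s : ℝ) (n : ℕ) :
    PowerSeries.constantCoeff (linProd t s n) = 1 := by
  simp [linProd, map_prod]

theorem linProd_ne_zero (t s : ℝ) (n : ℕ) : linProd t s n ≠ 0 := fun h => by
  have := constantCoeff_linProd t s n
  rw [h, map_zero] at this
  exact zero_ne_one this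

theorem linProd_swap (t s : ℝ) (k n : ℕ) :
    linProd t (s * t ^ k) n * linProd t s k = linProd t (s * t ^ n) k * linProd t s n := by
  have h (k n : ℕ) : linProd t s (k + n) = linProd t s k * linProd t (s * t ^ k) n := by
    simp only [linProd, Finset.prod_range_add, pow_add, mul_assoc]
  rw [mul_comm, ← h, mul_comm, ← h, add_comm]

section functional

variable {k n : ℕ} {q t b B v : ℝ}

theorem constantCoeff_pairSeries (ν : Fin n → ℕ) :
    PowerSeries.constantCoeff (pairSeries k q t b B v ν) =
      pairWeight q t b B v (0 : Fin k → ℕ) ν := by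
  rw [← PowerSeries.coeff_zero_eq_constantCoeff_apply, pairSeries, coeffSum, PowerSeries.coeff_mk,
    tsum_eq_single 0]
  · simp
  · intro η hη
    have : ∑ i, η i ≠ 0 := fun h => hη (funext fun i =>
      (Finset.sum_eq_zero_iff.1 h) i (Finset.mem_univ i))
    simp [this.symm]

theorem linProd_mul_rescale_pairSeries (hq0 : 0 < q) (hq1 : q < 1) (ht : 0 < t) (ht1 : t < 1)
    (hb : LatGeneric q t b) (hb0 : b ≠ 0) (hv : LatGeneric q t v) (ν : Fin n → ℕ) :
    linProd t (1 / t ^ n) n * (linProd t (t ^ k / t * b / t ^ n) k *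
      PowerSeries.rescale q (pairSeries k q t b B v ν)) =
      linProd t (1 / t ^ n) k * stepAct q t (PowerSeries.C (B / t) * PowerSeries.X)
        (PowerSeries.C (t ^ k / t ^ n) * PowerSeries.X) (PowerSeries.C v)
        (pairSeries k q t b B v) ν := by
  have hc : -(PowerSeries.C (t ^ n)⁻¹ * PowerSeries.X) * algebraMap ℝ (PowerSeries ℝ) (t ^ n) =
      -PowerSeries.X := by
    rw [neg_mul, mul_right_comm, show algebraMap ℝ (PowerSeries ℝ) = PowerSeries.C from rfl,
      ← map_mul, inv_mul_cancel₀ (pow_pos ht n).ne', map_one, one_mul]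
  have e (a : ℝ) : 1 + -(PowerSeries.C (t ^ n)⁻¹ * PowerSeries.X) *
      algebraMap ℝ (PowerSeries ℝ) a = 1 - PowerSeries.C (a / t ^ n) * PowerSeries.X := by
    rw [show algebraMap ℝ (PowerSeries ℝ) = PowerSeries.C from rfl, div_eq_mul_inv, map_mul]
    ring
  have h := prod_mul_rescale_pairSeries (k := k) (B := B) hq0 hq1 ht ht1 hb hb0 hv hc ν
  simp only [e] at h
  simp only [linProd, div_mul_eq_mul_div, one_mul] at h ⊢
  exact h

theorem functional_equation (hq0 : 0 < q) (hq1 : q < 1) (ht : 0 < t) (ht1 : t < 1) (hB : 0 < B)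
    (hB1 : B < 1) (hb : LatGeneric q t b) (hb0 : b ≠ 0) (hv : v = t * q / b) :
    CoeffSummable (pairSeries (n := n) k q t b B v) ∧
      linProd t (B / t * t ^ n) k * linProd t (t ^ k / t * b / t ^ n) k *
        PowerSeries.rescale q (coeffSum (pairSeries (n := n) k q t b B v)) =
      linProd t 1 k * linProd t (B / t) k * coeffSum (pairSeries (n := n) k q t b B v) := by
  have hvg : LatGeneric q t v := hv ▸ hb.dual hq0 ht hb0
  have hK := initConst_ne_zero (k := k) (n := n) hq0 hq1 ht ht1 hb hvg
  have hI : linProd t (1 / t ^ n) k * (linProd t (1 / t ^ n) k)⁻¹ = 1 :=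
    PowerSeries.mul_inv_cancel _ (by rw [constantCoeff_linProd]; exact one_ne_zero)
  have hI' : PowerSeries.constantCoeff (linProd t (1 / t ^ n) k)⁻¹ = 1 := by
    have := congrArg PowerSeries.constantCoeff hI
    rwa [map_mul, constantCoeff_linProd, one_mul, map_one] at this
  obtain ⟨g, hg1, hg⟩ := exists_rescale_eq_mul hq0 hq1 (h := linProd t (1 / t ^ n) n *
    linProd t (t ^ k / t * b / t ^ n) k * (linProd t (1 / t ^ n) k)⁻¹) (by
      rw [map_mul, map_mul, constantCoeff_linProd, constantCoeff_linProd, hI', one_mul, one_mul])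
  have hgI : g * g⁻¹ = 1 := PowerSeries.mul_inv_cancel _ (by rw [hg1]; exact one_ne_zero)
  generalize hKd : initConst k n q t b v = K at hK
  have hKI : (PowerSeries.C K⁻¹ * PowerSeries.C K : PowerSeries ℝ) = 1 := by
    rw [← map_mul, inv_mul_cancel₀ hK, map_one]
  obtain ⟨F, hF⟩ : ∃ F, F = pairSeries (n := n) k q t b B v := ⟨_, rfl⟩
  have hT : IsTwisted q t (PowerSeries.C (B / t) * PowerSeries.X)
      (PowerSeries.C (t ^ k / t ^ n) * PowerSeries.X) (PowerSeries.C v)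
      fun ν => (PowerSeries.C K⁻¹ * g) * F ν := by
    intro ν
    rw [stepAct_mul]
    simp only [map_mul, rescale_C, hg]
    have := linProd_mul_rescale_pairSeries (k := k) (B := B) hq0 hq1 ht ht1 hb hb0 hvg ν
    rw [← hF] at this
    linear_combination (PowerSeries.C K⁻¹ * g * (linProd t (1 / t ^ n) k)⁻¹) * this +
      (PowerSeries.C K⁻¹ * g * stepAct q t (PowerSeries.C (B / t) * PowerSeries.X)
      (PowerSeries.C (t ^ k / t ^ n) * PowerSeries.X) (PowerSeries.C v) F ν) * hI
  have hκ : v * t ^ n / (t ^ k * (B * t ^ (n - 1))) * (B * t ^ (n - 1)) * (t ^ k / t ^ n) = v := by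
    field_simp
  have hs : 0 < n → B / t * (v * t ^ n / (t ^ k * (B * t ^ (n - 1)))) = v / t ^ k := fun hn => by
    obtain ⟨n, rfl⟩ := Nat.exists_eq_succ_of_ne_zero hn.ne'
    rw [Nat.succ_sub_one, Nat.succ_eq_add_one, pow_succ]
    field_simp
  obtain ⟨h1, h2⟩ := rescale_coeffSum_of_isTwisted hq0 hq1 ht ht1 hB hB1 hκ
    (fun ν hν => by rw [hF, pairSeries_supported ν hν, mul_zero]) hT fun ν => by
      rw [map_mul, map_mul, hg1, hF, constantCoeff_pairSeries,
        pairWeight_zero_left hq0 hq1 ht hb hb0 hv hs, hKd, PowerSeries.constantCoeff_C, mul_one,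
        inv_mul_cancel_left₀ hK]
  have h3 : CoeffSummable F := by
    have h4 (ν) : PowerSeries.C K * g⁻¹ * (PowerSeries.C K⁻¹ * g * F ν) = F ν := by
      linear_combination (g * g⁻¹ * F ν) * hKI + F ν * hgI
    simpa only [h4] using h1.mul (PowerSeries.C K * g⁻¹)
  rw [h3.coeffSum_mul] at h2
  rw [← hF]
  refine ⟨h3, ?_⟩
  have e1 : ∏ i ∈ Finset.range n, (1 - PowerSeries.C (t ^ k / t ^ n * (B * t ^ (n - 1)) * t ^ i) *
      PowerSeries.X) = linProd t (B / t * t ^ k) n := by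
    refine Finset.prod_congr rfl fun i hi => ?_
    obtain ⟨n, rfl⟩ := Nat.exists_eq_succ_of_ne_zero (Nat.ne_zero_of_lt (Finset.mem_range.1 hi))
    rw [Nat.succ_sub_one, Nat.succ_eq_add_one, pow_succ t n]
    congr 3
    field_simp
  rw [e1, ← linProd, ← linProd, map_mul, map_mul, rescale_C, hg] at h2
  have e2 := linProd_swap t (1 / t ^ n) k n
  have e3 := linProd_swap t (B / t) k n
  rw [one_div_mul_cancel (pow_pos ht n).ne', one_div_mul_eq_div] at e2
  generalize PowerSeries.rescale q (coeffSum F) = RF at *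
  generalize coeffSum F = SF at *
  have h4 : linProd t (B / t * t ^ k) n * (linProd t (1 / t ^ n) n *
      linProd t (t ^ k / t * b / t ^ n) k) * RF = linProd t (1 / t ^ n) k *
      (linProd t (t ^ k / t ^ n) n * linProd t (B / t) n) * SF := by
    have hg0 : g ≠ 0 := left_ne_zero_of_mul (hgI.trans_ne one_ne_zero)
    have hK0 : PowerSeries.C K⁻¹ ≠ 0 := left_ne_zero_of_mul (hKI.trans_ne one_ne_zero)
    refine mul_left_cancel₀ (mul_ne_zero hK0 hg0) ?_
    linear_combination linProd t (1 / t ^ n) k * h2 - (linProd t (B / t * t ^ k) n *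
      PowerSeries.C K⁻¹ * linProd t (1 / t ^ n) n * linProd t (t ^ k / t * b / t ^ n) k * g * RF) *
      hI
  refine mul_left_cancel₀ (mul_ne_zero (linProd_ne_zero t (B / t) n)
    (linProd_ne_zero t (1 / t ^ n) n)) ?_
  linear_combination linProd t (B / t) k * h4 - (linProd t (1 / t ^ n) n *
    linProd t (t ^ k / t * b / t ^ n) k * RF) * e3 +
    linProd t (B / t) n * linProd t (B / t) k * SF * e2

end functional

section summability

variable {k n : ℕ} {q t b B v : ℝ}

theorem exists_qProd_lat_div_le (hq0 : 0 < q) (hq1 : q < 1) (ht : 0 < t) (ht1 : t < 1)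
    (hb : LatGeneric q t b) (i : Fin k) :
    ∃ C, 0 < C ∧ ∀ η : Fin k → ℕ, |qProd q (q * lat q t η i) / qProd q (b * lat q t η i)| ≤ C := by
  obtain ⟨c, hc, h⟩ := exists_le_abs_qProd hq0 hq1 (a := b * t ^ (i.rev : ℕ)) fun l => by
    exact_mod_cast hb (i.rev : ℕ) l
  refine ⟨1 / c, by positivity, fun η => ?_⟩
  rw [abs_div]
  refine div_le_div₀ zero_le_one (abs_qProd_mul_lat_le_one hq0 hq1 ht ht1 η i) hc ?_
  have := h (η i)
  rwa [mul_assoc, mul_comm (t ^ _)] at this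

theorem exists_cross_le (hq0 : 0 < q) (hq1 : q < 1) (ht : 0 < t) (ht1 : t < 1)
    (hb : LatGeneric q t b) (hb0 : b ≠ 0) (i : Fin k) (j : Fin n) :
    ∃ C, 0 < C ∧ ∀ (η : Fin k → ℕ) (ν : Fin n → ℕ), |qProd q (b * lat q t η i / lat q t ν j) /
      qProd q (b * lat q t η i / (t * lat q t ν j))| ≤ C := by
  have hz : b * t ^ ((i.rev : ℕ) - (j.rev : ℕ) : ℤ) ≠ 0 := by positivity
  obtain ⟨C, hC, h⟩ := exists_abs_qProd_div_le hq0 hq1 ht ht1.le hz fun l => by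
    rw [mul_div_assoc, div_eq_mul_inv (t ^ _), ← zpow_sub_one₀ ht.ne']
    exact hb _ l
  refine ⟨C, hC, fun η ν => ?_⟩
  have e : b * lat q t η i / lat q t ν j =
      b * t ^ ((i.rev : ℕ) - (j.rev : ℕ) : ℤ) * q ^ ((η i : ℤ) - ν j) := by
    simp only [lat]
    rw [zpow_sub₀ ht.ne', zpow_sub₀ hq0.ne']
    simp only [zpow_natCast]
    field_simp
  rw [mul_comm t, ← div_div, e]
  convert h (η i - ν j) using 4
  rw [div_mul_eq_mul_div]

theorem exists_pairWeight_le (hq0 : 0 < q) (hq1 : q < 1) (ht : 0 < t) (ht1 : t < 1) (hB : 0 < B)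
    (hb : LatGeneric q t b) (hb0 : b ≠ 0) (hv : LatGeneric q t v) :
    ∃ C, ∀ (η : Fin k → ℕ) (ν : Fin n → ℕ),
      |pairWeight q t b B v η ν| ≤ C * (B / t ^ k) ^ ∑ j, ν j := by
  obtain ⟨C₁, hC₁, h₁⟩ := exists_latDelta_le hq0 hq1 ht ht1 k
  obtain ⟨C₂, hC₂, h₂⟩ := exists_latDelta_le hq0 hq1 ht ht1 n
  choose C₃ hC₃ h₃ using exists_qProd_lat_div_le (k := k) hq0 hq1 ht ht1 hb
  choose C₄ hC₄ h₄ using exists_qProd_lat_div_le (k := n) hq0 hq1 ht ht1 hv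
  choose C₅ hC₅ h₅ using exists_cross_le (k := k) (n := n) hq0 hq1 ht ht1 hb hb0
  refine ⟨C₁ * C₂ * (∏ i, C₃ i) * (∏ j, C₄ j) * ∏ i, ∏ j, C₅ i j, fun η ν => ?_⟩
  have e : (C₁ * C₂ * (∏ i, C₃ i) * (∏ j, C₄ j) * ∏ i, ∏ j, C₅ i j) * (B / t ^ k) ^ ∑ j, ν j =
      C₁ * C₂ * (∏ i, C₃ i) * (∏ j, B ^ ν j * C₄ j) *
        ∏ i : Fin k, ∏ j, (t ^ ν j)⁻¹ * C₅ i j := by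
    simp only [Finset.prod_mul_distrib, Finset.prod_inv_distrib, Finset.prod_pow_eq_pow_sum,
      Finset.sum_const, smul_eq_mul, Finset.card_univ, Fintype.card_fin, div_pow, ← pow_mul]
    ring
  rw [e, pairWeight]
  simp only [abs_mul, Finset.abs_prod, abs_inv, abs_pow, abs_of_pos hB, abs_of_pos ht]
  refine mul_le_mul (mul_le_mul (mul_le_mul (mul_le_mul (h₁ η) (h₂ ν) (abs_nonneg _) hC₁.le)
    (Finset.prod_le_prod (fun _ _ => abs_nonneg _) fun i _ => h₃ i η)
    (Finset.prod_nonneg fun _ _ => abs_nonneg _) (by positivity))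
    (Finset.prod_le_prod (fun _ _ => by positivity) fun j _ => ?_)
    (Finset.prod_nonneg fun _ _ => by positivity)
    (mul_nonneg (by positivity) (Finset.prod_nonneg fun i _ => (hC₃ i).le)))
    (Finset.prod_le_prod (fun _ _ => Finset.prod_nonneg fun _ _ => by positivity) fun i _ =>
      Finset.prod_le_prod (fun _ _ => by positivity) fun j _ => ?_)
    (Finset.prod_nonneg fun _ _ => Finset.prod_nonneg fun _ _ => by positivity)
    (mul_nonneg (mul_nonneg (by positivity) (Finset.prod_nonneg fun i _ => (hC₃ i).le))
      (Finset.prod_nonneg fun j _ => mul_nonneg (by positivity) (hC₄ j).le))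
  · exact mul_le_mul_of_nonneg_left (h₄ j ν) (by positivity)
  · exact mul_le_mul_of_nonneg_left (h₅ i j η ν) (by positivity)

theorem summable_pairWeight (hq0 : 0 < q) (hq1 : q < 1) (ht : 0 < t) (ht1 : t < 1) (hB : 0 < B)
    (hB1 : B < t ^ k) (hb : LatGeneric q t b) (hb0 : b ≠ 0) (hv : LatGeneric q t v) {z : ℝ}
    (hz : |z| < 1) :
    Summable fun p : (Fin k → ℕ) × (Fin n → ℕ) =>
      pairWeight q t b B v p.1 p.2 * z ^ ∑ i, p.1 i := by
  obtain ⟨C, h⟩ := exists_pairWeight_le (k := k) (n := n) hq0 hq1 ht ht1 hB hb hb0 hv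
  have h1 := summable_pow_sum (abs_nonneg z) hz k
  have h2 := summable_pow_sum (B := B / t ^ k) (by positivity)
    ((div_lt_one (by positivity)).2 hB1) n
  refine Summable.of_norm_bounded ((h1.mul_of_nonneg h2 (fun _ => by positivity)
    fun _ => by positivity).mul_left C) fun p => ?_
  rw [Real.norm_eq_abs, abs_mul, abs_pow, mul_left_comm, mul_comm]
  exact mul_le_mul_of_nonneg_left (h _ _) (by positivity)

end summability

section evaluation

theorem HasSum.linear_mul {f : PowerSeries ℝ} {z S : ℝ}
    (h : HasSum (fun m => PowerSeries.coeff m f * z ^ m) S) (c : ℝ) :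
    HasSum (fun m => PowerSeries.coeff m ((1 - PowerSeries.C c * PowerSeries.X) * f) * z ^ m)
      ((1 - c * z) * S) := by
  have h1 : HasSum (fun m => PowerSeries.coeff m (PowerSeries.X * f) * z ^ m) (z * S) := by
    rw [← hasSum_nat_add_iff' 1]
    simp only [Finset.sum_range_one, PowerSeries.coeff_succ_X_mul, PowerSeries.coeff_zero_X_mul,
      zero_mul, sub_zero, pow_succ']
    simpa only [mul_left_comm] using h.mul_left z
  have h2 := h.sub (h1.mul_left c)
  have e : (1 - c * z) * S = S - c * (z * S) := by ring
  rw [e]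
  refine h2.congr_fun fun m => ?_
  rw [sub_mul, one_mul, map_sub, mul_assoc, PowerSeries.coeff_C_mul, sub_mul, mul_assoc]

theorem HasSum.linProd_mul {f : PowerSeries ℝ} {z S : ℝ}
    (h : HasSum (fun m => PowerSeries.coeff m f * z ^ m) S) (t s : ℝ) (n : ℕ) :
    HasSum (fun m => PowerSeries.coeff m (linProd t s n * f) * z ^ m)
      ((∏ i ∈ Finset.range n, (1 - s * t ^ i * z)) * S) := by
  induction n with
  | zero => simpa [linProd] using h
  | succ n ih =>
    have := ih.linear_mul (s * t ^ n)
    rw [linProd, Finset.prod_range_succ, Finset.prod_range_succ, ← linProd, mul_comm (linProd t s n),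
      mul_assoc, mul_comm (Finset.prod _ _), mul_assoc]
    exact this

theorem HasSum.rescale {f : PowerSeries ℝ} {q z S : ℝ}
    (h : HasSum (fun m => PowerSeries.coeff m f * (q * z) ^ m) S) :
    HasSum (fun m => PowerSeries.coeff m (PowerSeries.rescale q f) * z ^ m) S := by
  convert h using 2
  rw [PowerSeries.coeff_rescale, mul_pow]
  ring

variable {q t : ℝ}

theorem tendsto_prod_prod_linear (hq0 : 0 < q) (hq1 : q < 1) (s z : ℝ) (k : ℕ) :
    Filter.Tendsto (fun N => ∏ l ∈ Finset.range N, ∏ i ∈ Finset.range k,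
      (1 - s * t ^ i * (q ^ l * z))) Filter.atTop
      (nhds (∏ i ∈ Finset.range k, qProd q (s * t ^ i * z))) := by
  simp_rw [Finset.prod_comm (s := Finset.range _) (t := Finset.range k)]
  refine tendsto_finsetProd _ fun i _ => ?_
  convert tendsto_prod_qProd hq0 hq1 (s * t ^ i * z) using 4
  ring

theorem tsum_mul_prod_qProd (hq0 : 0 < q) (hq1 : q < 1) {f : PowerSeries ℝ} {z s₁ s₂ s₃ s₄ : ℝ}
    {k : ℕ} (hf : Summable fun m => PowerSeries.coeff m f * z ^ m)
    (h : linProd t s₁ k * linProd t s₂ k * PowerSeries.rescale q f =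
      linProd t s₃ k * linProd t s₄ k * f) :
    (∏ i ∈ Finset.range k, qProd q (s₃ * t ^ i * z)) *
        (∏ i ∈ Finset.range k, qProd q (s₄ * t ^ i * z)) *
        ∑' m, PowerSeries.coeff m f * z ^ m =
      (∏ i ∈ Finset.range k, qProd q (s₁ * t ^ i * z)) *
        (∏ i ∈ Finset.range k, qProd q (s₂ * t ^ i * z)) * PowerSeries.constantCoeff f := by
  have hb (N m : ℕ) : ‖PowerSeries.coeff m f * (q ^ N * z) ^ m‖ ≤
      ‖PowerSeries.coeff m f * z ^ m‖ := by
    rw [mul_pow, norm_mul, norm_mul, norm_mul]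
    refine mul_le_mul_of_nonneg_left (mul_le_of_le_one_left (norm_nonneg _) ?_) (norm_nonneg _)
    rw [Real.norm_of_nonneg (by positivity), ← pow_mul]
    exact pow_le_one₀ hq0.le hq1.le
  have hs (N : ℕ) : HasSum (fun m => PowerSeries.coeff m f * (q ^ N * z) ^ m)
      (∑' m, PowerSeries.coeff m f * (q ^ N * z) ^ m) :=
    (Summable.of_norm_bounded hf.norm (hb N)).hasSum
  have step (N : ℕ) : (∏ i ∈ Finset.range k, (1 - s₁ * t ^ i * (q ^ N * z))) *
      (∏ i ∈ Finset.range k, (1 - s₂ * t ^ i * (q ^ N * z))) *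
      (∑' m, PowerSeries.coeff m f * (q ^ (N + 1) * z) ^ m) =
      (∏ i ∈ Finset.range k, (1 - s₃ * t ^ i * (q ^ N * z))) *
      (∏ i ∈ Finset.range k, (1 - s₄ * t ^ i * (q ^ N * z))) *
      (∑' m, PowerSeries.coeff m f * (q ^ N * z) ^ m) := by
    have h0 := hs (N + 1)
    rw [pow_succ', mul_assoc] at h0
    have h1 := (h0.rescale.linProd_mul t s₂ k).linProd_mul t s₁ k
    have h2 := ((hs N).linProd_mul t s₄ k).linProd_mul t s₃ k
    simp only [← mul_assoc, h] at h1 h2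
    simpa only [pow_succ', mul_assoc] using h1.unique h2
  have iter (N : ℕ) : (∏ l ∈ Finset.range N, ∏ i ∈ Finset.range k,
        (1 - s₃ * t ^ i * (q ^ l * z))) *
      (∏ l ∈ Finset.range N, ∏ i ∈ Finset.range k, (1 - s₄ * t ^ i * (q ^ l * z))) *
      (∑' m, PowerSeries.coeff m f * z ^ m) =
      (∏ l ∈ Finset.range N, ∏ i ∈ Finset.range k, (1 - s₁ * t ^ i * (q ^ l * z))) *
      (∏ l ∈ Finset.range N, ∏ i ∈ Finset.range k, (1 - s₂ * t ^ i * (q ^ l * z))) *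
      (∑' m, PowerSeries.coeff m f * (q ^ N * z) ^ m) := by
    induction N with
    | zero => simp
    | succ N ih =>
      simp only [Finset.prod_range_succ _ N]
      linear_combination ((∏ i ∈ Finset.range k, (1 - s₃ * t ^ i * (q ^ N * z))) *
        ∏ i ∈ Finset.range k, (1 - s₄ * t ^ i * (q ^ N * z))) * ih -
        ((∏ l ∈ Finset.range N, ∏ i ∈ Finset.range k, (1 - s₁ * t ^ i * (q ^ l * z))) *
        ∏ l ∈ Finset.range N, ∏ i ∈ Finset.range k, (1 - s₂ * t ^ i * (q ^ l * z))) * step N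
  have lim : Filter.Tendsto (fun N : ℕ => ∑' m, PowerSeries.coeff m f * (q ^ N * z) ^ m)
      Filter.atTop (nhds (PowerSeries.constantCoeff f)) := by
    have e : PowerSeries.constantCoeff f = ∑' m, PowerSeries.coeff m f * (0 : ℝ) ^ m := by
      rw [tsum_eq_single 0 fun m hm => by rw [zero_pow hm, mul_zero], pow_zero, mul_one,
        PowerSeries.coeff_zero_eq_constantCoeff_apply]
    rw [e]
    refine tendsto_tsum_of_dominated_convergence hf.norm (fun m => ?_) (.of_forall hb)
    have h0 := (tendsto_pow_atTop_nhds_zero_of_lt_one hq0.le hq1).mul_const z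
    rw [zero_mul] at h0
    exact (h0.pow m).const_mul _
  refine tendsto_nhds_unique (l := (Filter.atTop : Filter ℕ)) ?_
    (((tendsto_prod_prod_linear hq0 hq1 s₁ z k).mul
      (tendsto_prod_prod_linear hq0 hq1 s₂ z k)).mul lim)
  simp only [← iter]
  exact ((tendsto_prod_prod_linear hq0 hq1 s₃ z k).mul
    (tendsto_prod_prod_linear hq0 hq1 s₄ z k)).mul_const _

end evaluation

section fubini

variable {ι : Type*} {k : ℕ}

theorem hasSum_coeff_coeffSum {w : (Fin k → ℕ) → ι → ℝ} {z S : ℝ}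
    (h : HasSum (fun p : (Fin k → ℕ) × ι => w p.1 p.2 * z ^ ∑ i, p.1 i) S) :
    HasSum (fun m => PowerSeries.coeff m (coeffSum fun ν => coeffSum fun η : Fin k → ℕ =>
      algebraMap ℝ (PowerSeries ℝ) (w η ν) * PowerSeries.X ^ ∑ i, η i) * z ^ m) S := by
  have h1 := h.tsum_fiberwise fun p => ∑ i, p.1 i
  refine h1.congr_fun fun m => ?_
  have h2 := h.summable.indicator ((fun p : (Fin k → ℕ) × ι => ∑ i, p.1 i) ⁻¹' {m})
  rw [tsum_subtype ((fun p : (Fin k → ℕ) × ι => ∑ i, p.1 i) ⁻¹' {m})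
    fun p : (Fin k → ℕ) × ι => w p.1 p.2 * z ^ ∑ i, p.1 i, h2.tsum_prod]
  rw [← Summable.tsum_comm (f := fun η ν => Set.indicator
    ((fun p : (Fin k → ℕ) × ι => ∑ i, p.1 i) ⁻¹' {m})
    (fun p : (Fin k → ℕ) × ι => w p.1 p.2 * z ^ ∑ i, p.1 i) (η, ν)) h2, coeffSum,
    PowerSeries.coeff_mk, ← tsum_mul_right]
  refine tsum_congr fun ν => ?_
  rw [coeffSum, PowerSeries.coeff_mk, ← tsum_mul_right]
  refine tsum_congr fun η => ?_
  rw [show algebraMap ℝ (PowerSeries ℝ) = PowerSeries.C from rfl, PowerSeries.coeff_C_mul,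
    PowerSeries.coeff_X_pow]
  by_cases hm : ∑ i, η i = m
  · simp [Set.indicator, hm]
  · simp [Set.indicator, hm, Ne.symm hm]

end fubini

section baseSum

variable {k n : ℕ} {q t b B v : ℝ}

theorem summable_baseSol (hq0 : 0 < q) (hq1 : q < 1) (ht : 0 < t) (ht1 : t < 1) (hB : 0 < B)
    (hB1 : B < 1) (b : ℝ) : Summable fun ν : Fin n → ℕ => baseSol q t B b ν := by
  obtain ⟨C, h⟩ := exists_baseSol_le (n := n) hq0 hq1 ht ht1 hB |b|
  exact Summable.of_norm_bounded ((summable_pow_sum hB.le hB1 n).mul_left C) (h b le_rfl)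

theorem tsum_baseSol_step (hq0 : 0 < q) (hq1 : q < 1) (ht : 0 < t) (ht1 : t < 1) (hB : 0 < B)
    (hB1 : B < 1) (b : ℝ) : ∑' ν : Fin n → ℕ, baseSol q t B b ν =
      (∏ i ∈ Finset.range n, (1 - b * (B * t ^ (n - 1)) * t ^ i)) *
        ∑' ν : Fin n → ℕ, baseSol q t B (q * b) ν := by
  have hs : CoeffSummable fun ν : Fin n → ℕ => PowerSeries.C (baseSol q t B (q * b) ν) := fun m => by
    simp only [PowerSeries.coeff_C]
    split_ifs
    · exact summable_baseSol hq0 hq1 ht ht1 hB hB1 _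
    · exact summable_zero
  obtain ⟨-, h⟩ := hs.stepAct hq0 hq1 ht ht1 (fun ν hν => by
    rw [baseSol_supported q t B _ hν, map_zero]) (PowerSeries.C (b * (B * t ^ (n - 1))))
  have h1 (ν : Fin n → ℕ) : stepAct q t (PowerSeries.C (b * (B * t ^ (n - 1)))) 0 0
      (fun ν : Fin n → ℕ => PowerSeries.C (baseSol q t B (q * b) ν)) ν =
      PowerSeries.C (baseSol q t B b ν) := by
    rw [C_baseSol, ← stepAct_C_baseSol hq0 hq1 ht ht1, ← map_mul]
    simp only [C_baseSol, map_mul]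
  rw [funext h1] at h
  have h2 := congrArg (PowerSeries.coeff 0) h
  rw [coeffSum, PowerSeries.coeff_mk, PowerSeries.coeff_zero_eq_constantCoeff, map_mul, map_prod,
    ← PowerSeries.coeff_zero_eq_constantCoeff, coeffSum, PowerSeries.coeff_mk] at h2
  simpa [mul_comm, mul_left_comm, mul_assoc] using h2

theorem tsum_baseSol_eq_prod_mul (hq0 : 0 < q) (hq1 : q < 1) (ht : 0 < t) (ht1 : t < 1)
    (hB : 0 < B) (hB1 : B < 1) (b : ℝ) : ∑' ν : Fin n → ℕ, baseSol q t B b ν =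
      (∏ i ∈ Finset.range n, qProd q (b * (B * t ^ (n - 1)) * t ^ i)) *
        ∑' ν : Fin n → ℕ, baseSol q t B 0 ν := by
  have iter (N : ℕ) : ∑' ν : Fin n → ℕ, baseSol q t B b ν =
      (∏ l ∈ Finset.range N, ∏ i ∈ Finset.range n, (1 - B * t ^ (n - 1) * t ^ i * (q ^ l * b))) *
        ∑' ν : Fin n → ℕ, baseSol q t B (q ^ N * b) ν := by
    induction N with
    | zero => simp
    | succ N ih =>
      rw [ih, tsum_baseSol_step hq0 hq1 ht ht1 hB hB1, Finset.prod_range_succ, ← mul_assoc,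
        pow_succ', mul_assoc q]
      congr 2
      exact Finset.prod_congr rfl fun i _ => by ring
  have h0 : Filter.Tendsto (fun N : ℕ => q ^ N * b) Filter.atTop (nhds 0) := by
    simpa using (tendsto_pow_atTop_nhds_zero_of_lt_one hq0.le hq1).mul_const b
  obtain ⟨C, hC⟩ := exists_baseSol_le (n := n) hq0 hq1 ht ht1 hB |b|
  have lim : Filter.Tendsto (fun N : ℕ => ∑' ν : Fin n → ℕ, baseSol q t B (q ^ N * b) ν)
      Filter.atTop (nhds (∑' ν : Fin n → ℕ, baseSol q t B 0 ν)) := by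
    refine tendsto_tsum_of_dominated_convergence ((summable_pow_sum hB.le hB1 n).mul_left C)
      (fun ν => ((continuous_baseSol q t B ν).tendsto 0).comp h0) (.of_forall fun N ν => ?_)
    refine hC _ ?_ ν
    rw [abs_mul, abs_of_pos (pow_pos hq0 N)]
    exact mul_le_of_le_one_left (abs_nonneg _) (pow_le_one₀ hq0.le hq1.le)
  have h1 := ((tendsto_prod_prod_linear hq0 hq1 (t := t) (B * t ^ (n - 1)) b n).mul lim)
  simp only [← iter] at h1
  have h2 := tendsto_nhds_unique tendsto_const_nhds h1
  rw [h2]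
  congr 1
  exact Finset.prod_congr rfl fun i _ => by congr 1; ring

theorem baseWeight_zero_eq (hq0 : 0 < q) (hq1 : q < 1) (ht : 0 < t) (ht1 : t < 1)
    (hB : 0 < B) (hB1 : B < 1) : baseWeight q t B (0 : Fin n → ℕ) =
      (∏ i ∈ Finset.range n, qProd q (B * t ^ i)) *
        ∑' ν : Fin n → ℕ, baseSol q t B 0 ν := by
  have h := tsum_baseSol_eq_prod_mul (n := n) hq0 hq1 ht ht1 hB hB1 (1 / t ^ (n - 1))
  have e (i : ℕ) : 1 / t ^ (n - 1) * (B * t ^ (n - 1)) * t ^ i = B * t ^ i := by field_simp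
  simp only [e] at h
  rw [← h, tsum_eq_single 0]
  · simp [baseSol, finPoch]
  · intro ν hν
    by_cases ha : Antitone ν
    · cases n with
      | zero => exact absurd (Subsingleton.elim _ _) hν
      | succ n =>
        have h0 : ν 0 ≠ 0 := fun h0 => hν <| funext fun i =>
          Nat.le_zero.1 (h0 ▸ ha (Fin.zero_le i))
        have : finPoch q t (1 / t ^ n) ν = 0 := by
          refine Finset.prod_eq_zero (Finset.mem_univ 0) (Finset.prod_eq_zero
            (Finset.mem_range.2 (Nat.pos_of_ne_zero h0)) ?_)
          have : t ^ n ≠ 0 := (pow_pos ht n).ne'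
          simp [this]
        rw [baseSol, Nat.add_sub_cancel, this, mul_zero]
    · exact baseSol_supported q t B _ ha

theorem prod_mul_tsum_baseSol (hq0 : 0 < q) (hq1 : q < 1) (ht : 0 < t) (ht1 : t < 1)
    (hB : 0 < B) (hB1 : B < 1) (b : ℝ) :
    (∏ i ∈ Finset.range n, qProd q (B * t ^ i)) * ∑' ν : Fin n → ℕ, baseSol q t B b ν =
      (∏ i ∈ Finset.range n, qProd q (b * (B * t ^ (n - 1)) * t ^ i)) *
        baseWeight q t B (0 : Fin n → ℕ) := by
  rw [tsum_baseSol_eq_prod_mul hq0 hq1 ht ht1 hB hB1, baseWeight_zero_eq hq0 hq1 ht ht1 hB hB1]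
  ring

end baseSum

section pairSum

variable {k n : ℕ} {q t b B v : ℝ}

theorem prod_mul_tsum_pairWeight (hq0 : 0 < q) (hq1 : q < 1) (ht : 0 < t) (ht1 : t < 1) (hB : 0 < B)
    (hB1 : B < t ^ k) (hb : LatGeneric q t b) (hb0 : b ≠ 0) (hv : v = t * q / b) {z : ℝ}
    (hz : |z| < 1) :
    (∏ i ∈ Finset.range k, qProd q (t ^ i * z)) *
        (∏ i ∈ Finset.range k, qProd q (B / t * t ^ i * z)) *
        (∏ i ∈ Finset.range n, qProd q (B * t ^ i)) *
        ∑' p : (Fin k → ℕ) × (Fin n → ℕ), pairWeight q t b B v p.1 p.2 * z ^ ∑ i, p.1 i =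
      (∏ i ∈ Finset.range k, qProd q (B / t * t ^ n * t ^ i * z)) *
        (∏ i ∈ Finset.range k, qProd q (t ^ k / t * b / t ^ n * t ^ i * z)) *
        (∏ i ∈ Finset.range n, qProd q (B / t * v * t ^ n / t ^ k * t ^ i)) *
        (initConst k n q t b v * baseWeight q t B (0 : Fin n → ℕ)) := by
  have hvg : LatGeneric q t v := hv ▸ hb.dual hq0 ht hb0
  have hB2 : B < 1 := hB1.trans_le (pow_le_one₀ ht.le ht1.le)
  obtain ⟨h1, h2⟩ := functional_equation (k := k) (n := n) hq0 hq1 ht ht1 hB hB2 hb hb0 hv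
  have h3 := hasSum_coeff_coeffSum (w := pairWeight q t b B v)
    (summable_pairWeight (k := k) (n := n) hq0 hq1 ht ht1 hB hB1 hb hb0 hvg hz).hasSum
  have h4 := tsum_mul_prod_qProd hq0 hq1 h3.summable h2
  rw [h3.tsum_eq] at h4
  simp only [one_mul] at h4
  change _ = _ * PowerSeries.constantCoeff (coeffSum (pairSeries (n := n) k q t b B v)) at h4
  have h5 : PowerSeries.constantCoeff (coeffSum (pairSeries (n := n) k q t b B v)) =
      initConst k n q t b v * ∑' ν : Fin n → ℕ, baseSol q t B (v / t ^ k) ν := by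
    rw [← PowerSeries.coeff_zero_eq_constantCoeff_apply, coeffSum, PowerSeries.coeff_mk,
      ← tsum_mul_left]
    refine tsum_congr fun ν => ?_
    rw [PowerSeries.coeff_zero_eq_constantCoeff_apply, constantCoeff_pairSeries,
      pairWeight_zero_left hq0 hq1 ht hb hb0 hv fun _ => rfl]
  have h6 := prod_mul_tsum_baseSol (n := n) hq0 hq1 ht ht1 hB hB2 (v / t ^ k)
  have h7 : ∏ i ∈ Finset.range n, qProd q (v / t ^ k * (B * t ^ (n - 1)) * t ^ i) =
      ∏ i ∈ Finset.range n, qProd q (B / t * v * t ^ n / t ^ k * t ^ i) := by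
    refine Finset.prod_congr rfl fun i hi => ?_
    obtain ⟨n, rfl⟩ := Nat.exists_eq_succ_of_ne_zero (Nat.ne_zero_of_lt (Finset.mem_range.1 hi))
    rw [Nat.succ_sub_one, Nat.succ_eq_add_one, pow_succ t n]
    congr 1
    field_simp
  rw [h7] at h6
  rw [h5] at h4
  linear_combination (∏ i ∈ Finset.range n, qProd q (B * t ^ i)) * h4 +
    (∏ i ∈ Finset.range k, qProd q (B / t * t ^ n * t ^ i * z)) *
    (∏ i ∈ Finset.range k, qProd q (t ^ k / t * b / t ^ n * t ^ i * z)) * initConst k n q t b v * h6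

end pairSum

section normalization

variable {q t : ℝ}

theorem latDelta_zero_eq_prod (hq0 : 0 < q) (hq1 : q < 1) (ht : 0 < t) (ht1 : t < 1) (n : ℕ) :
    latDelta q t (0 : Fin n → ℕ) = ∏ j ∈ Finset.range n,
      (qProd q t / qProd q (t ^ (j + 1)) * (qProd q q / qProd q (q * t ^ j))) := by
  have h1 (d : ℕ) : qProd q (t ^ (d + 1)) ≠ 0 :=
    (qProd_pos hq0 hq1 (by positivity) (pow_lt_one₀ ht.le ht1 d.succ_ne_zero)).ne'
  have h2 (d : ℕ) : qProd q (q * t ^ d) ≠ 0 :=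
    (qProd_pos hq0 hq1 (by positivity)
      (mul_lt_one_of_nonneg_of_lt_one_left hq0.le hq1 (pow_le_one₀ ht.le ht1.le))).ne'
  have h3 (d : ℕ) : pairDelta q t (t ^ (d + 1)) = qProd q (t ^ (d + 1)) / qProd q (t ^ (d + 2)) *
      (qProd q (q * t ^ d) / qProd q (q * t ^ (d + 1))) := by
    rw [pairDelta, qProd_eq_mul hq0 hq1 (t ^ (d + 1)), pow_succ' t (d + 1),
      show q * t ^ (d + 1) / t = q * t ^ d by rw [pow_succ]; field_simp]
    have := h2 (d + 1)
    generalize qProd q (q * t ^ (d + 1)) = x at this ⊢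
    rw [← pow_succ', div_mul_div_comm, mul_right_comm, mul_div_mul_right _ _ this]
  rw [latDelta_zero ht.ne', ltPairs, Finset.prod_filter, ← Finset.univ_product_univ,
    Finset.prod_product_right, Finset.prod_range]
  refine Finset.prod_congr rfl fun j _ => ?_
  have h4 : (∏ i : Fin n, if i < j then pairDelta q t (t ^ ((j : ℕ) - i)) else 1) =
      ∏ d ∈ Finset.range (j : ℕ), pairDelta q t (t ^ (d + 1)) := by
    simp only [Fin.lt_def]
    rw [Fin.prod_univ_eq_prod_range (fun i => if i < (j : ℕ) then pairDelta q t (t ^ ((j : ℕ) - i))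
      else 1) n, ← Finset.prod_filter, show {i ∈ Finset.range n | i < (j : ℕ)} =
        Finset.range (j : ℕ) by grind, ← Finset.prod_range_reflect]
    refine Finset.prod_congr rfl fun i hi => ?_
    rw [Finset.mem_range] at hi
    congr 2
    omega
  simp only
  rw [h4]
  simp only [h3, Finset.prod_mul_distrib]
  have h5 := prod_range_div_of_ne_zero (fun d => (qProd q (t ^ (d + 1)))⁻¹) j
    fun d => inv_ne_zero (h1 d)
  have h6 := prod_range_div_of_ne_zero (fun d => (qProd q (q * t ^ d))⁻¹) j
    fun d => inv_ne_zero (h2 d)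
  simp only [inv_div_inv, pow_zero, mul_one, zero_add, pow_one] at h5 h6
  rw [h5, h6]

theorem prod_qProd_shift (q b : ℝ) (ht : t ≠ 0) (k n : ℕ) :
    (∏ i ∈ Finset.range k, qProd q (b * t ^ i / t ^ n)) *
      ∏ j ∈ Finset.range n, qProd q (t ^ k * (b / (t * t ^ j))) =
    (∏ i ∈ Finset.range k, qProd q (b * t ^ i)) *
      ∏ j ∈ Finset.range n, qProd q (b / (t * t ^ j)) := by
  induction n with
  | zero => simp
  | succ n ih =>
    have h1 := Finset.prod_range_succ (fun i => qProd q (b * t ^ i / t ^ (n + 1))) k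
    rw [Finset.prod_range_succ'] at h1
    have e (i : ℕ) : b * t ^ (i + 1) / t ^ (n + 1) = b * t ^ i / t ^ n := by
      rw [pow_succ, pow_succ, ← mul_assoc, mul_div_mul_right _ _ ht]
    simp only [e, pow_zero, mul_one] at h1
    rw [Finset.prod_range_succ, Finset.prod_range_succ, ← pow_succ', ← mul_div_assoc,
      mul_comm _ b]
    linear_combination (qProd q (b / t ^ (n + 1))) * ih -
      (∏ j ∈ Finset.range n, qProd q (t ^ k * (b / (t * t ^ j)))) * h1

end normalization

section evaluation

variable {k n : ℕ} {q t b B v : ℝ}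

theorem latDelta_zero_mul_prod (hq0 : 0 < q) (hq1 : q < 1) (ht : 0 < t) (ht1 : t < 1) (n : ℕ) :
    latDelta q t (0 : Fin n → ℕ) * ∏ i ∈ Finset.range n, qProd q (q * t ^ i) =
      ∏ i ∈ Finset.range n, (qProd q q * qProd q t * (qProd q (t ^ (i + 1)))⁻¹) := by
  rw [latDelta_zero_eq_prod hq0 hq1 ht ht1, ← Finset.prod_mul_distrib]
  refine Finset.prod_congr rfl fun i _ => ?_
  have : qProd q (q * t ^ i) ≠ 0 := (qProd_pos hq0 hq1 (by positivity)
    (mul_lt_one_of_nonneg_of_lt_one_left hq0.le hq1 (pow_le_one₀ ht.le ht1.le))).ne'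
  field_simp

theorem initConst_mul_baseWeight (hq0 : 0 < q) (hq1 : q < 1) (ht : 0 < t) (ht1 : t < 1)
    (hb : LatGeneric q t b) :
    initConst k n q t b v * baseWeight q t B (0 : Fin n → ℕ) =
      (∏ i ∈ Finset.range k, (qProd q q * qProd q t * (qProd q (t ^ (i + 1)))⁻¹)) *
      (∏ i ∈ Finset.range k, (qProd q (b * t ^ i / t ^ n))⁻¹) *
      (∏ i ∈ Finset.range n, (qProd q q * qProd q t * (qProd q (t ^ (i + 1)))⁻¹)) *
      ∏ i ∈ Finset.range n, (qProd q (v * t ^ i))⁻¹ := by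
  have h1 : ∏ j : Fin n, qProd q (q * lat q t (0 : Fin n → ℕ) j) =
      ∏ i ∈ Finset.range n, qProd q (q * t ^ i) := by
    rw [← prod_rev_eq_prod_range]
    exact Finset.prod_congr rfl fun j _ => by simp [lat]
  have h2 := prod_qProd_shift q b ht.ne' k n
  have h3 : ∏ i ∈ Finset.range k, qProd q (b * t ^ i) ≠ 0 := Finset.prod_ne_zero_iff.2 fun i _ =>
    hb.qProd_ne_zero hq0 hq1 ⟨i, 0, by simp⟩
  have h4 : ∏ i ∈ Finset.range k, qProd q (b * t ^ i / t ^ n) ≠ 0 :=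
    Finset.prod_ne_zero_iff.2 fun i _ => hb.qProd_ne_zero hq0 hq1 ⟨i - n, 0, by
      rw [zpow_sub₀ ht.ne', zpow_natCast, zpow_natCast, zpow_zero, mul_one, mul_div_assoc]⟩
  have h5 : ∏ j ∈ Finset.range n, qProd q (b / (t * t ^ j)) ≠ 0 :=
    Finset.prod_ne_zero_iff.2 fun j _ => hb.qProd_ne_zero hq0 hq1 ⟨-(j + 1 : ℕ), 0, by
      rw [zpow_neg, zpow_natCast, zpow_zero, mul_one, pow_succ', div_eq_mul_inv]⟩
  rw [initConst, baseWeight, h1, ← latDelta_zero_mul_prod hq0 hq1 ht ht1,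
    ← latDelta_zero_mul_prod hq0 hq1 ht ht1]
  simp only [Finset.prod_div_distrib, Finset.prod_inv_distrib, Pi.zero_apply,
    Finset.sum_const_zero, pow_zero, mul_one]
  have h6 : (∏ i ∈ Finset.range k, qProd q (b * t ^ i))⁻¹ *
      ((∏ j ∈ Finset.range n, qProd q (t ^ k * (b / (t * t ^ j)))) /
        ∏ j ∈ Finset.range n, qProd q (b / (t * t ^ j))) =
      (∏ i ∈ Finset.range k, qProd q (b * t ^ i / t ^ n))⁻¹ := by
    rw [inv_mul_eq_div, div_div, div_eq_iff (mul_ne_zero h5 h3), eq_inv_mul_iff_mul_eq₀ h4]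
    linear_combination h2
  rw [← h6]
  ring

theorem prod_prod_qProd_div (hq0 : 0 < q) (hq1 : q < 1) (ht : 0 < t) (ht1 : t < 1) {x : ℝ}
    (hx : 0 ≤ x) (hx1 : x < t) (k n : ℕ) :
    ∏ i ∈ Finset.range k, ∏ j ∈ Finset.range n,
      qProd q (x / t * t ^ i * t ^ (j + 1)) / qProd q (x / t * t ^ i * t ^ j) =
    (∏ i ∈ Finset.range k, qProd q (x / t * t ^ n * t ^ i)) /
      ∏ i ∈ Finset.range k, qProd q (x / t * t ^ i) := by
  rw [← Finset.prod_div_distrib]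
  refine Finset.prod_congr rfl fun i _ => ?_
  rw [prod_range_div_of_ne_zero (fun j => qProd q (x / t * t ^ i * t ^ j)), pow_zero, mul_one,
    mul_right_comm]
  intro j
  have h1 : x / t < 1 := (div_lt_one ht).2 hx1
  have h2 : t ^ i * t ^ j ≤ 1 := by
    rw [← pow_add]
    exact pow_le_one₀ ht.le ht1.le
  rw [mul_assoc]
  exact (qProd_pos hq0 hq1 (by positivity)
    (mul_lt_one_of_nonneg_of_lt_one_left (by positivity) h1 h2)).ne'

theorem tsum_pairWeight (hq0 : 0 < q) (hq1 : q < 1) (ht : 0 < t) (ht1 : t < 1) (hB : 0 < B)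
    (hB1 : B < t ^ k) (hb : LatGeneric q t b) (hb0 : b ≠ 0) (hv : v = t * q / b) {A : ℝ}
    (hA : 0 < A) (hA1 : A < 1) :
    ∑' p : (Fin k → ℕ) × (Fin n → ℕ), pairWeight q t b B v p.1 p.2 * A ^ ∑ i, p.1 i =
      (∏ i ∈ Finset.range k, qProd q q * (qProd q (A * b * t ^ k / t / t ^ n * t ^ i) * qProd q t *
        ((qProd q (A * t ^ i))⁻¹ * (qProd q (b * t ^ i / t ^ n))⁻¹ * (qProd q (t ^ (i + 1)))⁻¹))) *
      (∏ i ∈ Finset.range n, qProd q q * (qProd q (B * v * t ^ n / t / t ^ k * t ^ i) * qProd q t *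
        ((qProd q (B * t ^ i))⁻¹ * (qProd q (v * t ^ i))⁻¹ * (qProd q (t ^ (i + 1)))⁻¹))) *
      ∏ i ∈ Finset.range k, ∏ j ∈ Finset.range n,
        qProd q (A * B / t * t ^ i * t ^ (j + 1)) / qProd q (A * B / t * t ^ i * t ^ j) := by
  have hB2 : B < 1 := hB1.trans_le (pow_le_one₀ ht.le ht1.le)
  have hp {x : ℝ} (hx : 0 < x) (hx1 : x < 1) (i : ℕ) : qProd q (x * t ^ i) ≠ 0 :=
    (qProd_pos hq0 hq1 (by positivity)
      (mul_lt_one_of_nonneg_of_lt_one_left hx.le hx1 (pow_le_one₀ ht.le ht1.le))).ne'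
  have hAB (hk : k ≠ 0) : A * B < t := by
    have : B < t := hB1.trans_le (pow_le_of_le_one ht.le ht1.le hk)
    nlinarith
  have h1 : ∏ i ∈ Finset.range k, qProd q (A * t ^ i) ≠ 0 :=
    Finset.prod_ne_zero_iff.2 fun i _ => hp hA hA1 i
  have h2 : ∏ i ∈ Finset.range n, qProd q (B * t ^ i) ≠ 0 :=
    Finset.prod_ne_zero_iff.2 fun i _ => hp hB hB2 i
  have h3 : ∏ i ∈ Finset.range k, qProd q (A * B / t * t ^ i) ≠ 0 :=
    Finset.prod_ne_zero_iff.2 fun i hi => hp (by positivity)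
      ((div_lt_one ht).2 (hAB (Nat.ne_zero_of_lt (Finset.mem_range.1 hi)))) i
  have h4 : ∏ i ∈ Finset.range k, ∏ j ∈ Finset.range n,
      qProd q (A * B / t * t ^ i * t ^ (j + 1)) / qProd q (A * B / t * t ^ i * t ^ j) =
      (∏ i ∈ Finset.range k, qProd q (A * B / t * t ^ n * t ^ i)) /
        ∏ i ∈ Finset.range k, qProd q (A * B / t * t ^ i) := by
    rcases eq_or_ne k 0 with rfl | hk
    · simp
    · exact prod_prod_qProd_div hq0 hq1 ht ht1 (by positivity) (hAB hk) k n
  have h := prod_mul_tsum_pairWeight (k := k) (n := n) hq0 hq1 ht ht1 hB hB1 hb hb0 hv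
    (z := A) (by rwa [abs_of_pos hA])
  rw [initConst_mul_baseWeight hq0 hq1 ht ht1 hb] at h
  have e1 (i : ℕ) : t ^ i * A = A * t ^ i := mul_comm _ _
  have e2 (i : ℕ) : B / t * t ^ i * A = A * B / t * t ^ i := by ring
  have e3 (i : ℕ) : B / t * t ^ n * t ^ i * A = A * B / t * t ^ n * t ^ i := by ring
  have e4 (i : ℕ) : t ^ k / t * b / t ^ n * t ^ i * A = A * b * t ^ k / t / t ^ n * t ^ i := by ring
  have e5 (i : ℕ) : B / t * v * t ^ n / t ^ k * t ^ i = B * v * t ^ n / t / t ^ k * t ^ i := by ring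
  simp only [e1, e2, e3, e4, e5] at h
  rw [h4]
  refine mul_left_cancel₀ (mul_ne_zero (mul_ne_zero h1 h3) h2) (h.trans ?_)
  simp only [Finset.prod_mul_distrib, Finset.prod_inv_distrib]
  have h5 : (∏ i ∈ Finset.range k, qProd q (A * t ^ i)) *
      (∏ i ∈ Finset.range k, qProd q (A * t ^ i))⁻¹ *
      ((∏ i ∈ Finset.range n, qProd q (B * t ^ i)) *
        (∏ i ∈ Finset.range n, qProd q (B * t ^ i))⁻¹) *
      ((∏ i ∈ Finset.range k, qProd q (A * B / t * t ^ i)) *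
        (∏ i ∈ Finset.range k, qProd q (A * B / t * t ^ i))⁻¹) = 1 := by
    rw [mul_inv_cancel₀ h1, mul_inv_cancel₀ h2, mul_inv_cancel₀ h3, one_mul, one_mul]
  rw [← mul_one (_ * _ * _ * _), ← h5, div_eq_mul_inv]
  ring

end evaluation

section cast

variable {q : ℝ}

theorem qPochInf_ofReal (hq0 : 0 < q) (hq1 : q < 1) (x : ℝ) :
    qPochInf x q = (qProd q x : ℂ) := by
  have h := (multipliable_qProd hq0 hq1 x).map_tprod Complex.ofRealHom Complex.continuous_ofReal
  rw [qPochInf, qProd]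
  refine Eq.trans (tprod_congr fun i => ?_) h.symm
  simp

theorem ofReal_qProd_ratio (hq0 : 0 < q) (hq1 : q < 1) (x z : ℝ) :
    qPoch ((q : ℂ) ^ (x : ℂ)) q z = ((qProd q (q ^ x) / qProd q (q ^ (x + z)) : ℝ) : ℂ) := by
  rw [qPoch, ← Complex.ofReal_cpow hq0.le, ← Complex.ofReal_cpow hq0.le, ← Complex.ofReal_mul,
    ← Real.rpow_add hq0, qPochInf_ofReal hq0 hq1, qPochInf_ofReal hq0 hq1, Complex.ofReal_div]

theorem qGamma_ofReal (hq0 : 0 < q) (hq1 : q < 1) (x : ℝ) :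
    qGamma q x = ((qProd q q * (qProd q (q ^ x))⁻¹ * (1 - q) ^ (1 - x) : ℝ) : ℂ) := by
  have h := ofReal_qProd_ratio hq0 hq1 1 (x - 1)
  rw [Complex.ofReal_one, Complex.cpow_one, Real.rpow_one, add_sub_cancel] at h
  have h2 : (0 : ℝ) ≤ 1 - q := by linarith
  rw [qGamma, ← Complex.ofReal_one, ← Complex.ofReal_sub, ← Complex.ofReal_sub, h,
    ← Complex.ofReal_cpow h2, ← Complex.ofReal_div, ← neg_sub x 1, Real.rpow_neg h2]
  rfl

theorem lat_rpow (hq0 : 0 < q) (γ : ℝ) {n : ℕ} (ν : Fin n → ℕ) (i : Fin n) :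
    lat q (q ^ γ) ν i = q ^ (((n : ℝ) - (((i : ℕ) : ℝ) + 1)) * γ + (ν i : ℝ)) := by
  have : ((i.rev : ℕ) : ℝ) = (n : ℝ) - (((i : ℕ) : ℝ) + 1) := by
    rw [Fin.val_rev, Nat.cast_sub i.isLt]
    push_cast
    ring
  rw [lat, ← Real.rpow_natCast, ← Real.rpow_natCast, ← Real.rpow_mul hq0.le,
    ← Real.rpow_add hq0, this]
  ring_nf

theorem prod_single_ofReal (hq0 : 0 < q) (hq1 : q < 1) (γ α β : ℝ) {n : ℕ} (ν : Fin n → ℕ) :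
    ∏ i : Fin n, ((q : ℂ) ^ ((((ν i : ℝ) * α : ℝ)) : ℂ) *
        qPoch ((q : ℂ) ^ (((1 + ((n : ℝ) - (((i : ℕ) : ℝ) + 1)) * γ + (ν i : ℝ) : ℝ)) : ℂ))
          q (((β - 1 : ℝ)) : ℂ)) =
      ((∏ i, (q ^ α) ^ ν i * (qProd q (q * lat q (q ^ γ) ν i) /
        qProd q (q ^ β * lat q (q ^ γ) ν i)) : ℝ) : ℂ) := by
  rw [Complex.ofReal_prod]
  refine Finset.prod_congr rfl fun i _ => ?_
  rw [ofReal_qProd_ratio hq0 hq1, ← Complex.ofReal_cpow hq0.le, ← Complex.ofReal_mul,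
    mul_comm (ν i : ℝ), Real.rpow_mul hq0.le, Real.rpow_natCast, lat_rpow hq0]
  congr 4
  · nth_rw 2 [← Real.rpow_one q]
    rw [← Real.rpow_add hq0]
    ring_nf
  · rw [← Real.rpow_add hq0]
    ring_nf

theorem prod_pair_ofReal (hq0 : 0 < q) (hq1 : q < 1) (γ : ℝ) {n : ℕ} {ν : Fin n → ℕ}
    (hν : Antitone ν) :
    ∏ p ∈ Finset.univ.filter (fun p : Fin n × Fin n => p.1 < p.2),
      ((q : ℂ) ^ (((2 * γ * (ν p.2 : ℝ) : ℝ)) : ℂ) *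
        (1 - (q : ℂ) ^
          ((((((p.2 : ℕ) : ℝ) - ((p.1 : ℕ) : ℝ)) * γ + (ν p.1 : ℝ) - (ν p.2 : ℝ) : ℝ)) : ℂ)) *
        qPoch ((q : ℂ) ^
            (((1 + ((((p.2 : ℕ) : ℝ) - ((p.1 : ℕ) : ℝ) - 1)) * γ +
                (ν p.1 : ℝ) - (ν p.2 : ℝ) : ℝ)) : ℂ))
          q (((2 * γ - 1 : ℝ)) : ℂ)) = ((latDelta q (q ^ γ) ν : ℝ) : ℂ) := by
  rw [latDelta_of_antitone hν, Complex.ofReal_prod]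
  refine Finset.prod_congr rfl fun p _ => ?_
  have h : lat q (q ^ γ) ν p.1 / lat q (q ^ γ) ν p.2 =
      q ^ ((((p.2 : ℕ) : ℝ) - ((p.1 : ℕ) : ℝ)) * γ + (ν p.1 : ℝ) - (ν p.2 : ℝ)) := by
    rw [lat_rpow hq0, lat_rpow hq0, ← Real.rpow_sub hq0]
    ring_nf
  set z := (((p.2 : ℕ) : ℝ) - ((p.1 : ℕ) : ℝ)) * γ + (ν p.1 : ℝ) - (ν p.2 : ℝ) with hz
  have h1 : (q ^ γ) ^ (2 * ν p.2) = q ^ (2 * γ * (ν p.2 : ℝ)) := by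
    rw [← Real.rpow_natCast (q ^ γ), ← Real.rpow_mul hq0.le]
    push_cast
    ring_nf
  have h2 : q * q ^ z / q ^ γ = q ^ (1 + z - γ) := by
    rw [Real.rpow_sub hq0 (1 + z), Real.rpow_add hq0 1, Real.rpow_one]
  rw [ofReal_qProd_ratio hq0 hq1, ← Complex.ofReal_cpow hq0.le, ← Complex.ofReal_cpow hq0.le,
    ← Complex.ofReal_one, ← Complex.ofReal_sub, ← Complex.ofReal_mul, ← Complex.ofReal_mul,
    pairDelta, h, h1, h2, ← Real.rpow_add hq0, mul_assoc, mul_div_assoc]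
  congr 6 <;> rw [hz] <;> ring_nf

theorem prod_cross_ofReal (hq0 : 0 < q) (hq1 : q < 1) (γ β : ℝ) {k n : ℕ} (η : Fin k → ℕ)
    (ν : Fin n → ℕ) :
    ∏ i : Fin k, ∏ j : Fin n,
      ((q : ℂ) ^ (((-γ * (ν j : ℝ) : ℝ)) : ℂ) *
        qPoch ((q : ℂ) ^
            (((β + ((k : ℝ) - (n : ℝ) + ((j : ℕ) : ℝ) - ((i : ℕ) : ℝ)) * γ +
                (η i : ℝ) - (ν j : ℝ) : ℝ)) : ℂ))
          q (((-γ : ℝ)) : ℂ)) =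
      ((∏ i, ∏ j, ((q ^ γ) ^ ν j)⁻¹ *
        (qProd q (q ^ β * lat q (q ^ γ) η i / lat q (q ^ γ) ν j) /
          qProd q (q ^ β * lat q (q ^ γ) η i / (q ^ γ * lat q (q ^ γ) ν j))) : ℝ) : ℂ) := by
  rw [Complex.ofReal_prod]
  refine Finset.prod_congr rfl fun i _ => ?_
  rw [Complex.ofReal_prod]
  refine Finset.prod_congr rfl fun j _ => ?_
  rw [ofReal_qProd_ratio hq0 hq1, ← Complex.ofReal_cpow hq0.le, ← Complex.ofReal_mul, neg_mul,
    Real.rpow_neg hq0.le, Real.rpow_mul hq0.le, Real.rpow_natCast, lat_rpow hq0, lat_rpow hq0,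
    ← Real.rpow_add hq0, ← Real.rpow_add hq0, ← Real.rpow_sub hq0, ← Real.rpow_sub hq0]
  ring_nf

theorem sl3qSummand_eq_pairWeight (hq0 : 0 < q) (hq1 : q < 1) (γ α1 α2 β1 β2 : ℝ) {k n : ℕ}
    {η : Fin k → ℕ} {ν : Fin n → ℕ} (hη : Antitone η) (hν : Antitone ν) :
    sl3qSummand q γ α1 α2 β1 β2 k n η ν =
      ((pairWeight q (q ^ γ) (q ^ β1) (q ^ α2) (q ^ β2) η ν * (q ^ α1) ^ ∑ i, η i : ℝ) : ℂ) := by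
  rw [sl3qSummand, prod_single_ofReal hq0 hq1, prod_single_ofReal hq0 hq1,
    prod_pair_ofReal hq0 hq1 γ hη, prod_pair_ofReal hq0 hq1 γ hν, prod_cross_ofReal hq0 hq1,
    ← Complex.ofReal_mul, ← Complex.ofReal_mul, ← Complex.ofReal_mul, ← Complex.ofReal_mul,
    pairWeight, Finset.prod_mul_distrib, Finset.prod_pow_eq_pow_sum]
  congr 1
  ring

theorem latGeneric_rpow (hq0 : 0 < q) (hq1 : q < 1) {γ β : ℝ}
    (h : ∀ m l : ℤ, β + (m : ℝ) * γ ≠ (l : ℝ)) : LatGeneric q (q ^ γ) (q ^ β) := by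
  intro m l h2
  rw [← Real.rpow_intCast, ← Real.rpow_intCast, ← Real.rpow_mul hq0.le, ← Real.rpow_add hq0,
    ← Real.rpow_add hq0] at h2
  have h3 := congrArg Real.log h2
  rw [Real.log_rpow hq0, Real.log_one] at h3
  have h4 := (mul_eq_zero.1 h3).resolve_right (Real.log_neg hq0 hq1).ne
  refine h m (-l) ?_
  push_cast
  linarith

end cast

section gammaProducts

variable {q : ℝ}

theorem gamma_block_ofReal (hq0 : 0 < q) (hq1 : q < 1) (a b c d e : ℝ) :
    qGamma q a * qGamma q b * qGamma q c / (qGamma q d * qGamma q e) =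
      ((qProd q q * (qProd q (q ^ d) * qProd q (q ^ e) *
        ((qProd q (q ^ a))⁻¹ * (qProd q (q ^ b))⁻¹ * (qProd q (q ^ c))⁻¹)) *
        (1 - q) ^ (1 - a - b - c + d + e) : ℝ) : ℂ) := by
  have h0 : (0 : ℝ) < 1 - q := by linarith
  have hQ : qProd q q ≠ 0 := (qProd_pos hq0 hq1 hq0.le hq1).ne'
  have h1 : (1 - q : ℝ) ^ (1 - a - b - c + d + e) =
      (1 - q) ^ (1 - a) * (1 - q) ^ (1 - b) * (1 - q) ^ (1 - c) *
        (((1 - q) ^ (1 - d))⁻¹ * ((1 - q) ^ (1 - e))⁻¹) := by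
    rw [← Real.rpow_neg h0.le, ← Real.rpow_neg h0.le, ← Real.rpow_add h0, ← Real.rpow_add h0,
      ← Real.rpow_add h0, ← Real.rpow_add h0]
    ring_nf
  rw [qGamma_ofReal hq0 hq1, qGamma_ofReal hq0 hq1, qGamma_ofReal hq0 hq1, qGamma_ofReal hq0 hq1,
    qGamma_ofReal hq0 hq1, h1, ← Complex.ofReal_mul, ← Complex.ofReal_mul, ← Complex.ofReal_mul,
    ← Complex.ofReal_div]
  congr 1
  simp only [div_eq_mul_inv, mul_inv, inv_inv]
  linear_combination (qProd q q * (qProd q (q ^ d) * qProd q (q ^ e) *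
        ((qProd q (q ^ a))⁻¹ * (qProd q (q ^ b))⁻¹ * (qProd q (q ^ c))⁻¹)) *
      (1 - q) ^ (1 - a) * (1 - q) ^ (1 - b) * (1 - q) ^ (1 - c) *
        (((1 - q) ^ (1 - d))⁻¹ * ((1 - q) ^ (1 - e))⁻¹)) *
    (qProd q q * (qProd q q)⁻¹ + 1) * mul_inv_cancel₀ hQ

theorem gamma_ratio_ofReal (hq0 : 0 < q) (hq1 : q < 1) (a d : ℝ) :
    qGamma q a / qGamma q d =
      ((qProd q (q ^ d) / qProd q (q ^ a) * (1 - q) ^ (d - a) : ℝ) : ℂ) := by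
  have h0 : (0 : ℝ) < 1 - q := by linarith
  have hQ : qProd q q ≠ 0 := (qProd_pos hq0 hq1 hq0.le hq1).ne'
  have h1 : (1 - q : ℝ) ^ (d - a) = (1 - q) ^ (1 - a) * ((1 - q) ^ (1 - d))⁻¹ := by
    rw [← Real.rpow_neg h0.le, ← Real.rpow_add h0]
    ring_nf
  rw [qGamma_ofReal hq0 hq1, qGamma_ofReal hq0 hq1, h1, ← Complex.ofReal_div]
  congr 1
  simp only [div_eq_mul_inv, mul_inv, inv_inv]
  linear_combination (qProd q (q ^ d) * (qProd q (q ^ a))⁻¹ * ((1 - q) ^ (1 - a) *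
    ((1 - q) ^ (1 - d))⁻¹)) * mul_inv_cancel₀ hQ

theorem prod_range_reflect_block (k : ℕ) (Q e : ℝ) (A B C D : ℕ → ℝ) :
    ∏ i ∈ Finset.range k, Q * (D (k - 1 - i) * e * ((A (k - 1 - i))⁻¹ * (B i)⁻¹ * (C i)⁻¹)) =
      ∏ i ∈ Finset.range k, Q * (D i * e * ((A i)⁻¹ * (B i)⁻¹ * (C i)⁻¹)) := by
  simp only [Finset.prod_mul_distrib, Finset.prod_range_reflect D k,
    Finset.prod_range_reflect (fun i => (A i)⁻¹) k]

theorem sum_range_sub_two_mul (k : ℕ) (c γ : ℝ) :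
    ∑ i ∈ Finset.range k, (c - 2 * (i : ℝ) * γ) = k * (c - (k - 1) * γ) := by
  induction k with
  | zero => simp
  | succ k ih =>
    rw [Finset.sum_range_succ, ih]
    push_cast
    ring

theorem rpow_add_natCast_mul (hq0 : 0 < q) (α γ : ℝ) (i : ℕ) :
    q ^ (α + (i : ℝ) * γ) = q ^ α * (q ^ γ) ^ i := by
  rw [Real.rpow_add hq0, mul_comm (i : ℝ), Real.rpow_mul hq0.le, Real.rpow_natCast]

theorem prod_gamma_block (hq0 : 0 < q) (hq1 : q < 1) (γ α β δ : ℝ) (k : ℕ) :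
    ∏ i ∈ Finset.range k,
        (qGamma q (((α + ((k : ℝ) - ((i : ℝ) + 1)) * γ : ℝ)) : ℂ) *
          qGamma q (((β + (i : ℝ) * γ : ℝ)) : ℂ) *
          qGamma q (((((i : ℝ) + 1) * γ : ℝ)) : ℂ)) /
        (qGamma q (((δ + ((k : ℝ) - ((i : ℝ) + 1)) * γ : ℝ)) : ℂ) * qGamma q ((γ : ℝ) : ℂ)) =
      (((∏ i ∈ Finset.range k, qProd q q * (qProd q (q ^ δ * (q ^ γ) ^ i) * qProd q (q ^ γ) *
          ((qProd q (q ^ α * (q ^ γ) ^ i))⁻¹ * (qProd q (q ^ β * (q ^ γ) ^ i))⁻¹ *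
            (qProd q ((q ^ γ) ^ (i + 1)))⁻¹))) *
        (1 - q) ^ ((k : ℝ) * (1 - α - β + δ - ((k : ℝ) - 1) * γ)) : ℝ) : ℂ) := by
  have h0 : (0 : ℝ) < 1 - q := by linarith
  rw [← sum_range_sub_two_mul, Real.rpow_sum_of_pos h0,
    ← prod_range_reflect_block k (qProd q q) (qProd q (q ^ γ))
      (fun i => qProd q (q ^ α * (q ^ γ) ^ i)) (fun i => qProd q (q ^ β * (q ^ γ) ^ i))
      (fun i => qProd q ((q ^ γ) ^ (i + 1))) (fun i => qProd q (q ^ δ * (q ^ γ) ^ i)),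
    ← Finset.prod_mul_distrib, Complex.ofReal_prod]
  refine Finset.prod_congr rfl fun i hi => ?_
  have hi2 : (k : ℝ) - ((i : ℝ) + 1) = ((k - 1 - i : ℕ) : ℝ) := by
    have := Finset.mem_range.1 hi
    rw [Nat.cast_sub (by omega), Nat.cast_sub (by omega)]
    push_cast
    ring
  have hc : q ^ (((i : ℝ) + 1) * γ) = (q ^ γ) ^ (i + 1) := by
    rw [← Real.rpow_natCast, ← Real.rpow_mul hq0.le]
    push_cast
    ring_nf
  rw [gamma_block_ofReal hq0 hq1, hi2, rpow_add_natCast_mul hq0, rpow_add_natCast_mul hq0,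
    rpow_add_natCast_mul hq0, hc]
  congr 3
  ring

theorem prod_gamma_ratio (hq0 : 0 < q) (hq1 : q < 1) (γ σ : ℝ) (k n : ℕ) :
    ∏ i ∈ Finset.range k, ∏ j ∈ Finset.range n,
        qGamma q (((σ + ((k : ℝ) + (n : ℝ) - ((i : ℝ) + 1) - ((j : ℝ) + 1) - 1) * γ : ℝ)) : ℂ) /
          qGamma q (((σ + ((k : ℝ) + (n : ℝ) - ((i : ℝ) + 1) - ((j : ℝ) + 1)) * γ : ℝ)) : ℂ) =
      (((∏ i ∈ Finset.range k, ∏ j ∈ Finset.range n,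
          qProd q (q ^ σ / q ^ γ * (q ^ γ) ^ i * (q ^ γ) ^ (j + 1)) /
            qProd q (q ^ σ / q ^ γ * (q ^ γ) ^ i * (q ^ γ) ^ j)) *
        (1 - q) ^ ((k : ℝ) * (n : ℝ) * γ) : ℝ) : ℂ) := by
  have h0 : (0 : ℝ) < 1 - q := by linarith
  have h1 : (1 - q) ^ ((k : ℝ) * (n : ℝ) * γ) =
      ∏ _i ∈ Finset.range k, ∏ _j ∈ Finset.range n, (1 - q) ^ γ := by
    rw [Finset.prod_const, Finset.prod_const, Finset.card_range, Finset.card_range, ← pow_mul,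
      ← Real.rpow_natCast, ← Real.rpow_mul h0.le]
    push_cast
    ring_nf
  rw [h1, ← Finset.prod_range_reflect (fun i => ∏ j ∈ Finset.range n,
    qProd q (q ^ σ / q ^ γ * (q ^ γ) ^ i * (q ^ γ) ^ (j + 1)) /
      qProd q (q ^ σ / q ^ γ * (q ^ γ) ^ i * (q ^ γ) ^ j)), ← Finset.prod_mul_distrib,
    Complex.ofReal_prod]
  refine Finset.prod_congr rfl fun i hi => ?_
  rw [← Finset.prod_range_reflect (fun j =>
    qProd q (q ^ σ / q ^ γ * (q ^ γ) ^ (k - 1 - i) * (q ^ γ) ^ (j + 1)) /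
      qProd q (q ^ σ / q ^ γ * (q ^ γ) ^ (k - 1 - i) * (q ^ γ) ^ j)), ← Finset.prod_mul_distrib,
    Complex.ofReal_prod]
  refine Finset.prod_congr rfl fun j hj => ?_
  have hi2 : ((k - 1 - i : ℕ) : ℝ) = (k : ℝ) - ((i : ℝ) + 1) := by
    have := Finset.mem_range.1 hi
    rw [Nat.cast_sub (by omega), Nat.cast_sub (by omega)]
    push_cast
    ring
  have hj2 : ((n - 1 - j : ℕ) : ℝ) = (n : ℝ) - ((j : ℝ) + 1) := by
    have := Finset.mem_range.1 hj
    rw [Nat.cast_sub (by omega), Nat.cast_sub (by omega)]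
    push_cast
    ring
  have e1 : q ^ σ / q ^ γ * (q ^ γ) ^ (k - 1 - i) * (q ^ γ) ^ (n - 1 - j) =
      q ^ (σ + ((k : ℝ) + (n : ℝ) - ((i : ℝ) + 1) - ((j : ℝ) + 1) - 1) * γ) := by
    rw [← Real.rpow_sub hq0, ← rpow_add_natCast_mul hq0, ← rpow_add_natCast_mul hq0, hi2, hj2]
    ring_nf
  have e2 : q ^ σ / q ^ γ * (q ^ γ) ^ (k - 1 - i) * (q ^ γ) ^ (n - 1 - j + 1) =
      q ^ (σ + ((k : ℝ) + (n : ℝ) - ((i : ℝ) + 1) - ((j : ℝ) + 1)) * γ) := by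
    rw [← Real.rpow_sub hq0, ← rpow_add_natCast_mul hq0, ← rpow_add_natCast_mul hq0,
      Nat.cast_add, hi2, hj2]
    push_cast
    ring_nf
  rw [gamma_ratio_ofReal hq0 hq1, e1, e2]
  congr 3
  ring

end gammaProducts

section main

variable {q : ℝ}

theorem pairWeight_eq_zero {k n : ℕ} {q t b B v : ℝ} {η : Fin k → ℕ} {ν : Fin n → ℕ}
    (h : ¬ (Antitone η ∧ Antitone ν)) : pairWeight q t b B v η ν = 0 := by
  rw [not_and_or] at h
  rcases h with h | h
  · rw [pairWeight, latDelta_of_not_antitone h]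
    ring
  · rw [pairWeight, latDelta_of_not_antitone h]
    ring

theorem rpow_lt_rpow_pow (hq0 : 0 < q) (hq1 : q < 1) {γ α : ℝ} {k : ℕ} (h : (k : ℝ) * γ < α) :
    q ^ α < (q ^ γ) ^ k := by
  rw [← Real.rpow_natCast, ← Real.rpow_mul hq0.le, mul_comm]
  exact Real.rpow_lt_rpow_of_exponent_gt hq0 hq1 h

theorem tsum_sl3qSummand (hq0 : 0 < q) (hq1 : q < 1) (k1 k2 : ℕ) {γ α1 α2 β1 : ℝ}
    (hγ : 0 < γ) (hα1 : 0 < α1) (hα2 : (k1 : ℝ) * γ < α2)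
    (hβ1 : ∀ m l : ℤ, β1 + (m : ℝ) * γ ≠ (l : ℝ)) :
    (Summable fun p : {f : Fin k1 → ℕ // Antitone f} × {g : Fin k2 → ℕ // Antitone g} =>
        sl3qSummand q γ α1 α2 β1 (γ + 1 - β1) k1 k2 p.1.1 p.2.1) ∧
      ∑' p : {f : Fin k1 → ℕ // Antitone f} × {g : Fin k2 → ℕ // Antitone g},
          sl3qSummand q γ α1 α2 β1 (γ + 1 - β1) k1 k2 p.1.1 p.2.1 =
        ((∑' p : (Fin k1 → ℕ) × (Fin k2 → ℕ), pairWeight q (q ^ γ) (q ^ β1) (q ^ α2)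
          (q ^ (γ + 1 - β1)) p.1 p.2 * (q ^ α1) ^ ∑ i, p.1 i : ℝ) : ℂ) := by
  have ht : 0 < q ^ γ := Real.rpow_pos_of_pos hq0 γ
  have hb : LatGeneric q (q ^ γ) (q ^ β1) := latGeneric_rpow hq0 hq1 hβ1
  have hb0 : q ^ β1 ≠ 0 := (Real.rpow_pos_of_pos hq0 β1).ne'
  have hv : LatGeneric q (q ^ γ) (q ^ (γ + 1 - β1)) := by
    rw [Real.rpow_sub hq0, Real.rpow_add hq0, Real.rpow_one]
    exact hb.dual hq0 ht hb0
  have hA : |q ^ α1| < 1 := by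
    rw [abs_of_pos (Real.rpow_pos_of_pos hq0 α1)]
    exact Real.rpow_lt_one hq0.le hq1 hα1
  have hs := summable_pairWeight (k := k1) (n := k2) hq0 hq1 ht (Real.rpow_lt_one hq0.le hq1 hγ)
    (Real.rpow_pos_of_pos hq0 α2) (rpow_lt_rpow_pow hq0 hq1 hα2) hb hb0 hv hA
  have hi : Function.Injective (Prod.map Subtype.val Subtype.val :
      {f : Fin k1 → ℕ // Antitone f} × {g : Fin k2 → ℕ // Antitone g} → _) :=
    Subtype.val_injective.prodMap Subtype.val_injective
  have he (p : {f : Fin k1 → ℕ // Antitone f} × {g : Fin k2 → ℕ // Antitone g}) :=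
    sl3qSummand_eq_pairWeight hq0 hq1 γ α1 α2 β1 (γ + 1 - β1) p.1.2 p.2.2
  set F : (Fin k1 → ℕ) × (Fin k2 → ℕ) → ℝ := fun p => pairWeight q (q ^ γ) (q ^ β1) (q ^ α2)
    (q ^ (γ + 1 - β1)) p.1 p.2 * (q ^ α1) ^ ∑ i, p.1 i with hF
  have hsupp : Function.support F ⊆ Set.range (Prod.map Subtype.val Subtype.val :
      {f : Fin k1 → ℕ // Antitone f} × {g : Fin k2 → ℕ // Antitone g} → _) := by
    intro p hp
    by_cases h : Antitone p.1 ∧ Antitone p.2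
    · exact ⟨(⟨p.1, h.1⟩, ⟨p.2, h.2⟩), rfl⟩
    · exact absurd (by simp only [hF, pairWeight_eq_zero h, zero_mul]) hp
  have hs2 : Summable fun p : {f : Fin k1 → ℕ // Antitone f} × {g : Fin k2 → ℕ // Antitone g} =>
      ((F (Prod.map Subtype.val Subtype.val p) : ℝ) : ℂ) :=
    Complex.ofRealCLM.summable (hs.comp_injective hi)
  refine ⟨hs2.congr fun p => (he p).symm ▸ rfl, ?_⟩
  rw [← hi.tsum_eq hsupp, Complex.ofReal_tsum]
  exact tsum_congr he

end main

/-- sl(3) q-Selberg identity with general exponent, as a sum over pairs of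
partitions. For `0 < q < 1`, `γ > 0`, `α1 > 0`, `α2 > k1 γ`, `β1 + mγ ∉ ℤ` for all
`m ∈ ℤ`, and `β2 := γ + 1 − β1`, the sum of `T(η,ν)` over all pairs of partitions
(weakly decreasing tuples) converges absolutely and `(1−q)^{k1+k2} Σ T(η,ν)` equals the
stated product of q-Gamma factors. -/
theorem sl3_qSelberg_partition_sum (q : ℝ) (hq0 : 0 < q) (hq1 : q < 1)
    (k1 k2 : ℕ) (γ α1 α2 β1 : ℝ)
    (hγ : 0 < γ) (hα1 : 0 < α1) (hα2 : (k1 : ℝ) * γ < α2)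
    (hβ1 : ∀ m l : ℤ, β1 + (m : ℝ) * γ ≠ (l : ℝ)) :
    Summable (fun p : {f : Fin k1 → ℕ // Antitone f} × {g : Fin k2 → ℕ // Antitone g} =>
        ‖sl3qSummand q γ α1 α2 β1 (γ + 1 - β1) k1 k2 p.1.1 p.2.1‖) ∧
      ((1 - q : ℂ)) ^ (k1 + k2) *
          ∑' p : {f : Fin k1 → ℕ // Antitone f} × {g : Fin k2 → ℕ // Antitone g},
            sl3qSummand q γ α1 α2 β1 (γ + 1 - β1) k1 k2 p.1.1 p.2.1
        = (∏ i ∈ Finset.range k1,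
              (qGamma q (((α1 + ((k1 : ℝ) - ((i : ℝ) + 1)) * γ : ℝ)) : ℂ) *
                qGamma q (((β1 + (((i : ℝ) + 1) - (k2 : ℝ) - 1) * γ : ℝ)) : ℂ) *
                qGamma q (((((i : ℝ) + 1) * γ : ℝ)) : ℂ)) /
              (qGamma q
                  (((α1 + β1 + (2 * (k1 : ℝ) - (k2 : ℝ) - ((i : ℝ) + 1) - 1) * γ : ℝ)) : ℂ) *
                qGamma q ((γ : ℝ) : ℂ))) *
          (∏ i ∈ Finset.range k2,
              (qGamma q (((α2 + ((k2 : ℝ) - ((i : ℝ) + 1)) * γ : ℝ)) : ℂ) *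
                qGamma q ((((γ + 1 - β1) + (i : ℝ) * γ : ℝ)) : ℂ) *
                qGamma q (((((i : ℝ) + 1) * γ : ℝ)) : ℂ)) /
              (qGamma q
                  (((α2 + (γ + 1 - β1) +
                      (2 * (k2 : ℝ) - (k1 : ℝ) - ((i : ℝ) + 1) - 1) * γ : ℝ)) : ℂ) *
                qGamma q ((γ : ℝ) : ℂ))) *
          ∏ i ∈ Finset.range k1, ∏ j ∈ Finset.range k2,
              qGamma q
                  (((α1 + α2 +
                      ((k1 : ℝ) + (k2 : ℝ) - ((i : ℝ) + 1) - ((j : ℝ) + 1) - 1) * γ : ℝ)) : ℂ) /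
                qGamma q
                  (((α1 + α2 +
                      ((k1 : ℝ) + (k2 : ℝ) - ((i : ℝ) + 1) - ((j : ℝ) + 1)) * γ : ℝ)) : ℂ) := by
  obtain ⟨hs, he⟩ := tsum_sl3qSummand hq0 hq1 k1 k2 hγ hα1 hα2 hβ1
  refine ⟨hs.norm, ?_⟩
  have h0 : (0 : ℝ) < 1 - q := by linarith
  have hv : q ^ (γ + 1 - β1) = q ^ γ * q / q ^ β1 := by
    rw [Real.rpow_sub hq0, Real.rpow_add hq0, Real.rpow_one]
  have hδ (α β : ℝ) (k n : ℕ) : q ^ (α + β + ((k : ℝ) - (n : ℝ) - 1) * γ) =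
      q ^ α * q ^ β * (q ^ γ) ^ k / q ^ γ / (q ^ γ) ^ n := by
    rw [← Real.rpow_natCast, ← Real.rpow_natCast, ← Real.rpow_mul hq0.le, ← Real.rpow_mul hq0.le,
      ← Real.rpow_add hq0, ← Real.rpow_add hq0, ← Real.rpow_sub hq0, ← Real.rpow_sub hq0]
    ring_nf
  have hβ (i : ℕ) : q ^ (β1 - k2 * γ) * (q ^ γ) ^ i = q ^ β1 * (q ^ γ) ^ i / (q ^ γ) ^ k2 := by
    rw [Real.rpow_sub hq0, mul_comm (k2 : ℝ), Real.rpow_mul hq0.le, Real.rpow_natCast]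
    ring
  have hblock1 := prod_gamma_block hq0 hq1 γ α1 (β1 - k2 * γ)
    (α1 + β1 + ((k1 : ℝ) - (k2 : ℝ) - 1) * γ) k1
  have hblock2 := prod_gamma_block hq0 hq1 γ α2 (γ + 1 - β1)
    (α2 + (γ + 1 - β1) + ((k2 : ℝ) - (k1 : ℝ) - 1) * γ) k2
  have hcross := prod_gamma_ratio hq0 hq1 γ (α1 + α2) k1 k2
  simp only [hδ, hβ] at hblock1
  rw [hδ] at hblock2
  rw [Real.rpow_add hq0] at hcross
  have hpow : (1 - q : ℂ) ^ (k1 + k2) = (((1 - q) ^ (k1 + k2) : ℝ) : ℂ) := by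
    push_cast
    rfl
  have hexp : (1 - q) ^ (k1 + k2) =
      (1 - q) ^ ((k1 : ℝ) * (1 - α1 - (β1 - k2 * γ) +
        (α1 + β1 + ((k1 : ℝ) - (k2 : ℝ) - 1) * γ) - ((k1 : ℝ) - 1) * γ)) *
      (1 - q) ^ ((k2 : ℝ) * (1 - α2 - (γ + 1 - β1) +
        (α2 + (γ + 1 - β1) + ((k2 : ℝ) - (k1 : ℝ) - 1) * γ) - ((k2 : ℝ) - 1) * γ)) *
      (1 - q) ^ ((k1 : ℝ) * (k2 : ℝ) * γ) := by
    rw [← Real.rpow_natCast, ← Real.rpow_add h0, ← Real.rpow_add h0]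
    push_cast
    ring_nf
  have e1 (i : ℕ) : β1 + ((i : ℝ) + 1 - (k2 : ℝ) - 1) * γ = β1 - k2 * γ + (i : ℝ) * γ := by ring
  have e2 (x : ℝ) (k n i : ℕ) : x + (2 * (k : ℝ) - (n : ℝ) - ((i : ℝ) + 1) - 1) * γ =
      x + ((k : ℝ) - (n : ℝ) - 1) * γ + ((k : ℝ) - ((i : ℝ) + 1)) * γ := by ring
  simp only [e1, e2]
  rw [he, hblock1, hblock2, hcross, tsum_pairWeight hq0 hq1 (Real.rpow_pos_of_pos hq0 γ)
    (Real.rpow_lt_one hq0.le hq1 hγ) (Real.rpow_pos_of_pos hq0 α2)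
    (rpow_lt_rpow_pow hq0 hq1 hα2) (latGeneric_rpow hq0 hq1 hβ1)
    (Real.rpow_pos_of_pos hq0 β1).ne' hv (Real.rpow_pos_of_pos hq0 α1)
    (Real.rpow_lt_one hq0.le hq1 hα1), hpow, hexp, ← Complex.ofReal_mul, ← Complex.ofReal_mul,
    ← Complex.ofReal_mul]
  congr 1
  ring
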